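/- arXiv:1704.00589 — 3 statements merged into one kernel-verified Lean document; each statement's English description precedes it below -/
import Mathlib

section
/- For every n ≥ 4 and every integer p ≥ 4, every Hochschild p-cocycle with trivial coefficients on A_s(n) is a coboundary: if f : A_s(n)^p → ℂ is p-linear with δ(f) = 0, then f = δ(g) for some (p−1)-linear map g : A_s(n)^{p−1} → ℂ. That is, H^p(A_s(n), ℂ) = 0 for all p ≥ 4. -/
open scoped BigOperators

/-- The relations presenting the quantum permutation algebra `A_s(n,d)`. -/
inductive ASRel (n : ℕ) (d : Matrix (Fin n) (Fin n) ℂ) :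
    FreeAlgebra ℂ (Fin n × Fin n) → FreeAlgebra ℂ (Fin n × Fin n) → Prop
  | row_orth (i j k : Fin n) :
      ASRel n d (FreeAlgebra.ι ℂ (i, j) * FreeAlgebra.ι ℂ (i, k))
        (if j = k then FreeAlgebra.ι ℂ (i, j) else 0)
  | col_orth (i j k : Fin n) :
      ASRel n d (FreeAlgebra.ι ℂ (j, i) * FreeAlgebra.ι ℂ (k, i))
        (if j = k then FreeAlgebra.ι ℂ (j, i) else 0)
  | row_sum (i : Fin n) : ASRel n d (∑ j, FreeAlgebra.ι ℂ (i, j)) 1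
  | col_sum (i : Fin n) : ASRel n d (∑ j, FreeAlgebra.ι ℂ (j, i)) 1
  | inter (i j : Fin n) :
      ASRel n d (∑ k, d i k • FreeAlgebra.ι ℂ (k, j)) (∑ k, d k j • FreeAlgebra.ι ℂ (i, k))

/-- The quantum permutation algebra `A_s(n,d)`. -/
abbrev ASAlg (n : ℕ) (d : Matrix (Fin n) (Fin n) ℂ) := RingQuot (ASRel n d)

/-- The generators `u_{ij}` of `A_s(n,d)`. -/
noncomputable def ASu {n : ℕ} (d : Matrix (Fin n) (Fin n) ℂ) (i j : Fin n) : ASAlg n d :=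
  RingQuot.mkAlgHom ℂ (ASRel n d) (FreeAlgebra.ι ℂ (i, j))

/-- The counit `ε : A_s(n,d) → ℂ`, the unique algebra map with `ε(u_{ij}) = δ_{ij}`. -/
noncomputable def ASeps (n : ℕ) (d : Matrix (Fin n) (Fin n) ℂ) : ASAlg n d →ₐ[ℂ] ℂ :=
  RingQuot.liftAlgHom ℂ
    ⟨FreeAlgebra.lift ℂ (fun p => if p.1 = p.2 then (1 : ℂ) else 0), by
      intro a b h
      induction h with
      | row_orth i j k =>
          simp only [map_mul, FreeAlgebra.lift_ι_apply, apply_ite, map_zero]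
          split_ifs <;> simp_all
      | col_orth i j k =>
          simp only [map_mul, FreeAlgebra.lift_ι_apply, apply_ite, map_zero]
          split_ifs <;> simp_all
      | row_sum i =>
          simp [FreeAlgebra.lift_ι_apply]
      | col_sum i =>
          simp [FreeAlgebra.lift_ι_apply]
      | inter i j =>
          simp [FreeAlgebra.lift_ι_apply, smul_ite]⟩

lemma ASeps_u {n : ℕ} (d : Matrix (Fin n) (Fin n) ℂ) (i j : Fin n) :
    ASeps n d (ASu d i j) = if i = j then 1 else 0 := by
  simp [ASeps, ASu, RingQuot.liftAlgHom_mkAlgHom_apply, FreeAlgebra.lift_ι_apply]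

/-- The Hochschild differential with trivial coefficients for an augmented ℂ-algebra
`(A, ε)`: it sends a `p`-cochain `f : A^p → ℂ` to the `(p+1)`-cochain
`δ(f)(a₁,…,a_{p+1}) = ε(a₁)f(a₂,…,a_{p+1}) + Σ_{i=1}^p (−1)^i f(a₁,…,a_i a_{i+1},…,a_{p+1})
  + (−1)^{p+1} f(a₁,…,a_p)ε(a_{p+1})`. -/
noncomputable def hdiff {A : Type*} [Ring A] [Algebra ℂ A] (ε : A →ₐ[ℂ] ℂ) (p : ℕ)
    (f : (Fin p → A) → ℂ) : (Fin (p + 1) → A) → ℂ := fun a =>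
  ε (a 0) * f (fun j => a j.succ)
    + ∑ k : Fin p, (-1 : ℂ) ^ (k.val + 1) *
        f (fun j => if j.val < k.val then a j.castSucc
            else if j.val = k.val then a j.castSucc * a j.succ else a j.succ)
    + (-1 : ℂ) ^ (p + 1) * f (fun j => a j.castSucc) * ε (a (Fin.last p))

section Hochschild

variable {A W : Type} [Ring A] [Algebra ℂ A] [AddCommGroup W] [Module ℂ W]

/-- The action of `A` on linear maps `A → W` given by `(a • φ) b = φ (b * a) - b • φ a`;
Hochschild cohomology with these coefficients is that of `W` with a shift of degree. -/
noncomputable def shiftAct (ρ : A →ₙₐ[ℂ] Module.End ℂ W) :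
    A →ₙₐ[ℂ] Module.End ℂ (A →ₗ[ℂ] W) where
  toFun a :=
    { toFun := fun φ => φ ∘ₗ LinearMap.mulRight ℂ a - (ρ : A →ₗ[ℂ] Module.End ℂ W).flip (φ a)
      map_add' := fun φ ψ => by ext b; simp; abel
      map_smul' := fun c φ => by ext b; simp [smul_sub] }
  map_smul' c a := by ext φ b; simp [smul_sub]
  map_zero' := by ext φ b; simp
  map_add' a a' := by ext φ b; simp [mul_add]; abel
  map_mul' a a' := by ext φ b; simp [mul_assoc]

lemma shiftAct_apply (ρ : A →ₙₐ[ℂ] Module.End ℂ W) (a : A) (φ : A →ₗ[ℂ] W) (b : A) :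
    shiftAct ρ a φ b = φ (b * a) - ρ b (φ a) := rfl

/-- The Hochschild differential with coefficients in `W`, with `A` acting on the left through `ρ`
and on the right through `ε`. -/
noncomputable def cobd (ε : A →ₐ[ℂ] ℂ) (ρ : A →ₙₐ[ℂ] Module.End ℂ W) (p : ℕ)
    (f : (Fin p → A) → W) (a : Fin (p + 1) → A) : W :=
  ρ (a 0) (f fun j => a j.succ)
    + ∑ k : Fin p, (-1 : ℂ) ^ (k.val + 1) •
        f (fun j => if j.val < k.val then a j.castSucc
            else if j.val = k.val then a j.castSucc * a j.succ else a j.succ)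
    + ((-1 : ℂ) ^ (p + 1) * ε (a (Fin.last p))) • f (fun j => a j.castSucc)

lemma cobd_neg (ε : A →ₐ[ℂ] ℂ) (ρ : A →ₙₐ[ℂ] Module.End ℂ W) (p : ℕ)
    (f : (Fin p → A) → W) (a : Fin (p + 1) → A) :
    cobd ε ρ p (fun x => -f x) a = -cobd ε ρ p f a := by
  simp only [cobd, map_neg, smul_neg, Finset.sum_neg_distrib]
  abel

lemma cobd_shiftAct (ε : A →ₐ[ℂ] ℂ) (ρ : A →ₙₐ[ℂ] Module.End ℂ W) (p : ℕ)
    (f : (Fin (p + 1) → A) → W) (F : (Fin p → A) → A →ₗ[ℂ] W)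
    (hF : ∀ a b, F a b = f (Fin.cons b a)) (b : A) (a : Fin (p + 1) → A) :
    cobd ε ρ (p + 1) f (Fin.cons b a) = -cobd ε (shiftAct ρ) p F a b := by
  have h1 : ∀ k : Fin p, (fun j : Fin (p + 1) =>
      if j.val < k.succ.val then (Fin.cons b a : Fin (p + 2) → A) j.castSucc
      else if j.val = k.succ.val then (Fin.cons b a : Fin (p + 2) → A) j.castSucc *
        (Fin.cons b a : Fin (p + 2) → A) j.succ else (Fin.cons b a : Fin (p + 2) → A) j.succ) =
      Fin.cons b (fun j : Fin p => if j.val < k.val then a j.castSucc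
            else if j.val = k.val then a j.castSucc * a j.succ else a j.succ) := by
    intro k
    funext j
    refine Fin.cases ?_ (fun j => ?_) j
    · simp
    · simp
  have h0 : (fun j : Fin (p + 1) =>
      if j.val < (0 : Fin (p + 1)).val then (Fin.cons b a : Fin (p + 2) → A) j.castSucc
      else if j.val = (0 : Fin (p + 1)).val then (Fin.cons b a : Fin (p + 2) → A) j.castSucc *
        (Fin.cons b a : Fin (p + 2) → A) j.succ else (Fin.cons b a : Fin (p + 2) → A) j.succ) =
      Fin.cons (b * a 0) (fun j : Fin p => a j.succ) := by
    funext j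
    refine Fin.cases ?_ (fun j => ?_) j
    · simp
    · simp
  have h2 : (fun j : Fin (p + 1) => (Fin.cons b a : Fin (p + 2) → A) j.castSucc) =
      Fin.cons b (fun j : Fin p => a j.castSucc) := by
    funext j
    refine Fin.cases ?_ (fun j => ?_) j
    · simp
    · simp
  have h3 : (Fin.cons (a 0) (fun j : Fin p => a j.succ) : Fin (p + 1) → A) = a :=
    Fin.cons_self_tail a
  have h4 : (Fin.cons b a : Fin (p + 2) → A) (Fin.last (p + 1)) = a (Fin.last p) := by
    rw [← Fin.succ_last, Fin.cons_succ]
  simp only [cobd]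
  rw [Fin.sum_univ_succ, h0, h2, h4]
  simp_rw [h1]
  simp only [LinearMap.add_apply, LinearMap.sum_apply, LinearMap.smul_apply, shiftAct_apply,
    hF, h3, Fin.cons_zero, Fin.cons_succ, Fin.val_succ, pow_succ]
  simp only [Fin.val_zero, pow_zero, mul_neg, mul_one, neg_smul, one_smul, neg_neg,
    Finset.sum_neg_distrib, neg_mul]
  abel

/-- Every cocycle of degree `q + 1` with coefficients in `(W, ρ)` is a coboundary. -/
def CohomologyVanishes (ε : A →ₐ[ℂ] ℂ) (ρ : A →ₙₐ[ℂ] Module.End ℂ W) (q : ℕ) : Prop :=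
  ∀ f : MultilinearMap ℂ (fun _ : Fin (q + 1) => A) W,
    (∀ a, cobd ε ρ (q + 1) f a = 0) →
      ∃ g : MultilinearMap ℂ (fun _ : Fin q => A) W, ∀ a, f a = cobd ε ρ q g a

lemma CohomologyVanishes.of_shiftAct {ε : A →ₐ[ℂ] ℂ} {ρ : A →ₙₐ[ℂ] Module.End ℂ W} {q : ℕ}
    (h : CohomologyVanishes ε (shiftAct ρ) q) : CohomologyVanishes ε ρ (q + 1) := by
  intro f hf
  let F : MultilinearMap ℂ (fun _ : Fin (q + 1) => A) (A →ₗ[ℂ] W) :=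
    { toFun := fun a =>
        { toFun := fun b => f.curryLeft b a
          map_add' := by simp
          map_smul' := by simp }
      map_update_add' := by intro _ a i x y; ext b; simp
      map_update_smul' := by intro _ a i c x; ext b; simp }
  have hF : ∀ a b, F a b = f (Fin.cons b a) := fun a b => rfl
  obtain ⟨G, hG⟩ := h F (fun a => by
    ext b
    have := cobd_shiftAct ε ρ (q + 1) f F hF b a
    rw [hf, eq_comm, neg_eq_zero] at this
    exact this)
  let G' : A →ₗ[ℂ] MultilinearMap ℂ (fun _ : Fin q => A) W :=
    { toFun := fun b =>
        { toFun := fun a => G a b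
          map_update_add' := by intro _ a i x y; simp
          map_update_smul' := by intro _ a i c x; simp }
      map_add' := by intro b b'; ext a; simp
      map_smul' := by intro c b; ext a; simp }
  let g : MultilinearMap ℂ (fun _ : Fin (q + 1) => A) W :=
    LinearMap.uncurryLeft (M := fun _ : Fin (q + 1) => A) G'
  refine ⟨-g, fun a => ?_⟩
  have h1 := cobd_shiftAct ε ρ q g G
    (fun a b => rfl) (a 0) (Fin.tail a)
  have h2 := hF (Fin.tail a) (a 0)
  rw [Fin.cons_self_tail] at h1 h2
  have h3 := cobd_neg ε ρ (q + 1) g a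
  rw [← h2, hG]
  rw [h1, neg_neg] at h3
  exact h3.symm

/-- Vanishing of the first extension group of `N` by `(W, ρ)`, in terms of `1`-cocycles
`A → Hom(N, W)`. -/
def ExtVanishes {N : Type} [AddCommGroup N] [Module ℂ N] (act : A → N → N)
    (ρ : A →ₙₐ[ℂ] Module.End ℂ W) : Prop :=
  ∀ c : A →ₗ[ℂ] N →ₗ[ℂ] W, (∀ a b x, c (a * b) x = ρ a (c b x) + c a (act b x)) →
    ∃ φ : N →ₗ[ℂ] W, ∀ a x, c a x = ρ a (φ x) - φ (act a x)

lemma ExtVanishes.cohomologyVanishes_zero {ε : A →ₐ[ℂ] ℂ} {ρ : A →ₙₐ[ℂ] Module.End ℂ W}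
    (h : ExtVanishes (N := ℂ) (fun a x => ε a * x) ρ) : CohomologyVanishes ε ρ 0 := by
  intro f hf
  let f' : A →ₗ[ℂ] W :=
    { toFun := fun a => f.curryLeft a (fun i => i.elim0)
      map_add' := fun a b => by simp only [map_add, add_apply]
      map_smul' := fun r a => by
        simp only [map_smul, smul_apply, RingHom.id_apply] }
  have hf' : ∀ a, f a = f' (a 0) := fun a => by
    refine congrArg f (funext fun j => ?_)
    obtain rfl : j = 0 := Fin.fin_one_eq_zero j
    rfl
  have hmul : ∀ a b, f' (a * b) = ρ a (f' b) + ε b • f' a := fun a b => by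
    have := hf ![a, b]
    simp [cobd, hf'] at this
    rw [← sub_eq_zero, ← neg_eq_zero, ← this]
    abel
  obtain ⟨φ, hφ⟩ := h (LinearMap.mk₂ ℂ (fun a (x : ℂ) => x • f' a)
      (by intros; simp) (by intro r a x; simp [smul_comm r x])
      (by intros; simp [add_smul]) (by intros; simp [mul_smul]))
    (fun a b x => by simp [hmul, smul_smul, mul_comm])
  refine ⟨MultilinearMap.constOfIsEmpty ℂ _ (φ 1), fun a => ?_⟩
  have h1 := hφ (a 0) 1
  have h2 : φ (ε (a 0)) = ε (a 0) • φ 1 := by rw [← map_smul]; simp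
  simp only [LinearMap.mk₂_apply, one_smul, mul_one, h2] at h1
  rw [hf', h1]
  simp [cobd, sub_eq_add_neg]

lemma ExtVanishes.of_exact {N' P N : Type} [AddCommGroup N'] [Module ℂ N'] [AddCommGroup N]
    [Module ℂ N] [AddCommGroup P] [Module ℂ P] [Module A P] [IsScalarTower ℂ A P]
    {act' : A → N' → N'} {act : A → N → N} {ρ : A →ₙₐ[ℂ] Module.End ℂ W}
    (i : N' →ₗ[ℂ] P) (π : P →ₗ[ℂ] N) (hi : ∀ a x, i (act' a x) = a • i x)
    (hπ : ∀ a x, π (a • x) = act a (π x)) (hinj : LinearMap.ker i = ⊥)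
    (hsurj : LinearMap.range π = ⊤) (hex : LinearMap.ker π = LinearMap.range i)
    (h' : ExtVanishes act' ρ)
    (hP : ExtVanishes (fun (a : A) (x : P) => a • x) (shiftAct ρ)) :
    ExtVanishes act (shiftAct ρ) := by
  intro c hc
  obtain ⟨φ, hφ⟩ := hP (c.compl₂ π) (fun a b x => by simp [hc, hπ])
  simp only [LinearMap.compl₂_apply] at hφ
  have hπi : ∀ y, π (i y) = 0 := fun y => by
    have : i y ∈ LinearMap.ker π := hex ▸ LinearMap.mem_range_self i y
    exact this
  have hlin : ∀ b y, φ (b • i y) = shiftAct ρ b (φ (i y)) := fun b y => by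
    have := hφ b (i y)
    rw [hπi, map_zero] at this
    exact (sub_eq_zero.mp this.symm).symm
  obtain ⟨θ, hθ⟩ := h' ((φ ∘ₗ i).flip) (fun a b y => by
    simp only [LinearMap.flip_apply, LinearMap.comp_apply, hi, hlin, shiftAct_apply]
    abel)
  simp only [LinearMap.flip_apply, LinearMap.comp_apply] at hθ
  obtain ⟨r, hr⟩ := LinearMap.exists_leftInverse_of_injective i hinj
  obtain ⟨s, hs⟩ := LinearMap.exists_rightInverse_of_surjective π hsurj
  let θ' : P →ₗ[ℂ] W := θ ∘ₗ r
  have hθ' : ∀ y, θ' (i y) = θ y := fun y => by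
    have : r (i y) = y := LinearMap.congr_fun hr y
    simp [θ', this]
  let ψ : P →ₗ[ℂ] A →ₗ[ℂ] W :=
    LinearMap.mk₂ ℂ (fun y b => ρ b (θ' y) - θ' (b • y))
      (by intros; simp; abel) (by intro r y b; simp [smul_sub, smul_comm b r y])
      (by intros; simp [add_smul]; abel) (by intros; simp [smul_sub])
  have hψ : ∀ y b, ψ y b = ρ b (θ' y) - θ' (b • y) := fun y b => rfl
  have hψl : ∀ a y, ψ (a • y) = shiftAct ρ a (ψ y) := fun a y => by
    ext b
    simp only [shiftAct_apply, hψ, map_mul, map_sub, mul_smul, Module.End.mul_apply]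
    abel
  let φ' := φ - ψ
  have hφ'0 : ∀ y, π y = 0 → φ' y = 0 := fun y hy => by
    have : y ∈ LinearMap.range i := hex ▸ (LinearMap.mem_ker.mpr hy)
    obtain ⟨z, rfl⟩ := this
    ext b
    simp [φ', hψ, hθ', hθ, ← hi]
  have hs' : ∀ x, π (s x) = x := fun x => LinearMap.congr_fun hs x
  have hφ's : ∀ y, φ' (s (π y)) = φ' y := fun y => by
    rw [← sub_eq_zero, ← map_sub]
    exact hφ'0 _ (by simp [hs'])
  refine ⟨φ' ∘ₗ s, fun a x => ?_⟩
  have h1 := hφ a (s x)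
  have h2 := hφ's (a • s x)
  rw [hπ, hs'] at h2
  rw [hs'] at h1
  simp only [LinearMap.comp_apply]
  rw [h1, h2]
  simp [φ', hψl]

/-- The submodule of row vectors over `A` fixed by right multiplication by a diagonal matrix. -/
def diagFixed {ι : Type} (v : ι → A) : Submodule A (ι → A) where
  carrier := {x | ∀ i, x i * v i = x i}
  add_mem' := fun hx hy i => by simp [add_mul, hx i, hy i]
  zero_mem' := fun i => by simp
  smul_mem' := fun a x hx i => by simp [mul_assoc, hx i]

lemma extVanishes_diagFixed {ι : Type} [Fintype ι] [DecidableEq ι] (v : ι → A)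
    (hv : ∀ i, v i * v i = v i) (ρ : A →ₙₐ[ℂ] Module.End ℂ W) :
    ExtVanishes (fun (a : A) (x : diagFixed v) => a • x) ρ := by
  intro c hc
  let e : ι → diagFixed v := fun i => ⟨Pi.single i (v i), fun j => by
    rcases eq_or_ne j i with rfl | h
    · simp [hv]
    · simp [h]⟩
  have he : ∀ x : diagFixed v, x = ∑ i, x.1 i • e i := fun x => by
    ext j
    simp [e, Finset.sum_apply, Pi.single_apply, x.2 j]
  let φ : diagFixed v →ₗ[ℂ] W :=
    { toFun := fun x => -∑ i, c (x.1 i) (e i)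
      map_add' := by intro x y; simp [Finset.sum_add_distrib]; abel
      map_smul' := by intro r x; simp [Finset.smul_sum] }
  have hφ : ∀ x, φ x = -∑ i, c (x.1 i) (e i) := fun x => rfl
  refine ⟨φ, fun a x => ?_⟩
  conv_lhs => rw [he x, map_sum]
  have : ∀ i, c a (x.1 i • e i) = c (a * x.1 i) (e i) - ρ a (c (x.1 i) (e i)) := fun i => by
    rw [hc]; abel
  simp only [this, hφ, Finset.sum_sub_distrib, map_neg, map_sum]
  simp [sub_eq_add_neg]
  abel

lemma extVanishes_self (ρ : A →ₙₐ[ℂ] Module.End ℂ W) :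
    ExtVanishes (fun (a : A) (x : A) => a * x) ρ := by
  intro c hc
  refine ⟨-(c.flip 1), fun a x => ?_⟩
  have : c (a * x) 1 = ρ a (c x 1) + c a (x * 1) := hc a x 1
  rw [mul_one] at this
  simp [this]

end Hochschild

section Magic

/-- A magic unitary: the entries of each row and each column are orthogonal idempotents with
sum `1`. -/
structure IsMagic {n : ℕ} {B : Type} [Ring B] (u : Fin n → Fin n → B) : Prop where
  row : ∀ i j k, u i j * u i k = if j = k then u i j else 0
  col : ∀ i j k, u j i * u k i = if j = k then u j i else 0
  row_sum : ∀ i, ∑ j, u i j = 1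
  col_sum : ∀ i, ∑ j, u j i = 1

/-- A magic unitary whose entries freely generate `A` among magic unitaries. -/
structure IsUniversalMagic {n : ℕ} {A : Type} [Ring A] [Algebra ℂ A] (u : Fin n → Fin n → A) : Prop
    extends IsMagic u where
  adjoin_eq_top : Algebra.adjoin ℂ (Set.range fun p : Fin n × Fin n => u p.1 p.2) = ⊤
  exists_lift : ∀ {B : Type} [Ring B] [Algebra ℂ B] (w : Fin n → Fin n → B), IsMagic w →
    ∃ F : A →ₐ[ℂ] B, ∀ i j, F (u i j) = w i j

variable {n : ℕ} {A : Type} [Ring A] {u : Fin n → Fin n → A}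

/-- The off-diagonal entries of a magic unitary. -/
def offDiag (u : Fin n → Fin n → A) (p : Fin n × Fin n) : A := if p.1 = p.2 then 0 else u p.1 p.2

lemma IsMagic.offDiag_mul_self (hu : IsMagic u) (p : Fin n × Fin n) :
    offDiag u p * offDiag u p = offDiag u p := by
  unfold offDiag
  split_ifs
  · simp
  · simp [hu.row]

lemma IsMagic.offDiag_mul_diag (hu : IsMagic u) (i j : Fin n) : offDiag u (i, j) * u j j = 0 := by
  unfold offDiag
  split_ifs with h
  · simp
  · simp only [hu.col]; exact if_neg h

lemma IsMagic.diag_mul_offDiag (hu : IsMagic u) (i j : Fin n) : u i i * offDiag u (i, j) = 0 := by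
  unfold offDiag
  split_ifs with h
  · simp
  · simp only [hu.row]; exact if_neg h

lemma IsMagic.sum_offDiag (hu : IsMagic u) (i : Fin n) : ∑ j, offDiag u (i, j) = 1 - u i i := by
  have : ∀ j, offDiag u (i, j) = u i j - if i = j then u i j else 0 := fun j => by
    unfold offDiag
    split_ifs <;> simp
  simp [this, hu.row_sum]

lemma IsMagic.sum_offDiag_left (hu : IsMagic u) (j : Fin n) :
    ∑ i, offDiag u (i, j) = 1 - u j j := by
  have : ∀ i, offDiag u (i, j) = u i j - if i = j then u i j else 0 := fun i => by
    unfold offDiag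
    split_ifs <;> simp
  simp [this, hu.col_sum]

/-- The augmentation `x ↦ ∑ x_{ij}` on the submodule fixed by the off-diagonal entries. -/
def sumMap (u : Fin n → Fin n → A) : diagFixed (offDiag u) →ₗ[A] A where
  toFun x := ∑ p, x.1 p
  map_add' x y := by simp [Finset.sum_add_distrib]
  map_smul' a x := by simp [Finset.mul_sum]

/-- The map `x ↦ (x_{jl} - (∑_i x_{ij}) v_{jl})`. -/
def colMap (hu : IsMagic u) : diagFixed (offDiag u) →ₗ[A] diagFixed (offDiag u) where
  toFun x := ⟨fun p => x.1 p - (∑ i, x.1 (i, p.1)) * offDiag u p, fun p => by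
    rw [sub_mul, x.2 p, mul_assoc, hu.offDiag_mul_self]⟩
  map_add' x y := by
    ext p
    simp [Finset.sum_add_distrib, add_mul]
    abel
  map_smul' a x := by
    ext p
    simp [← Finset.mul_sum, mul_sub, mul_assoc]

/-- The map `a ↦ (a v_{ij})`. -/
def mulMap (hu : IsMagic u) : A →ₗ[A] diagFixed (offDiag u) where
  toFun a := ⟨fun p => a * offDiag u p, fun p => by rw [mul_assoc, hu.offDiag_mul_self]⟩
  map_add' x y := by
    ext p
    simp [add_mul]
  map_smul' a x := by
    ext p
    simp [mul_assoc]

/-- The row vector with entry `v_{ij}` at `(i, j)` and zero elsewhere. -/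
def unitRow (hu : IsMagic u) (p : Fin n × Fin n) : diagFixed (offDiag u) :=
  ⟨Pi.single p (offDiag u p), fun q => by
    rcases eq_or_ne q p with rfl | h
    · simp [hu.offDiag_mul_self]
    · simp [h]⟩

lemma eq_sum_unitRow (hu : IsMagic u) (x : diagFixed (offDiag u)) :
    x = ∑ p, x.1 p • unitRow hu p := by
  ext q
  simp [unitRow, Finset.sum_apply, Pi.single_apply, x.2 q]

lemma sumMap_unitRow (hu : IsMagic u) (p : Fin n × Fin n) :
    sumMap u (unitRow hu p) = offDiag u p := by
  simp [sumMap, unitRow]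

lemma unitRow_diag (hu : IsMagic u) (i : Fin n) : unitRow hu (i, i) = 0 := by
  ext q
  simp [unitRow, offDiag]

lemma mul_offDiag_smul_unitRow (hu : IsMagic u) (p : Fin n × Fin n) :
    offDiag u p • unitRow hu p = unitRow hu p := by
  ext q
  rcases eq_or_ne q p with rfl | h
  · simp [unitRow, hu.offDiag_mul_self]
  · simp [unitRow, h]

lemma colMap_unitRow (hu : IsMagic u) (i j : Fin n) :
    colMap hu (unitRow hu (i, j)) =
      unitRow hu (i, j) - offDiag u (i, j) • ∑ l, unitRow hu (j, l) := by
  ext ⟨a, b⟩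
  simp only [colMap, unitRow, LinearMap.coe_mk, AddHom.coe_mk, Submodule.coe_sub,
    Submodule.coe_smul, Submodule.coe_sum, Pi.sub_apply, Pi.smul_apply, Finset.sum_apply,
    smul_eq_mul, Pi.single_apply, Prod.mk.injEq]
  congr 1
  rcases eq_or_ne a j with rfl | h
  · simp
  · simp [h]

lemma sumMap_colMap (hu : IsMagic u) (x : diagFixed (offDiag u)) :
    sumMap u (colMap hu x) = 0 := by
  rw [eq_sum_unitRow hu x]
  simp only [map_sum, map_smul]
  refine Finset.sum_eq_zero fun p _ => ?_
  obtain ⟨i, j⟩ := p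
  rw [colMap_unitRow, map_sub, map_smul, map_sum]
  simp only [sumMap_unitRow, hu.sum_offDiag, smul_eq_mul, mul_sub, mul_one, hu.offDiag_mul_diag]
  simp

lemma colMap_mulMap (hu : IsMagic u) (a : A) : colMap hu (mulMap hu a) = 0 := by
  ext ⟨j, l⟩
  simp [colMap, mulMap, ← Finset.mul_sum, hu.sum_offDiag_left, mul_assoc, sub_mul,
      hu.diag_mul_offDiag]

variable [Algebra ℂ A]

lemma IsUniversalMagic.induction (hu : IsUniversalMagic u) {p : A → Prop}
    (gen : ∀ i j, p (u i j)) (scalar : ∀ r, p (algebraMap ℂ A r))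
    (add : ∀ a b, p a → p b → p (a + b)) (mul : ∀ a b, p a → p b → p (a * b)) (a : A) : p a := by
  have ha : a ∈ Algebra.adjoin ℂ (Set.range fun p : Fin n × Fin n => u p.1 p.2) := by
    rw [hu.adjoin_eq_top]; trivial
  induction ha using Algebra.adjoin_induction with
  | mem x hx => obtain ⟨q, rfl⟩ := hx; exact gen _ _
  | algebraMap r => exact scalar r
  | add x y _ _ hx hy => exact add x y hx hy
  | mul x y _ _ hx hy => exact mul x y hx hy

lemma IsUniversalMagic.mem_of_mul_right (hu : IsUniversalMagic u) (S : Submodule ℂ A)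
    (h1 : (1 : A) ∈ S) (hS : ∀ s ∈ S, ∀ i j, s * u i j ∈ S) (a : A) : a ∈ S := by
  have : ∀ s ∈ S, s * a ∈ S := by
    induction a using hu.induction with
    | gen i j => exact fun s hs => hS s hs i j
    | scalar r =>
      intro s hs
      rw [← Algebra.commutes, ← Algebra.smul_def]
      exact S.smul_mem r hs
    | add a b ha hb => exact fun s hs => by rw [mul_add]; exact S.add_mem (ha s hs) (hb s hs)
    | mul a b ha hb => exact fun s hs => by rw [← mul_assoc]; exact hb _ (ha s hs)
  simpa using this 1 h1

lemma IsUniversalMagic.exists_derivation (hu : IsUniversalMagic u) {ε : A →ₐ[ℂ] ℂ}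
    (hε : ∀ i j, ε (u i j) = if i = j then 1 else 0) {Q : Type} [AddCommGroup Q] [Module ℂ Q]
    [Module A Q] [IsScalarTower ℂ A Q] (E : Fin n → Fin n → Q)
    (row : ∀ i j k, u i j • E i k + (if i = k then E i j else 0) = if j = k then E i j else 0)
    (col : ∀ i j k, u j i • E k i + (if k = i then E j i else 0) = if j = k then E j i else 0)
    (row_sum : ∀ i, ∑ j, E i j = 0) (col_sum : ∀ i, ∑ j, E j i = 0) :
    ∃ D : A →ₗ[ℂ] Q, (∀ a b, D (a * b) = a • D b + ε b • D a) ∧ ∀ i j, D (u i j) = E i j := by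
  let w : Fin n → Fin n → Module.End ℂ (Q × ℂ) := fun i j =>
    { toFun := fun x => (u i j • x.1 + x.2 • E i j, (if i = j then 1 else 0) * x.2)
      map_add' := fun x y => by ext <;> simp [add_smul, mul_add]; abel
      map_smul' := fun r x => by
        ext
        · simp [mul_smul, smul_comm r (u i j)]
        · simp }
  have hwa : ∀ i j x, w i j x = (u i j • x.1 + x.2 • E i j, (if i = j then 1 else 0) * x.2) :=
    fun _ _ _ => rfl
  have hw : IsMagic w := by
    refine ⟨fun i j k => ?_, fun i j k => ?_, fun i => ?_, fun i => ?_⟩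
    · refine LinearMap.ext fun x => Prod.ext ?_ ?_
      · have h : (w i j * w i k) x = w i j (w i k x) := rfl
        have h1 : (w i j (w i k x)).1 = (u i j * u i k) • x.1 +
            x.2 • (u i j • E i k + if i = k then E i j else 0) := by
          simp only [hwa, smul_add, mul_smul, smul_comm (u i j) x.2]
          split_ifs <;> simp [add_assoc]
        rw [h, h1, row, hu.row]
        split_ifs <;> simp [hwa]
      · have h : (w i j * w i k) x = w i j (w i k x) := rfl
        rw [h]
        by_cases h1 : i = k <;> by_cases h2 : j = k <;> by_cases h3 : i = j <;> simp_all
    · refine LinearMap.ext fun x => Prod.ext ?_ ?_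
      · have h : (w j i * w k i) x = w j i (w k i x) := rfl
        have h1 : (w j i (w k i x)).1 = (u j i * u k i) • x.1 +
            x.2 • (u j i • E k i + if k = i then E j i else 0) := by
          simp only [hwa, smul_add, mul_smul, smul_comm (u j i) x.2]
          split_ifs <;> simp [add_assoc]
        rw [h, h1, col, hu.col]
        split_ifs <;> simp [hwa]
      · have h : (w j i * w k i) x = w j i (w k i x) := rfl
        rw [h]
        by_cases h1 : k = i <;> by_cases h2 : j = k <;> by_cases h3 : j = i <;> simp_all
    · refine LinearMap.ext fun x => ?_
      rw [LinearMap.sum_apply]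
      ext
      · simp [hwa, Prod.fst_sum, Finset.sum_add_distrib, ← Finset.smul_sum, ← Finset.sum_smul,
          row_sum, hu.row_sum]
      · simp [hwa, Prod.snd_sum]
    · refine LinearMap.ext fun x => ?_
      rw [LinearMap.sum_apply]
      ext
      · simp [hwa, Prod.fst_sum, Finset.sum_add_distrib, ← Finset.smul_sum, ← Finset.sum_smul,
          col_sum, hu.col_sum]
      · simp [hwa, Prod.snd_sum]
  obtain ⟨F, hF⟩ := hu.exists_lift w hw
  have key : ∀ a, ∃ d : Q, ∀ x, F a x = (a • x.1 + x.2 • d, ε a * x.2) := fun a => by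
    induction a using hu.induction with
    | gen i j => exact ⟨E i j, fun x => by rw [hF, hwa, hε]⟩
    | scalar r => exact ⟨0, fun x => by ext <;> simp [Module.algebraMap_end_apply]⟩
    | add a b ha hb =>
      obtain ⟨d, hd⟩ := ha
      obtain ⟨d', hd'⟩ := hb
      refine ⟨d + d', fun x => ?_⟩
      rw [map_add, LinearMap.add_apply, hd, hd']
      ext
      · simp [add_smul]; abel
      · simp [add_mul]
    | mul a b ha hb =>
      obtain ⟨d, hd⟩ := ha
      obtain ⟨d', hd'⟩ := hb
      refine ⟨a • d' + ε b • d, fun x => ?_⟩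
      rw [map_mul, Module.End.mul_apply, hd', hd]
      ext
      · simp [mul_smul, smul_comm x.2 a, smul_comm x.2 (ε b)]; abel
      · simp [mul_assoc]
  let D : A →ₗ[ℂ] Q := LinearMap.fst ℂ Q ℂ ∘ₗ (LinearMap.applyₗ ((0 : Q), (1 : ℂ))) ∘ₗ F.toLinearMap
  have hD : ∀ a x, F a x = (a • x.1 + x.2 • D a, ε a * x.2) := fun a x => by
    obtain ⟨d, hd⟩ := key a
    have : D a = d := by simp [D, hd]
    rw [hd, this]
  refine ⟨D, fun a b => ?_, fun i j => ?_⟩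
  · have h1 := hD (a * b) (0, 1)
    rw [map_mul, Module.End.mul_apply, hD b, hD a] at h1
    simpa using (congrArg Prod.fst h1).symm
  · have h1 := hD (u i j) (0, 1)
    rw [hF, hwa] at h1
    simpa using (congrArg Prod.fst h1).symm

end Magic

section Exactness

variable {n : ℕ} {A : Type} [Ring A] [Algebra ℂ A] {u : Fin n → Fin n → A} {ε : A →ₐ[ℂ] ℂ}

lemma augmentation_offDiag (hε : ∀ i j, ε (u i j) = if i = j then 1 else 0) (p : Fin n × Fin n) :
    ε (offDiag u p) = 0 := by
  unfold offDiag
  split_ifs with h <;> simp [hε, h]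

lemma augmentation_sumMap (hε : ∀ i j, ε (u i j) = if i = j then 1 else 0)
    (x : diagFixed (offDiag u)) : ε (sumMap u x) = 0 := by
  have : sumMap u x = ∑ p, x.1 p * offDiag u p := Finset.sum_congr rfl fun p _ => (x.2 p).symm
  simp [this, augmentation_offDiag hε]

lemma exists_sumMap_eq (hu : IsUniversalMagic u) (hε : ∀ i j, ε (u i j) = if i = j then 1 else 0)
    (a : A) (ha : ε a = 0) : ∃ x, sumMap u x = a := by
  let R : Submodule A A := LinearMap.range (sumMap u)
  let S : Submodule ℂ A :=
    (R.restrictScalars ℂ).comap (LinearMap.id - (Algebra.linearMap ℂ A) ∘ₗ ε.toLinearMap)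
  have hS : ∀ b, b ∈ S ↔ b - algebraMap ℂ A (ε b) ∈ R := fun b => Iff.rfl
  have hoff : ∀ p, offDiag u p ∈ R := fun p =>
    ⟨unitRow hu.toIsMagic p, sumMap_unitRow hu.toIsMagic p⟩
  have hgen : ∀ i j, u i j - algebraMap ℂ A (if i = j then 1 else 0) ∈ R := fun i j => by
    rcases eq_or_ne i j with rfl | h
    · have := R.neg_mem (R.sum_mem fun j (_ : j ∈ Finset.univ) => hoff (i, j))
      rw [hu.sum_offDiag] at this
      simpa using this
    · have := hoff (i, j)
      simpa [offDiag, h] using this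
  have := hu.mem_of_mul_right S (by simp [hS]) (fun s hs i j => by
    rw [hS] at hs ⊢
    have h1 : s * u i j - algebraMap ℂ A (ε (s * u i j)) =
        s • (u i j - algebraMap ℂ A (if i = j then 1 else 0)) +
          (algebraMap ℂ A (if i = j then 1 else 0)) • (s - algebraMap ℂ A (ε s)) := by
      rw [map_mul, hε]
      split_ifs <;> simp [mul_sub]
    rw [h1]
    exact R.add_mem (R.smul_mem _ (hgen i j)) (R.smul_mem _ hs)) a
  rw [hS, ha, map_zero, sub_zero] at this
  exact this

lemma exists_colMap_eq (hu : IsUniversalMagic u) (hε : ∀ i j, ε (u i j) = if i = j then 1 else 0)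
    (x : diagFixed (offDiag u)) (hx : sumMap u x = 0) : ∃ y, colMap hu.toIsMagic y = x := by
  have hm := hu.toIsMagic
  let R : Submodule A (diagFixed (offDiag u)) := LinearMap.range (colMap hm)
  let e : Fin n → Fin n → diagFixed (offDiag u) ⧸ R := fun i j => R.mkQ (unitRow hm (i, j))
  have he0 : ∀ i, e i i = 0 := fun i => by simp [e, unitRow_diag]
  let s : Fin n → diagFixed (offDiag u) ⧸ R := fun i => ∑ j, e i j
  let E : Fin n → Fin n → diagFixed (offDiag u) ⧸ R := fun i j => e i j - if i = j then s i else 0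
  have hvs : ∀ i j, offDiag u (i, j) • s j = e i j := fun i j => by
    have : R.mkQ (colMap hm (unitRow hm (i, j))) = 0 := by
      rw [Submodule.mkQ_apply, Submodule.Quotient.mk_eq_zero]
      exact LinearMap.mem_range_self _ _
    rw [colMap_unitRow, map_sub, map_smul, map_sum, sub_eq_zero] at this
    exact this.symm
  have hve : ∀ i j, offDiag u (i, j) • e i j = e i j := fun i j => by
    simp only [e]
    rw [← map_smul, mul_offDiag_smul_unitRow]
  have hrow : ∀ i j k, u i j • e i k = if j = k then e i k else 0 := fun i j k => by
    rcases eq_or_ne i k with rfl | h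
    · simp [he0]
    · rw [← hve i k, ← mul_smul]
      simp only [offDiag, if_neg h, hm.row]
      split_ifs with h1
      · subst h1; simp
      · simp
  have hcol : ∀ i j k, u j i • e k i = if j = k then e k i else 0 := fun i j k => by
    rcases eq_or_ne k i with rfl | h
    · simp [he0]
    · rw [← hve k i, ← mul_smul]
      simp only [offDiag, if_neg h, hm.col]
      split_ifs with h1
      · subst h1; simp
      · simp
  have hrs : ∀ i j, u i j • s i = e i j := fun i j => by
    simp [s, Finset.smul_sum, hrow]
  have hcs : ∀ i j, i ≠ j → u i j • s j = e i j := fun i j h => by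
    rw [← hvs i j]
    simp [offDiag, h]
  obtain ⟨D, hD, hDu⟩ := hu.exists_derivation hε E
    (fun i j k => by
      simp only [E, smul_sub, hrow, smul_ite, smul_zero, hrs]
      rcases eq_or_ne i k with rfl | h1
      · rcases eq_or_ne j i with rfl | h2
        · simp [he0]
        · simp [h2, h2.symm]
      · rcases eq_or_ne j k with rfl | h2
        · simp [h1]
        · simp [h1, h2])
    (fun i j k => by
      simp only [E, smul_sub, hcol, smul_ite, smul_zero]
      rcases eq_or_ne k i with rfl | h1
      · rcases eq_or_ne j k with rfl | h2
        · simp [he0, hrs]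
        · simp [h2, hcs _ _ h2]
      · rcases eq_or_ne j k with rfl | h2
        · simp [h1]
        · simp [h1, h2])
    (fun i => by simp [E, s])
    (fun i => by
      have h1 : ∀ j, e j i = u j i • s i - if j = i then u i i • s i else 0 := fun j => by
        rcases eq_or_ne j i with rfl | h
        · simp [he0]
        · simp [h, hcs _ _ h]
      have h2 : ∑ j, e j i = s i := by
        rw [Finset.sum_congr rfl fun j _ => h1 j]
        simp [← Finset.sum_smul, hm.col_sum, hrs, he0]
      simp [E, h2])
  have hDv : ∀ p, D (x.1 p) = x.1 p • e p.1 p.2 := fun ⟨i, j⟩ => by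
    rw [← x.2 (i, j), hD, augmentation_offDiag hε, mul_smul, hve]
    rcases eq_or_ne i j with rfl | h
    · simp [offDiag, he0]
    · simp [offDiag, h, hDu, E]
  have h0 : R.mkQ x = 0 := by
    have h1 : D (∑ p, x.1 p) = 0 := by
      have : ∑ p, x.1 p = 0 := hx
      rw [this, map_zero]
    rw [eq_sum_unitRow hm x]
    simp only [map_sum, map_smul]
    rw [map_sum] at h1
    simpa only [hDv] using h1
  rw [Submodule.mkQ_apply, Submodule.Quotient.mk_eq_zero] at h0
  exact h0

end Exactness

section Resolution

variable {n : ℕ} {A : Type} [Ring A] {u : Fin n → Fin n → A}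

lemma exists_mulMap_eq (hu : IsMagic u)
    (hex : ∀ x : diagFixed (offDiag u), (∀ j, ∑ l, x.1 (j, l) = ∑ i, x.1 (i, j)) →
      ∃ a, mulMap hu a = x)
    (x : diagFixed (offDiag u)) (hx : colMap hu x = 0) : ∃ a, mulMap hu a = x := by
  refine hex x fun j => ?_
  have h1 : ∀ p, x.1 p = (∑ i, x.1 (i, p.1)) * offDiag u p := fun p =>
    sub_eq_zero.mp (congrFun (congrArg Subtype.val hx) p)
  have h2 : (∑ i, x.1 (i, j)) * u j j = 0 := by
    rw [Finset.sum_mul]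
    refine Finset.sum_eq_zero fun i _ => ?_
    rw [← x.2 (i, j), mul_assoc, hu.offDiag_mul_diag, mul_zero]
  have h3 : ∀ l, x.1 (j, l) = (∑ i, x.1 (i, j)) * offDiag u (j, l) := fun l => h1 (j, l)
  rw [Finset.sum_congr rfl fun l _ => h3 l, ← Finset.mul_sum, hu.sum_offDiag, mul_sub, h2]
  simp

variable [Algebra ℂ A] {ε : A →ₐ[ℂ] ℂ}

theorem cohomologyVanishes_add_three (hu : IsUniversalMagic u)
    (hε : ∀ i j, ε (u i j) = if i = j then 1 else 0)
    (hinj : ∀ a : A, (∀ i j, i ≠ j → a * u i j = 0) → a = 0)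
    (hex : ∀ x : diagFixed (offDiag u), (∀ j, ∑ l, x.1 (j, l) = ∑ i, x.1 (i, j)) →
      ∃ a, mulMap hu.toIsMagic a = x) (q : ℕ) :
    ∀ {W : Type} [AddCommGroup W] [Module ℂ W] (ρ : A →ₙₐ[ℂ] Module.End ℂ W),
      CohomologyVanishes ε ρ (q + 3) := by
  have hm := hu.toIsMagic
  induction q with
  | succ q ih => exact fun ρ => (ih (shiftAct ρ)).of_shiftAct
  | zero =>
    intro W _ _ ρ
    refine CohomologyVanishes.of_shiftAct (CohomologyVanishes.of_shiftAct
      (CohomologyVanishes.of_shiftAct (ExtVanishes.cohomologyVanishes_zero ?_)))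
    have hP : ∀ {W : Type} [AddCommGroup W] [Module ℂ W] (ρ : A →ₙₐ[ℂ] Module.End ℂ W),
        ExtVanishes (fun (a : A) (x : diagFixed (offDiag u)) => a • x) ρ := fun ρ =>
      extVanishes_diagFixed _ hm.offDiag_mul_self ρ
    have ext1 : ExtVanishes (fun (a : A) (x : LinearMap.ker (sumMap u)) => a • x)
        (shiftAct ρ) := by
      refine ExtVanishes.of_exact ((mulMap hm).restrictScalars ℂ)
        (((colMap hm).codRestrict (LinearMap.ker (sumMap u))
          (sumMap_colMap hm)).restrictScalars ℂ)
        (fun a x => ?_) (fun a x => ?_) ?_ ?_ ?_ (extVanishes_self ρ) (hP _)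
      · exact map_smul (mulMap hm) a x
      · exact map_smul ((colMap hm).codRestrict (LinearMap.ker (sumMap u)) (sumMap_colMap hm)) a x
      · rw [LinearMap.ker_eq_bot']
        intro a ha
        refine hinj a fun i j hij => ?_
        have := congrFun (congrArg Subtype.val ha) (i, j)
        simpa [mulMap, offDiag, hij] using this
      · rw [LinearMap.range_eq_top]
        rintro ⟨x, hx⟩
        obtain ⟨y, hy⟩ := exists_colMap_eq hu hε x hx
        exact ⟨y, Subtype.ext hy⟩
      · ext x
        constructor
        · intro hx
          exact exists_mulMap_eq hm hex x (congrArg Subtype.val hx)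
        · rintro ⟨a, rfl⟩
          exact Subtype.ext (colMap_mulMap hm a)
    have ext2 : ExtVanishes (fun (a : A) (x : LinearMap.range (sumMap u)) => a • x)
        (shiftAct (shiftAct ρ)) := by
      refine ExtVanishes.of_exact ((LinearMap.ker (sumMap u)).subtype.restrictScalars ℂ)
        ((sumMap u).rangeRestrict.restrictScalars ℂ)
        (fun a x => rfl) (fun a x => map_smul (sumMap u).rangeRestrict a x) ?_ ?_ ?_ ext1 (hP _)
      · exact LinearMap.ker_eq_bot_of_injective Subtype.val_injective
      · exact LinearMap.range_eq_top.mpr (sumMap u).surjective_rangeRestrict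
      · ext x
        constructor
        · intro hx
          exact ⟨⟨x, congrArg Subtype.val hx⟩, rfl⟩
        · rintro ⟨y, rfl⟩
          exact Subtype.ext y.2
    refine ExtVanishes.of_exact ((LinearMap.range (sumMap u)).subtype.restrictScalars ℂ)
      ε.toLinearMap (fun a x => rfl) (fun a x => map_mul ε a x) ?_ ?_ ?_ ext2
      (extVanishes_self _)
    · exact LinearMap.ker_eq_bot_of_injective Subtype.val_injective
    · exact LinearMap.range_eq_top.mpr fun r => ⟨algebraMap ℂ A r, by simp⟩
    · ext a
      constructor
      · intro ha
        obtain ⟨x, hx⟩ := exists_sumMap_eq hu hε a ha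
        exact ⟨⟨a, x, hx⟩, rfl⟩
      · rintro ⟨⟨_, x, rfl⟩, rfl⟩
        exact augmentation_sumMap hε x

end Resolution

/-- A space with two commuting families of `n` idempotents, each with sum a scalar `σ ≥ 2`. -/
structure Level (n : ℕ) where
  X : Type
  [addCommGroup : AddCommGroup X]
  [module : Module ℂ X]
  P : Fin n → X →ₗ[ℂ] X
  Q : Fin n → X →ₗ[ℂ] X
  σ : ℝ
  two_le : 2 ≤ σ
  P_P : ∀ i x, P i (P i x) = P i x
  Q_Q : ∀ i x, Q i (Q i x) = Q i x
  P_Q : ∀ i j x, P i (Q j x) = Q j (P i x)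
  sum_P : ∀ x, ∑ i, P i x = (σ : ℂ) • x
  sum_Q : ∀ x, ∑ j, Q j x = (σ : ℂ) • x

namespace Level

attribute [instance] Level.addCommGroup Level.module

variable {n : ℕ} (l : Level n)

/-- The inverse of the scalar `σ`. -/
noncomputable def s : ℂ := (l.σ : ℂ)⁻¹

/-- The inverse of the scalar `1 - 1 / σ`. -/
noncomputable def t : ℂ := (1 - l.s)⁻¹

lemma σ_mul_s : (l.σ : ℂ) * l.s = 1 := by
  have := l.two_le
  exact mul_inv_cancel₀ (by exact_mod_cast (by linarith : l.σ ≠ 0))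

lemma s_mul_σ : l.s * (l.σ : ℂ) = 1 := by rw [mul_comm, l.σ_mul_s]

lemma t_mul : l.t * (1 - l.s) = 1 := by
  refine inv_mul_cancel₀ fun h => ?_
  have h1 := l.σ_mul_s
  rw [← sub_eq_zero.mp h, mul_one] at h1
  have h2 : l.σ = 1 := by exact_mod_cast h1
  linarith [l.two_le]

/-- The operator `δ_{il} - s P_l`. -/
noncomputable def α (i k : Fin n) : l.X →ₗ[ℂ] l.X :=
  (if i = k then LinearMap.id else 0) - l.s • l.P k

/-- The operator `δ_{jm} - s Q_m`. -/
noncomputable def β (j m : Fin n) : l.X →ₗ[ℂ] l.X :=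
  (if j = m then LinearMap.id else 0) - l.s • l.Q m

lemma α_apply (i k : Fin n) (x : l.X) :
    l.α i k x = (if i = k then x else 0) - l.s • l.P k x := by
  unfold α
  split_ifs <;> simp

lemma β_apply (j m : Fin n) (x : l.X) :
    l.β j m x = (if j = m then x else 0) - l.s • l.Q m x := by
  unfold β
  split_ifs <;> simp

/-- The space of matrices over `X` whose `(i, j)` entry is fixed by `P_i` and `Q_j` and whose rows
and columns have sum zero. -/
def nextSpace : Submodule ℂ (Fin n → Fin n → l.X) where
  carrier := {x | (∀ i j, l.P i (x i j) = x i j) ∧ (∀ i j, l.Q j (x i j) = x i j) ∧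
    (∀ i, ∑ j, x i j = 0) ∧ ∀ j, ∑ i, x i j = 0}
  add_mem' := fun {x y} hx hy => by
    refine ⟨fun i j => ?_, fun i j => ?_, fun i => ?_, fun j => ?_⟩
    · simp [hx.1 i j, hy.1 i j]
    · simp [hx.2.1 i j, hy.2.1 i j]
    · simp [Finset.sum_add_distrib, hx.2.2.1 i, hy.2.2.1 i]
    · simp [Finset.sum_add_distrib, hx.2.2.2 j, hy.2.2.2 j]
  zero_mem' := by simp
  smul_mem' := fun c x hx => by
    refine ⟨fun i j => ?_, fun i j => ?_, fun i => ?_, fun j => ?_⟩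
    · simp [hx.1 i j]
    · simp [hx.2.1 i j]
    · simp [← Finset.smul_sum, hx.2.2.1 i]
    · simp [← Finset.smul_sum, hx.2.2.2 j]

variable {l}

lemma nextSpace_P (x : l.nextSpace) (i j : Fin n) : l.P i (x.1 i j) = x.1 i j := x.2.1 i j

lemma nextSpace_Q (x : l.nextSpace) (i j : Fin n) : l.Q j (x.1 i j) = x.1 i j := x.2.2.1 i j

lemma nextSpace_sum_row (x : l.nextSpace) (i : Fin n) : ∑ j, x.1 i j = 0 := x.2.2.2.1 i

lemma nextSpace_sum_col (x : l.nextSpace) (j : Fin n) : ∑ i, x.1 i j = 0 := x.2.2.2.2 j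

lemma P_α {x : l.X} {i k : Fin n} (h : l.P i x = x) : l.P k (l.α i k x) = l.α i k x := by
  rw [α_apply]
  rcases eq_or_ne i k with rfl | hik
  · simp [h]
  · simp [hik, l.P_P]

lemma Q_α {x : l.X} {i k m : Fin n} (h : l.Q m x = x) : l.Q m (l.α i k x) = l.α i k x := by
  rw [α_apply, map_sub, map_smul, ← l.P_Q, h]
  split_ifs <;> simp [h]

lemma Q_β {x : l.X} {j m : Fin n} (h : l.Q j x = x) : l.Q m (l.β j m x) = l.β j m x := by
  rw [β_apply]
  rcases eq_or_ne j m with rfl | hjm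
  · simp [h]
  · simp [hjm, l.Q_Q]

lemma P_β {x : l.X} {j m k : Fin n} (h : l.P k x = x) : l.P k (l.β j m x) = l.β j m x := by
  rw [β_apply, map_sub, map_smul, l.P_Q, h]
  split_ifs <;> simp [h]

lemma α_β (i k j m : Fin n) (x : l.X) : l.α i k (l.β j m x) = l.β j m (l.α i k x) := by
  simp only [α_apply, β_apply, map_sub, map_smul, l.P_Q]
  split_ifs <;> (try simp only [map_zero]) <;> module

lemma α_self {x : l.X} {i : Fin n} (h : l.P i x = x) : l.t • l.α i i x = x := by
  have : l.α i i x = (1 - l.s) • x := by simp [α_apply, h, sub_smul]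
  rw [this, smul_smul, l.t_mul, one_smul]

lemma β_self {x : l.X} {j : Fin n} (h : l.Q j x = x) : l.t • l.β j j x = x := by
  have : l.β j j x = (1 - l.s) • x := by simp [β_apply, h, sub_smul]
  rw [this, smul_smul, l.t_mul, one_smul]

lemma sum_α_right (i : Fin n) (x : l.X) : ∑ k, l.α i k x = 0 := by
  simp [α_apply, Finset.sum_sub_distrib, ← Finset.smul_sum, l.sum_P, smul_smul, l.s_mul_σ,
    -Complex.coe_smul]

lemma sum_β_right (j : Fin n) (x : l.X) : ∑ m, l.β j m x = 0 := by
  simp [β_apply, Finset.sum_sub_distrib, ← Finset.smul_sum, l.sum_Q, smul_smul, l.s_mul_σ,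
    -Complex.coe_smul]

lemma sum_α (k : Fin n) (x : Fin n → l.X) : ∑ i, l.α i k (x i) = x k - l.s • l.P k (∑ i, x i) := by
  simp [α_apply, Finset.sum_sub_distrib, ← Finset.smul_sum]

lemma sum_β (m : Fin n) (x : Fin n → l.X) : ∑ j, l.β j m (x j) = x m - l.s • l.Q m (∑ j, x j) := by
  simp [β_apply, Finset.sum_sub_distrib, ← Finset.smul_sum]

variable (l)

/-- The idempotents `P_i` on `nextSpace`. -/
noncomputable def nextP (i : Fin n) : l.nextSpace →ₗ[ℂ] l.nextSpace where
  toFun x := ⟨fun k m => x.1 k m - l.t • l.α i k (x.1 i m), by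
    refine ⟨fun k m => ?_, fun k m => ?_, fun k => ?_, fun m => ?_⟩
    · rw [map_sub, map_smul, P_α (nextSpace_P x i m), nextSpace_P]
    · rw [map_sub, map_smul, Q_α (nextSpace_Q x i m), nextSpace_Q]
    · rw [Finset.sum_sub_distrib, ← Finset.smul_sum, ← map_sum, nextSpace_sum_row,
        nextSpace_sum_row]
      simp
    · rw [Finset.sum_sub_distrib, ← Finset.smul_sum, sum_α_right, nextSpace_sum_col]
      simp⟩
  map_add' x y := by
    ext k m
    simp
    abel
  map_smul' c x := by
    ext k m
    simp [smul_sub, smul_comm c]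

/-- The idempotents `Q_j` on `nextSpace`. -/
noncomputable def nextQ (j : Fin n) : l.nextSpace →ₗ[ℂ] l.nextSpace where
  toFun x := ⟨fun k m => x.1 k m - l.t • l.β j m (x.1 k j), by
    refine ⟨fun k m => ?_, fun k m => ?_, fun k => ?_, fun m => ?_⟩
    · rw [map_sub, map_smul, P_β (nextSpace_P x k j), nextSpace_P]
    · rw [map_sub, map_smul, Q_β (nextSpace_Q x k j), nextSpace_Q]
    · rw [Finset.sum_sub_distrib, ← Finset.smul_sum, sum_β_right, nextSpace_sum_row]
      simp
    · rw [Finset.sum_sub_distrib, ← Finset.smul_sum, ← map_sum, nextSpace_sum_col,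
        nextSpace_sum_col]
      simp⟩
  map_add' x y := by
    ext k m
    simp
    abel
  map_smul' c x := by
    ext k m
    simp [smul_sub, smul_comm c]

lemma nextP_apply (i k m : Fin n) (x : l.nextSpace) :
    (l.nextP i x).1 k m = x.1 k m - l.t • l.α i k (x.1 i m) := rfl

lemma nextQ_apply (j k m : Fin n) (x : l.nextSpace) :
    (l.nextQ j x).1 k m = x.1 k m - l.t • l.β j m (x.1 k j) := rfl

lemma nextP_apply_self (i m : Fin n) (x : l.nextSpace) : (l.nextP i x).1 i m = 0 := by
  rw [nextP_apply, α_self (nextSpace_P x i m), sub_self]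

lemma nextQ_apply_self (j k : Fin n) (x : l.nextSpace) : (l.nextQ j x).1 k j = 0 := by
  rw [nextQ_apply, β_self (nextSpace_Q x k j), sub_self]

/-- The level whose space is `nextSpace`. -/
noncomputable def next (hn : 4 ≤ n) : Level n where
  X := l.nextSpace
  P := l.nextP
  Q := l.nextQ
  σ := n - (1 - l.σ⁻¹)⁻¹
  two_le := by
    have h1 : (4 : ℝ) ≤ n := by exact_mod_cast hn
    have h2 : l.σ⁻¹ ≤ 2⁻¹ := inv_anti₀ (by norm_num) l.two_le
    have h3 : (1 - l.σ⁻¹)⁻¹ ≤ (2⁻¹)⁻¹ := inv_anti₀ (by norm_num) (by linarith)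
    norm_num at h3
    linarith
  P_P i x := by
    ext k m
    rw [nextP_apply, nextP_apply_self, map_zero, smul_zero, sub_zero]
  Q_Q j x := by
    ext k m
    rw [nextQ_apply, nextQ_apply_self, map_zero, smul_zero, sub_zero]
  P_Q i j x := by
    ext k m
    simp only [nextP_apply, nextQ_apply, map_sub, map_smul, α_β, smul_sub, smul_smul]
    abel
  sum_P x := by
    ext k m
    have : l.t = (((1 - l.σ⁻¹)⁻¹ : ℝ) : ℂ) := by simp [t, s]
    simp only [Submodule.coe_sum, Finset.sum_apply, nextP_apply, Finset.sum_sub_distrib,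
      ← Finset.smul_sum, sum_α k fun i => x.1 i m, nextSpace_sum_col]
    simp [sub_smul, this, Nat.cast_smul_eq_nsmul]
  sum_Q x := by
    ext k m
    have : l.t = (((1 - l.σ⁻¹)⁻¹ : ℝ) : ℂ) := by simp [t, s]
    simp only [Submodule.coe_sum, Finset.sum_apply, nextQ_apply, Finset.sum_sub_distrib,
      ← Finset.smul_sum, sum_β m fun j => x.1 k j, nextSpace_sum_row]
    simp [sub_smul, this, Nat.cast_smul_eq_nsmul]

/-- The entries of an element of `nextSpace`. -/
def entry (i j : Fin n) : l.nextSpace →ₗ[ℂ] l.X where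
  toFun x := x.1 i j
  map_add' _ _ := rfl
  map_smul' _ _ := rfl

/-- The projection onto `nextSpace` of the matrix with entry `P_i Q_j x` at `(i, j)` and zero
elsewhere. -/
noncomputable def insert (i j : Fin n) : l.X →ₗ[ℂ] l.nextSpace where
  toFun x := ⟨fun k m => l.α i k (l.β j m (l.P i (l.Q j x))), by
    have hP : l.P i (l.P i (l.Q j x)) = l.P i (l.Q j x) := l.P_P _ _
    have hQ : l.Q j (l.P i (l.Q j x)) = l.P i (l.Q j x) := by rw [l.P_Q, l.Q_Q]
    refine ⟨fun k m => P_α (P_β hP), fun k m => Q_α (Q_β hQ), fun k => ?_, fun m => ?_⟩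
    · rw [← map_sum, sum_β_right, map_zero]
    · rw [sum_α_right]⟩
  map_add' x y := by
    ext k m
    simp
  map_smul' c x := by
    ext k m
    simp

/-- The level on `ℂ` with all idempotents equal to `1`. -/
noncomputable def base (hn : 4 ≤ n) : Level n where
  X := ℂ
  P _ := LinearMap.id
  Q _ := LinearMap.id
  σ := n
  two_le := by exact_mod_cast (by omega : 2 ≤ n)
  P_P _ _ := rfl
  Q_Q _ _ := rfl
  P_Q _ _ _ := rfl
  sum_P x := by simp
  sum_Q x := by simp

end Level

namespace Tower

variable {n : ℕ} (hn : 4 ≤ n)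

/-- The tower of levels obtained by iterating `Level.next`. -/
noncomputable def lev : ℕ → Level n
  | 0 => Level.base hn
  | k + 1 => (lev k).next hn

/-- The entries of an element of level `k + 1`. -/
noncomputable def D (k : ℕ) (i j : Fin n) : (lev hn (k + 1)).X →ₗ[ℂ] (lev hn k).X :=
  (lev hn k).entry i j

/-- The insertion of an element of level `k` as an entry of an element of level `k + 1`. -/
noncomputable def L (k : ℕ) (i j : Fin n) : (lev hn k).X →ₗ[ℂ] (lev hn (k + 1)).X :=
  (lev hn k).insert i j

/-- The space of level `0` is `ℂ`. -/
noncomputable def coord : (lev hn 0).X ≃ₗ[ℂ] ℂ := LinearEquiv.refl ℂ ℂ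

variable {hn} {k : ℕ}

lemma ext {x y : (lev hn (k + 1)).X} (h : ∀ i j, D hn k i j x = D hn k i j y) : x = y :=
  Subtype.ext (funext fun i => funext fun j => h i j)

lemma P_zero (i : Fin n) (x : (lev hn 0).X) : (lev hn 0).P i x = x := rfl

lemma Q_zero (i : Fin n) (x : (lev hn 0).X) : (lev hn 0).Q i x = x := rfl

lemma P_D (i j : Fin n) (x : (lev hn (k + 1)).X) :
    (lev hn k).P i (D hn k i j x) = D hn k i j x := Level.nextSpace_P (l := lev hn k) x i j

lemma Q_D (i j : Fin n) (x : (lev hn (k + 1)).X) :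
    (lev hn k).Q j (D hn k i j x) = D hn k i j x := Level.nextSpace_Q (l := lev hn k) x i j

lemma sum_D_row (i : Fin n) (x : (lev hn (k + 1)).X) : ∑ j, D hn k i j x = 0 :=
  Level.nextSpace_sum_row (l := lev hn k) x i

lemma sum_D_col (j : Fin n) (x : (lev hn (k + 1)).X) : ∑ i, D hn k i j x = 0 :=
  Level.nextSpace_sum_col (l := lev hn k) x j

lemma D_L (i j l m : Fin n) (x : (lev hn k).X) : D hn k l m (L hn k i j x) =
    (lev hn k).α i l ((lev hn k).β j m ((lev hn k).P i ((lev hn k).Q j x))) := rfl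

lemma D_P (i l m : Fin n) (x : (lev hn (k + 1)).X) : D hn k l m ((lev hn (k + 1)).P i x) =
    D hn k l m x - (lev hn k).t • (lev hn k).α i l (D hn k i m x) := rfl

lemma D_Q (j l m : Fin n) (x : (lev hn (k + 1)).X) : D hn k l m ((lev hn (k + 1)).Q j x) =
    D hn k l m x - (lev hn k).t • (lev hn k).β j m (D hn k l j x) := rfl

lemma D_P_self (i m : Fin n) (x : (lev hn (k + 1)).X) :
    D hn k i m ((lev hn (k + 1)).P i x) = 0 := (lev hn k).nextP_apply_self i m x

lemma D_Q_self (j l : Fin n) (x : (lev hn (k + 1)).X) :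
    D hn k l j ((lev hn (k + 1)).Q j x) = 0 := (lev hn k).nextQ_apply_self j l x

lemma D_eq_zero_of_P {i : Fin n} {x : (lev hn (k + 1)).X} (h : (lev hn (k + 1)).P i x = x)
    (m : Fin n) : D hn k i m x = 0 := by rw [← h, D_P_self]

lemma D_eq_zero_of_Q {j : Fin n} {x : (lev hn (k + 1)).X} (h : (lev hn (k + 1)).Q j x = x)
    (l : Fin n) : D hn k l j x = 0 := by rw [← h, D_Q_self]

lemma L_P (i j : Fin n) (x : (lev hn k).X) : L hn k i j ((lev hn k).P i x) = L hn k i j x :=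
  ext fun l m => by rw [D_L, D_L, ← (lev hn k).P_Q, (lev hn k).P_P]

lemma L_Q (i j : Fin n) (x : (lev hn k).X) : L hn k i j ((lev hn k).Q j x) = L hn k i j x :=
  ext fun l m => by rw [D_L, D_L, (lev hn k).Q_Q]

lemma P_P_Q (i j : Fin n) (x : (lev hn k).X) :
    (lev hn k).P i ((lev hn k).P i ((lev hn k).Q j x)) = (lev hn k).P i ((lev hn k).Q j x) :=
  (lev hn k).P_P _ _

lemma Q_P_Q (i j : Fin n) (x : (lev hn k).X) :
    (lev hn k).Q j ((lev hn k).P i ((lev hn k).Q j x)) = (lev hn k).P i ((lev hn k).Q j x) := by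
  rw [(lev hn k).P_Q, (lev hn k).Q_Q]

lemma P_L (i j : Fin n) (x : (lev hn k).X) : (lev hn (k + 1)).P i (L hn k i j x) = 0 :=
  ext fun l m => by
    rw [D_P, D_L, D_L, map_zero, ← map_smul, Level.α_self (Level.P_β (P_P_Q i j x)), sub_self]

lemma Q_L (i j : Fin n) (x : (lev hn k).X) : (lev hn (k + 1)).Q j (L hn k i j x) = 0 :=
  ext fun l m => by
    rw [D_Q, D_L, D_L, map_zero, Level.α_β, Level.α_β, ← map_smul,
      Level.β_self (Level.Q_α (Q_P_Q i j x)), sub_self]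

lemma sum_L_row (i : Fin n) (x : (lev hn k).X) : ∑ j, L hn k i j x = 0 :=
  ext fun l m => by
    rw [map_sum, map_zero]
    simp only [D_L]
    simp only [(lev hn k).P_Q]
    rw [← map_sum, Level.sum_β m fun j => (lev hn k).Q j ((lev hn k).P i x), (lev hn k).sum_Q,
      map_smul, smul_smul, (lev hn k).s_mul_σ, one_smul, sub_self, map_zero]

lemma sum_L_col (j : Fin n) (x : (lev hn k).X) : ∑ i, L hn k i j x = 0 :=
  ext fun l m => by
    rw [map_sum, map_zero]
    simp only [D_L, Level.α_β]
    rw [← map_sum, Level.sum_α l fun i => (lev hn k).P i ((lev hn k).Q j x), (lev hn k).sum_P,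
      map_smul, smul_smul, (lev hn k).s_mul_σ, one_smul, sub_self, map_zero]

lemma D_L_D (i j l m : Fin n) (x : (lev hn (k + 1)).X) :
    D hn k l m (L hn k i j (D hn k i j x)) =
      (lev hn k).α i l ((lev hn k).β j m (D hn k i j x)) := by
  rw [D_L, Q_D, P_D]

lemma sub_P (i : Fin n) (x : (lev hn (k + 1)).X) :
    x - (lev hn (k + 1)).P i x = (lev hn k).t • ∑ m, L hn k i m (D hn k i m x) :=
  ext fun l m => by
    rw [map_sub, D_P, map_smul, map_sum]
    simp only [D_L_D]
    rw [← map_sum, Level.sum_β m fun j => D hn k i j x, sum_D_row]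
    simp

lemma sub_Q (j : Fin n) (x : (lev hn (k + 1)).X) :
    x - (lev hn (k + 1)).Q j x = (lev hn k).t • ∑ l, L hn k l j (D hn k l j x) :=
  ext fun l m => by
    rw [map_sub, D_Q, map_smul, map_sum]
    simp only [D_L_D, Level.α_β]
    rw [← map_sum, Level.sum_α l fun i => D hn k i j x, sum_D_col]
    simp

lemma sub_P_sub_Q (i j : Fin n) (x : (lev hn (k + 1)).X) :
    x - (lev hn (k + 1)).Q j x - (lev hn (k + 1)).P i (x - (lev hn (k + 1)).Q j x) =
      (lev hn k).t ^ 2 • L hn k i j (D hn k i j x) :=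
  ext fun l m => by
    rw [map_sub _ _ ((lev hn (k + 1)).P i _), D_P, sub_sub_cancel, map_sub, D_Q, map_smul, D_L_D,
      sub_sub_cancel, map_smul, smul_smul, sq]

lemma sum_L_D (x : (lev hn (k + 1)).X) : ∑ i, ∑ j, L hn k i j (D hn k i j x) = x :=
  ext fun l m => by
    simp only [map_sum, D_L_D, Level.α_β]
    rw [Finset.sum_comm]
    simp only [← map_sum, Level.sum_α l fun i => D hn k i _ x, sum_D_col]
    rw [Level.sum_β m fun j => D hn k l j x - (lev hn k).s • (lev hn k).P l 0]
    simp [sum_D_row]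

lemma t_smul_D_L_row {i j l : Fin n} {x : (lev hn k).X} (hP : (lev hn k).P i x = x)
    (hQ : (lev hn k).Q l x = x) :
    (lev hn k).t • D hn k i j (L hn k i l x) =
      (if l = j then x else 0) - (lev hn k).s • (lev hn k).Q j x := by
  rw [D_L, hQ, hP, Level.α_self (Level.P_β hP), Level.β_apply]

lemma t_smul_D_L_col {i j l : Fin n} {x : (lev hn k).X} (hP : (lev hn k).P l x = x)
    (hQ : (lev hn k).Q i x = x) :
    (lev hn k).t • D hn k j i (L hn k l i x) =
      (if l = j then x else 0) - (lev hn k).s • (lev hn k).P j x := by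
  rw [D_L, hQ, hP, Level.α_β, Level.β_self (Level.Q_α hQ), Level.α_apply]

end Tower

namespace Tower

section Operators

variable {n : ℕ} (hn : 4 ≤ n)

/-- The operator with components `P_i Q_j x_k + t_k D_{ij} x_{k+1}`. -/
noncomputable def Φ (i j : Fin n) : (∀ k, (lev hn k).X) →ₗ[ℂ] ∀ k, (lev hn k).X where
  toFun x := fun k => (lev hn k).P i ((lev hn k).Q j (x k)) + (lev hn k).t • D hn k i j (x (k + 1))
  map_add' x y := by
    ext k
    simp
    abel
  map_smul' c x := by
    ext k
    simp [smul_comm c]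

/-- The operator with components `s_0 x_0` and `L_{ij} x_k + s_{k+1} x_{k+1}`. -/
noncomputable def I (i j : Fin n) : (∀ k, (lev hn k).X) →ₗ[ℂ] ∀ k, (lev hn k).X where
  toFun x
    | 0 => (lev hn 0).s • x 0
    | k + 1 => L hn k i j (x k) + (lev hn (k + 1)).s • x (k + 1)
  map_add' x y := by
    ext (_ | k)
    · simp
    · simp
      abel
  map_smul' c x := by
    ext (_ | k)
    · simp [smul_comm c]
    · simp [smul_comm c]

variable {hn}

lemma Φ_apply (i j : Fin n) (x : ∀ k, (lev hn k).X) (k : ℕ) : Φ hn i j x k =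
    (lev hn k).P i ((lev hn k).Q j (x k)) + (lev hn k).t • D hn k i j (x (k + 1)) := rfl

lemma I_zero (i j : Fin n) (x : ∀ k, (lev hn k).X) : I hn i j x 0 = (lev hn 0).s • x 0 := rfl

lemma I_succ (i j : Fin n) (x : ∀ k, (lev hn k).X) (k : ℕ) : I hn i j x (k + 1) =
    L hn k i j (x k) + (lev hn (k + 1)).s • x (k + 1) := rfl

lemma P_Φ (i j : Fin n) (x : ∀ k, (lev hn k).X) (k : ℕ) :
    (lev hn k).P i (Φ hn i j x k) = Φ hn i j x k := by
  rw [Φ_apply, map_add, map_smul, P_P_Q, P_D]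

lemma Q_Φ (i j : Fin n) (x : ∀ k, (lev hn k).X) (k : ℕ) :
    (lev hn k).Q j (Φ hn i j x k) = Φ hn i j x k := by
  rw [Φ_apply, map_add, map_smul, Q_P_Q, Q_D]

lemma P_I (i j : Fin n) (x : ∀ k, (lev hn k).X) (k : ℕ) :
    (lev hn k).P i (I hn i j x k) = (lev hn k).s • (lev hn k).P i (x k) := by
  rcases k with _ | k
  · rw [I_zero, map_smul]
  · rw [I_succ, map_add, P_L, zero_add, map_smul]

lemma Q_I (i j : Fin n) (x : ∀ k, (lev hn k).X) (k : ℕ) :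
    (lev hn k).Q j (I hn i j x k) = (lev hn k).s • (lev hn k).Q j (x k) := by
  rcases k with _ | k
  · rw [I_zero, map_smul]
  · rw [I_succ, map_add, Q_L, zero_add, map_smul]

lemma Φ_I_row {i j l : Fin n} {x : ∀ k, (lev hn k).X} (hP : ∀ k, (lev hn k).P i (x k) = x k)
    (hQ : ∀ k, (lev hn k).Q l (x k) = x k) :
    Φ hn i j (I hn i l x) = if l = j then x else 0 := by
  funext k
  rw [Φ_apply, I_succ, map_add, map_smul, D_eq_zero_of_P (hP (k + 1)), smul_zero, add_zero,
    t_smul_D_L_row (hP k) (hQ k), (lev hn k).P_Q, P_I, map_smul, hP, add_sub_cancel]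
  split_ifs <;> rfl

lemma Φ_I_col {i j l : Fin n} {x : ∀ k, (lev hn k).X} (hP : ∀ k, (lev hn k).P l (x k) = x k)
    (hQ : ∀ k, (lev hn k).Q i (x k) = x k) :
    Φ hn j i (I hn l i x) = if l = j then x else 0 := by
  funext k
  rw [Φ_apply, I_succ, map_add, map_smul, D_eq_zero_of_Q (hQ (k + 1)), smul_zero, add_zero,
    t_smul_D_L_col (hP k) (hQ k), Q_I, map_smul, hQ, add_sub_cancel]
  split_ifs <;> rfl

lemma sum_I_Φ_row (i : Fin n) (x : ∀ k, (lev hn k).X) : ∑ j, I hn i j (Φ hn i j x) = x := by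
  have h : ∀ k, (lev hn k).s • ∑ j, Φ hn i j x k = (lev hn k).P i (x k) := fun k => by
    simp only [Φ_apply]
    rw [Finset.sum_add_distrib, ← Finset.smul_sum, sum_D_row, smul_zero, add_zero, ← map_sum,
      (lev hn k).sum_Q, map_smul, smul_smul, (lev hn k).s_mul_σ, one_smul]
  funext k
  rw [Finset.sum_apply]
  rcases k with _ | k
  · simp only [I_zero]
    rw [← Finset.smul_sum, h, P_zero]
  · simp only [I_succ]
    rw [Finset.sum_add_distrib, ← Finset.smul_sum, h]
    simp only [Φ_apply, map_add, map_smul, L_P, L_Q]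
    rw [Finset.sum_add_distrib, sum_L_row, ← Finset.smul_sum, ← sub_P]
    abel

lemma sum_I_Φ_col (j : Fin n) (x : ∀ k, (lev hn k).X) : ∑ i, I hn i j (Φ hn i j x) = x := by
  have h : ∀ k, (lev hn k).s • ∑ i, Φ hn i j x k = (lev hn k).Q j (x k) := fun k => by
    simp only [Φ_apply]
    rw [Finset.sum_add_distrib, ← Finset.smul_sum, sum_D_col, smul_zero, add_zero,
      (lev hn k).sum_P, smul_smul, (lev hn k).s_mul_σ, one_smul]
  funext k
  rw [Finset.sum_apply]
  rcases k with _ | k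
  · simp only [I_zero]
    rw [← Finset.smul_sum, h, Q_zero]
  · simp only [I_succ]
    rw [Finset.sum_add_distrib, ← Finset.smul_sum, h]
    simp only [Φ_apply, map_add, map_smul, L_P, L_Q]
    rw [Finset.sum_add_distrib, sum_L_col, ← Finset.smul_sum, ← sub_Q]
    abel

variable (hn) in
/-- The magic unitary of operators on the product of all levels. -/
noncomputable def U (i j : Fin n) : Module.End ℂ (∀ k, (lev hn k).X) := I hn i j ∘ₗ Φ hn i j

lemma U_apply (i j : Fin n) (x : ∀ k, (lev hn k).X) : U hn i j x = I hn i j (Φ hn i j x) := rfl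

lemma Φ_U (i j : Fin n) (x : ∀ k, (lev hn k).X) : Φ hn i j (U hn i j x) = Φ hn i j x := by
  rw [U_apply, Φ_I_row (P_Φ i j x) (Q_Φ i j x), if_pos rfl]

lemma isMagic_op_U : IsMagic fun i j => MulOpposite.op (U hn i j) := by
  refine ⟨fun i j k => ?_, fun i j k => ?_, fun i => ?_, fun i => ?_⟩
  · rw [← MulOpposite.op_mul]
    have : U hn i k * U hn i j = if j = k then U hn i j else 0 := LinearMap.ext fun x => by
      rw [Module.End.mul_apply, U_apply i k, U_apply i j, Φ_I_row (P_Φ i j x) (Q_Φ i j x)]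
      split_ifs with h
      · rw [h, U_apply]
      · rw [map_zero, LinearMap.zero_apply]
    rw [this]
    split_ifs <;> rfl
  · rw [← MulOpposite.op_mul]
    have : U hn k i * U hn j i = if j = k then U hn j i else 0 := LinearMap.ext fun x => by
      rw [Module.End.mul_apply, U_apply k i, U_apply j i, Φ_I_col (P_Φ j i x) (Q_Φ j i x)]
      split_ifs with h
      · rw [h, U_apply]
      · rw [map_zero, LinearMap.zero_apply]
    rw [this]
    split_ifs <;> rfl
  · rw [← Finset.op_sum, ← MulOpposite.op_one]
    congr 1
    refine LinearMap.ext fun x => ?_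
    rw [LinearMap.sum_apply]
    exact sum_I_Φ_row i x
  · rw [← Finset.op_sum, ← MulOpposite.op_one]
    congr 1
    refine LinearMap.ext fun x => ?_
    rw [LinearMap.sum_apply]
    exact sum_I_Φ_col i x

lemma Φ_single {i j : Fin n} {k : ℕ} {x : (lev hn k).X} (hP : (lev hn k).P i x = x)
    (hQ : (lev hn k).Q j x = x) : Φ hn i j (Pi.single k x) = Pi.single k x := by
  funext l
  rw [Φ_apply]
  rcases eq_or_ne l k with rfl | h
  · rw [Pi.single_eq_same, hQ, hP, Pi.single_eq_of_ne (by omega), map_zero, smul_zero, add_zero]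
  · rw [Pi.single_eq_of_ne h, map_zero, map_zero, zero_add]
    rcases eq_or_ne (l + 1) k with rfl | h'
    · rw [Pi.single_eq_same, D_eq_zero_of_P hP, smul_zero]
    · rw [Pi.single_eq_of_ne h', map_zero, smul_zero]

lemma I_single (i j : Fin n) (k : ℕ) (x : (lev hn k).X) : I hn i j (Pi.single k x) =
    (Pi.single (k + 1) (L hn k i j x) + (lev hn k).s • (Pi.single k x : ∀ k, (lev hn k).X) :
      ∀ k, (lev hn k).X) := by
  funext l
  rw [Pi.add_apply, Pi.smul_apply]
  rcases l with _ | l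
  · rw [I_zero, Pi.single_eq_of_ne (i := k + 1) (by omega), zero_add]
    rcases eq_or_ne 0 k with rfl | h
    · rfl
    · rw [Pi.single_eq_of_ne h, smul_zero, smul_zero]
  · rw [I_succ]
    rcases eq_or_ne (l + 1) k with rfl | h
    · rw [Pi.single_eq_of_ne (i := l + 1) (by omega), map_zero,
        Pi.single_eq_of_ne (i := l + 1 + 1) (by omega)]
    · rw [Pi.single_eq_of_ne h, smul_zero, smul_zero]
      rcases eq_or_ne l k with rfl | h'
      · rw [Pi.single_eq_same, Pi.single_eq_same]
      · rw [Pi.single_eq_of_ne h', map_zero, Pi.single_eq_of_ne (by omega)]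

lemma sum_U_single {k : ℕ} (x : (lev hn (k + 1)).X) :
    ∑ i, ∑ j, U hn i j (Pi.single k (D hn k i j x)) = Pi.single (k + 1) x := by
  have h : ∀ i j, U hn i j (Pi.single k (D hn k i j x)) =
      Pi.single (k + 1) (L hn k i j (D hn k i j x)) +
        (lev hn k).s • LinearMap.single ℂ (fun k => (lev hn k).X) k (D hn k i j x) :=
    fun i j => by
      rw [U_apply, Φ_single (P_D i j x) (Q_D i j x), I_single, LinearMap.single_apply]
  simp only [h, Finset.sum_add_distrib, ← Finset.smul_sum, ← map_sum, sum_D_row, map_zero,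
    smul_zero, add_zero]
  have h2 := congrArg (LinearMap.single ℂ (fun k => (lev hn k).X) (k + 1)) (sum_L_D x)
  simp only [map_sum] at h2
  exact h2

end Operators

end Tower

lemma Level.smul_t_cancel {n : ℕ} (l : Level n) {x : l.X} (h : x = l.s • x) : x = 0 := by
  have : l.t • (1 - l.s) • x = 0 := by rw [sub_smul, one_smul, ← h, sub_self, smul_zero]
  rwa [smul_smul, l.t_mul, one_smul] at this

lemma Level.eq_zero_of_P_Q {n : ℕ} (l : Level n) {y : l.X}
    (h : ∀ i j, i ≠ j → l.P i (l.Q j y) = 0) : y = 0 := by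
  have hQ : ∀ i, l.Q i y = 0 := fun i => by
    have h1 : l.P i (l.Q i y) = (l.σ : ℂ) • l.Q i y := by
      rw [← l.sum_P, Finset.sum_eq_single i (fun k _ hk => h k i hk) (by simp)]
    have h2 : l.Q i y = l.s • l.P i (l.Q i y) := by
      rw [h1, smul_smul, l.s_mul_σ, one_smul]
    have h3 : l.P i (l.Q i y) = 0 := l.smul_t_cancel (by
      conv_lhs => rw [h2, map_smul, l.P_P])
    rw [h2, h3, smul_zero]
  have h4 := l.sum_Q y
  rw [Finset.sum_eq_zero fun i _ => hQ i] at h4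
  rw [← one_smul ℂ y, ← l.s_mul_σ, mul_smul, ← h4, smul_zero]

namespace Tower

section Model

variable {n : ℕ} (hn : 4 ≤ n) {A : Type} [Ring A] [Algebra ℂ A] (u : Fin n → Fin n → A)

/-- The maps from the levels of the tower to an algebra with a magic unitary. -/
noncomputable def ψ : ∀ k, (lev hn k).X →ₗ[ℂ] A
  | 0 => Algebra.linearMap ℂ A ∘ₗ (coord hn).toLinearMap
  | k + 1 => ∑ i, ∑ j, LinearMap.mulRight ℂ (u i j) ∘ₗ ψ k ∘ₗ D hn k i j

variable {hn u}

lemma ψ_zero (x : (lev hn 0).X) : ψ hn u 0 x = algebraMap ℂ A (coord hn x) := rfl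

lemma ψ_succ {k : ℕ} (x : (lev hn (k + 1)).X) :
    ψ hn u (k + 1) x = ∑ i, ∑ j, ψ hn u k (D hn k i j x) * u i j := by
  rw [ψ]
  simp [LinearMap.sum_apply]

variable (hn u) in
/-- The compatibility of `ψ` with the idempotents of level `k`. -/
def Absorbs (k : ℕ) : Prop :=
  (∀ i q z, (lev hn k).P i z = z → ψ hn u k ((lev hn k).Q q z) * u i q = ψ hn u k z * u i q) ∧
    ∀ l j z, (lev hn k).Q j z = z → ψ hn u k ((lev hn k).P l z) * u l j = ψ hn u k z * u l j

lemma ψ_L_of_absorbs (hu : IsMagic u) {k : ℕ} (h : Absorbs hn u k) {i j : Fin n}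
    {m : (lev hn k).X} (hP : (lev hn k).P i m = m) (hQ : (lev hn k).Q j m = m) :
    ψ hn u (k + 1) (L hn k i j m) = ψ hn u k m * u i j - (lev hn k).s • ψ hn u k m := by
  set s := (lev hn k).s with hs
  have hD : ∀ l q, ψ hn u k (D hn k l q (L hn k i j m)) * u l q =
      (if i = l then (if j = q then ψ hn u k m * u l q else 0) else 0)
      - (if i = l then s • (ψ hn u k m * u l q) else 0)
      - (if j = q then s • (ψ hn u k m * u l q) else 0)
      + s • s • (ψ hn u k ((lev hn k).Q q m) * u l q) := fun l q => by
    rw [D_L, hQ, hP, Level.α_apply, Level.β_apply, ← h.2 l q _ ((lev hn k).Q_Q q m), ← hs]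
    have h1 : i = l → ψ hn u k ((lev hn k).Q q m) * u l q = ψ hn u k m * u l q := by
      rintro rfl
      exact h.1 i q m hP
    have h2 : j = q → ψ hn u k ((lev hn k).P l m) * u l q = ψ hn u k m * u l q := by
      rintro rfl
      exact h.2 l j m hQ
    split_ifs with hi hj hj
    · simp only [map_sub, map_smul, sub_mul, smul_mul_assoc, h1 hi, h2 hj, smul_sub]
      abel
    · simp only [map_sub, map_smul, map_zero, sub_mul, smul_mul_assoc, zero_mul, h1 hi, smul_sub,
        smul_zero]
      abel
    · simp only [map_sub, map_smul, map_zero, sub_mul, smul_mul_assoc, zero_mul, h2 hj, smul_sub]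
      abel
    · simp only [map_sub, map_smul, map_zero, sub_mul, smul_mul_assoc, zero_mul, smul_sub,
        smul_zero]
      abel
  rw [ψ_succ]
  simp only [hD, Finset.sum_add_distrib, Finset.sum_sub_distrib]
  have h3 : ∑ l, ∑ q, s • s • (ψ hn u k ((lev hn k).Q q m) * u l q) = s • ψ hn u k m := by
    rw [Finset.sum_comm]
    simp only [← Finset.smul_sum, ← Finset.mul_sum, hu.col_sum, mul_one]
    rw [← map_sum, (lev hn k).sum_Q, map_smul, hs, smul_smul _ ((lev hn k).σ : ℂ),
      (lev hn k).s_mul_σ, one_smul]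
  rw [h3]
  simp only [Finset.sum_ite_irrel, Finset.sum_const_zero, Finset.sum_ite_eq, Finset.mem_univ,
    if_true, ← Finset.smul_sum, ← Finset.mul_sum, hu.row_sum, hu.col_sum, mul_one]
  abel

lemma ψ_sub_P_mul_of_absorbs (hu : IsMagic u) {k : ℕ} (h : Absorbs hn u k) (i j : Fin n)
    (x : (lev hn (k + 1)).X) : ψ hn u (k + 1) (x - (lev hn (k + 1)).P i x) * u i j =
      (lev hn k).t • (ψ hn u k (D hn k i j x) * u i j) := by
  rw [sub_P, map_smul, map_sum]
  simp only [ψ_L_of_absorbs hu h (P_D i _ x) (Q_D i _ x)]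
  rw [Finset.sum_sub_distrib, ← Finset.smul_sum, ← map_sum, sum_D_row, map_zero, smul_zero,
    sub_zero, smul_mul_assoc, Finset.sum_mul]
  simp [mul_assoc, hu.row]

lemma ψ_sub_Q_mul_of_absorbs (hu : IsMagic u) {k : ℕ} (h : Absorbs hn u k) (i j : Fin n)
    (x : (lev hn (k + 1)).X) : ψ hn u (k + 1) (x - (lev hn (k + 1)).Q j x) * u i j =
      (lev hn k).t • (ψ hn u k (D hn k i j x) * u i j) := by
  rw [sub_Q, map_smul, map_sum]
  simp only [ψ_L_of_absorbs hu h (P_D _ j x) (Q_D _ j x)]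
  rw [Finset.sum_sub_distrib, ← Finset.smul_sum, ← map_sum, sum_D_col, map_zero, smul_zero,
    sub_zero, smul_mul_assoc, Finset.sum_mul]
  simp [mul_assoc, hu.col]

lemma absorbs (hu : IsMagic u) (k : ℕ) : Absorbs hn u k := by
  induction k with
  | zero => exact ⟨fun i q z _ => by rw [Q_zero], fun l j z _ => by rw [P_zero]⟩
  | succ k ih =>
    refine ⟨fun i q z hz => ?_, fun l j z hz => ?_⟩
    · have := ψ_sub_Q_mul_of_absorbs hu ih i q z
      rw [D_eq_zero_of_P hz, map_zero, zero_mul, smul_zero, map_sub, sub_mul, sub_eq_zero] at this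
      exact this.symm
    · have := ψ_sub_P_mul_of_absorbs hu ih l j z
      rw [D_eq_zero_of_Q hz, map_zero, zero_mul, smul_zero, map_sub, sub_mul, sub_eq_zero] at this
      exact this.symm

lemma ψ_mul_mem_of_fixed (hu : IsMagic u) {k : ℕ} {i j : Fin n} {m : (lev hn k).X}
    (hP : (lev hn k).P i m = m) (hQ : (lev hn k).Q j m = m) :
    ψ hn u k m * u i j ∈ ⨆ k, LinearMap.range (ψ hn u k) := by
  rw [sub_eq_iff_eq_add.mp (ψ_L_of_absorbs hu (absorbs hu k) hP hQ).symm]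
  exact add_mem (Submodule.mem_iSup_of_mem (k + 1) ⟨_, rfl⟩)
    (Submodule.smul_mem _ _ (Submodule.mem_iSup_of_mem k ⟨_, rfl⟩))

lemma ψ_mul_mem (hu : IsMagic u) {k : ℕ} (i j : Fin n) (x : (lev hn k).X) :
    ψ hn u k x * u i j ∈ ⨆ k, LinearMap.range (ψ hn u k) := by
  rcases k with _ | k
  · exact ψ_mul_mem_of_fixed hu (P_zero i x) (Q_zero j x)
  · have hx : x = (lev hn (k + 1)).P i ((lev hn (k + 1)).Q j x) +
        ((lev hn (k + 1)).Q j x - (lev hn (k + 1)).P i ((lev hn (k + 1)).Q j x)) +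
        (x - (lev hn (k + 1)).Q j x) := by abel
    rw [hx, map_add, map_add, add_mul, add_mul, ψ_sub_P_mul_of_absorbs hu (absorbs hu k),
      ψ_sub_Q_mul_of_absorbs hu (absorbs hu k), D_Q_self, map_zero, zero_mul, smul_zero, add_zero]
    exact add_mem (ψ_mul_mem_of_fixed hu (P_P_Q i j x) (Q_P_Q i j x))
      (Submodule.smul_mem _ _ (ψ_mul_mem_of_fixed hu (P_D i j x) (Q_D i j x)))

lemma iSup_range_ψ (hu : IsUniversalMagic u) (a : A) : a ∈ ⨆ k, LinearMap.range (ψ hn u k) := by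
  refine hu.mem_of_mul_right _ ?_ (fun s hs i j => ?_) a
  · exact Submodule.mem_iSup_of_mem 0 ⟨(coord hn).symm 1, by simp [ψ_zero]⟩
  · induction hs using Submodule.iSup_induction' with
    | mem k x hx =>
      obtain ⟨y, rfl⟩ := hx
      exact ψ_mul_mem hu.toIsMagic i j y
    | zero => simp
    | add x y _ _ hx hy =>
      rw [add_mul]
      exact add_mem hx hy

variable (hn u) in
/-- A linear map to the product of the levels that sends right multiplication by `u i j` to the
operator `U i j`. -/
structure IsModelMap (θ : A →ₗ[ℂ] ∀ k, (lev hn k).X) : Prop where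
  map_one : θ 1 = Pi.single 0 ((coord hn).symm 1)
  map_mul : ∀ a i j, θ (a * u i j) = U hn i j (θ a)

lemma exists_isModelMap (hu : IsUniversalMagic u) : ∃ θ, IsModelMap hn u θ := by
  obtain ⟨F, hF⟩ := hu.exists_lift _ (isMagic_op_U (hn := hn))
  refine ⟨LinearMap.applyₗ (Pi.single 0 ((coord hn).symm 1)) ∘ₗ
    (MulOpposite.opLinearEquiv ℂ).symm.toLinearMap ∘ₗ F.toLinearMap, ?_, fun a i j => ?_⟩
  · simp
  · simp [hF]

variable {θ : A →ₗ[ℂ] ∀ k, (lev hn k).X}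

lemma IsModelMap.apply_ψ (hθ : IsModelMap hn u θ) {k : ℕ} (x : (lev hn k).X) : θ (ψ hn u k x) =
    Pi.single k x := by
  induction k with
  | zero =>
    rw [ψ_zero, Algebra.algebraMap_eq_smul_one, map_smul, hθ.map_one]
    have : x = coord hn x • (coord hn).symm 1 := by
      rw [← map_smul, smul_eq_mul, mul_one, LinearEquiv.symm_apply_apply]
    conv_rhs => rw [this]
    exact (Pi.single_smul (f := fun k => (lev hn k).X) 0 (coord hn x) ((coord hn).symm 1)).symm
  | succ k ih =>
    rw [ψ_succ, ← sum_U_single]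
    simp only [map_sum, hθ.map_mul, ih]

lemma IsModelMap.exists_eq_sum (hθ : IsModelMap hn u θ) (hu : IsUniversalMagic u) (a : A) :
    ∃ N, ∀ M ≥ N, θ a M = 0 ∧ a = ∑ k ∈ Finset.range M, ψ hn u k (θ a k) := by
  have ha := iSup_range_ψ (hn := hn) hu a
  induction ha using Submodule.iSup_induction' with
  | mem k x hx =>
    obtain ⟨y, rfl⟩ := hx
    refine ⟨k + 1, fun M hM => ?_⟩
    rw [hθ.apply_ψ]
    refine ⟨Pi.single_eq_of_ne (by omega) _, ?_⟩
    rw [Finset.sum_eq_single k, Pi.single_eq_same]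
    · intro l _ hl
      rw [Pi.single_eq_of_ne hl, map_zero]
    · intro h
      exact absurd (Finset.mem_range.mpr hM) h
  | zero => exact ⟨0, fun M _ => by simp⟩
  | add x y _ _ hx hy =>
    obtain ⟨N, hN⟩ := hx
    obtain ⟨N', hN'⟩ := hy
    refine ⟨max N N', fun M hM => ?_⟩
    obtain ⟨h1, h2⟩ := hN M (le_of_max_le_left hM)
    obtain ⟨h3, h4⟩ := hN' M (le_of_max_le_right hM)
    refine ⟨by rw [map_add, Pi.add_apply, h1, h3, add_zero], ?_⟩
    simp only [map_add, Pi.add_apply, Finset.sum_add_distrib]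
    rw [← h2, ← h4]

lemma IsModelMap.eq_zero (hθ : IsModelMap hn u θ) (hu : IsUniversalMagic u) {a : A}
    (ha : θ a = 0) : a = 0 := by
  obtain ⟨N, hN⟩ := hθ.exists_eq_sum hu a
  rw [(hN N le_rfl).2, ha]
  simp

lemma IsModelMap.Φ_mul (hθ : IsModelMap hn u θ) (a : A) (i j : Fin n) :
    Φ hn i j (θ (a * u i j)) = Φ hn i j (θ a) := by
  rw [hθ.map_mul, Φ_U]

lemma eq_zero_of_Φ {x : ∀ k, (lev hn k).X} (h : ∀ i j, i ≠ j → Φ hn i j x = 0) (N : ℕ)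
    (hN : ∀ k ≥ N, x k = 0) : x = 0 := by
  induction N with
  | zero => exact funext fun k => hN k (Nat.zero_le k)
  | succ N ih =>
    refine ih fun k hk => ?_
    rcases hk.eq_or_lt with rfl | hk
    · refine Level.eq_zero_of_P_Q _ fun i j hij => ?_
      have := congrFun (h i j hij) N
      rwa [Φ_apply, hN (N + 1) le_rfl, map_zero, smul_zero, add_zero] at this
    · exact hN k hk

theorem eq_zero_of_mul_eq_zero (hn : 4 ≤ n) (hu : IsUniversalMagic u) {a : A}
    (ha : ∀ i j, i ≠ j → a * u i j = 0) : a = 0 := by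
  obtain ⟨θ, hθ⟩ := exists_isModelMap (hn := hn) hu
  obtain ⟨N, hN⟩ := hθ.exists_eq_sum hu a
  refine hθ.eq_zero hu (eq_zero_of_Φ (fun i j hij => ?_) N fun k hk => (hN k hk).1)
  rw [← hθ.Φ_mul, ha i j hij, map_zero, map_zero]

lemma exists_P_Q_eq {k : ℕ} {m : Fin n → Fin n → (lev hn k).X}
    (hP : ∀ i j, (lev hn k).P i (m i j) = m i j) (hQ : ∀ i j, (lev hn k).Q j (m i j) = m i j)
    (hm : ∀ i, ∑ j, L hn k i j (m i j) = ∑ j, L hn k j i (m j i)) :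
    ∃ y, ∀ i j, i ≠ j → (lev hn k).P i ((lev hn k).Q j y) = m i j := by
  set w : Fin n → (lev hn (k + 1)).X := fun i => ∑ j, L hn k i j (m i j) with hw
  set c : Fin n → (lev hn k).X := fun i => (lev hn k).t ^ 2 • D hn k i i (w i) with hc
  have hLc : ∀ i, L hn k i i (c i) = w i := fun i => by
    have hPw : (lev hn (k + 1)).P i (w i) = 0 := by
      rw [hw, map_sum]
      exact Finset.sum_eq_zero fun j _ => P_L i j _
    have hQw : (lev hn (k + 1)).Q i (w i) = 0 := by
      simp only [hw]
      rw [hm, map_sum]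
      exact Finset.sum_eq_zero fun j _ => Q_L j i _
    rw [hc, map_smul, ← sub_P_sub_Q, hQw, sub_zero, hPw, sub_zero]
  set m' : Fin n → Fin n → (lev hn k).X := fun i j => m i j - if i = j then c i else 0 with hm'
  have hP' : ∀ i j, (lev hn k).P i (m' i j) = m' i j := fun i j => by
    simp only [hm']
    rw [map_sub, hP]
    split_ifs
    · rw [hc, map_smul, P_D]
    · rw [map_zero]
  have hQ' : ∀ i j, (lev hn k).Q j (m' i j) = m' i j := fun i j => by
    simp only [hm']
    rw [map_sub, hQ]
    split_ifs with h
    · subst h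
      rw [hc, map_smul, Q_D]
    · rw [map_zero]
  have hrow : ∀ i q, m' i q = (lev hn k).s • (lev hn k).Q q (∑ l, m' i l) := fun i q => by
    have h1 : ∑ l, L hn k i l (m' i l) = 0 := by
      have h3 : ∀ l, L hn k i l (if i = l then c i else 0) = if i = l then w i else 0 :=
        fun l => by
          split_ifs with h
          · rw [← h, hLc]
          · rw [map_zero]
      simp [hm', Finset.sum_sub_distrib, h3, hw]
    have h2 := congrArg (fun z => (lev hn k).t • D hn k i q z) h1
    simp only [map_sum, Finset.smul_sum, map_zero, smul_zero,
      t_smul_D_L_row (hP' i _) (hQ' i _)] at h2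
    rw [Finset.sum_sub_distrib, Finset.sum_ite_eq' Finset.univ q, if_pos (Finset.mem_univ q),
      sub_eq_zero] at h2
    rw [h2, map_sum, Finset.smul_sum]
  have hcol : ∀ i q, m' q i = (lev hn k).s • (lev hn k).P q (∑ l, m' l i) := fun i q => by
    have h1 : ∑ l, L hn k l i (m' l i) = 0 := by
      have h3 : ∀ l, L hn k l i (if l = i then c l else 0) = if l = i then w i else 0 :=
        fun l => by
          split_ifs with h
          · rw [h, hLc]
          · rw [map_zero]
      simp [hm', Finset.sum_sub_distrib, h3, hw, hm]
    have h2 := congrArg (fun z => (lev hn k).t • D hn k q i z) h1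
    simp only [map_sum, Finset.smul_sum, map_zero, smul_zero,
      t_smul_D_L_col (hP' _ i) (hQ' _ i)] at h2
    rw [Finset.sum_sub_distrib, Finset.sum_ite_eq' Finset.univ q, if_pos (Finset.mem_univ q),
      sub_eq_zero] at h2
    rw [h2, map_sum, Finset.smul_sum]
  refine ⟨(lev hn k).s • (lev hn k).s • ∑ j, ∑ i, m' i j, fun i j hij => ?_⟩
  have h5 : (lev hn k).s • (lev hn k).P i (∑ j, ∑ i, m' i j) = ∑ j, m' i j := by
    rw [map_sum, Finset.smul_sum]
    exact Finset.sum_congr rfl fun j _ => (hcol j i).symm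
  rw [(lev hn k).P_Q, map_smul, map_smul, map_smul, h5, ← hrow]
  simp [hm', hij]

theorem exists_mulMap_eq_of_sum_eq (hn : 4 ≤ n) (hu : IsUniversalMagic u)
    (x : diagFixed (offDiag u)) (hx : ∀ j, ∑ l, x.1 (j, l) = ∑ i, x.1 (i, j)) :
    ∃ a, mulMap hu.toIsMagic a = x := by
  obtain ⟨θ, hθ⟩ := exists_isModelMap (hn := hn) hu
  have hdiag : ∀ (x : diagFixed (offDiag u)) i, x.1 (i, i) = 0 := fun x i => by
    rw [← x.2 (i, i), offDiag, if_pos rfl, mul_zero]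
  have hmul : ∀ (x : diagFixed (offDiag u)) i j, i ≠ j → x.1 (i, j) * u i j = x.1 (i, j) :=
    fun x i j hij => by simpa [offDiag, hij] using x.2 (i, j)
  have hI : ∀ (x : diagFixed (offDiag u)) i j,
      θ (x.1 (i, j)) = I hn i j (Φ hn i j (θ (x.1 (i, j)))) := fun x i j => by
    rcases eq_or_ne i j with rfl | hij
    · rw [hdiag, map_zero, map_zero, map_zero]
    · conv_lhs => rw [← hmul x i j hij, hθ.map_mul, U_apply]
  choose N hN using fun p => hθ.exists_eq_sum hu (x.1 p)
  have hK : ∃ K, ∀ i j, ∀ k ≥ K, Φ hn i j (θ (x.1 (i, j))) k = 0 := by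
    refine ⟨Finset.univ.sup N, fun i j k hk => ?_⟩
    have h : N (i, j) ≤ k := (Finset.le_sup (Finset.mem_univ _)).trans hk
    rw [Φ_apply, (hN _ k h).1, (hN _ (k + 1) (by omega)).1]
    simp only [map_zero, smul_zero, add_zero]
  obtain ⟨K, hK⟩ := hK
  clear hN
  induction K generalizing x with
  | zero =>
    refine ⟨0, ?_⟩
    rw [map_zero]
    refine Subtype.ext (funext fun ⟨i, j⟩ => (hθ.eq_zero hu ?_).symm)
    rw [hI, show Φ hn i j (θ (x.1 (i, j))) = 0 from funext fun k => hK i j k (Nat.zero_le k),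
      map_zero]
  | succ K ih =>
    have htop : ∀ i j, θ (x.1 (i, j)) (K + 1) = L hn K i j (Φ hn i j (θ (x.1 (i, j))) K) :=
      fun i j => by
        rw [congrFun (hI x i j) (K + 1), I_succ, hK i j (K + 1) le_rfl, smul_zero, add_zero]
    obtain ⟨y, hy⟩ := exists_P_Q_eq (fun i j => P_Φ i j (θ (x.1 (i, j))) K)
      (fun i j => Q_Φ i j (θ (x.1 (i, j))) K) (fun i => by
        simp only [← htop]
        rw [← Finset.sum_apply, ← Finset.sum_apply, ← map_sum, ← map_sum, hx])
    obtain ⟨b, hb⟩ := ih (x - mulMap hu.toIsMagic (ψ hn u K y)) (fun j => by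
        simp only [Submodule.coe_sub, Pi.sub_apply, Finset.sum_sub_distrib, hx]
        simp [mulMap, ← Finset.mul_sum, hu.sum_offDiag, hu.sum_offDiag_left])
      (fun i j k hk => by
        rcases eq_or_ne i j with rfl | hij
        · rw [hdiag, map_zero, map_zero, Pi.zero_apply]
        · have h1 : (x - mulMap hu.toIsMagic (ψ hn u K y)).1 (i, j) =
              x.1 (i, j) - ψ hn u K y * u i j := by simp [mulMap, offDiag, hij]
          rw [h1, map_sub, map_sub, hθ.Φ_mul, hθ.apply_ψ, Pi.sub_apply, sub_eq_zero,
            Φ_apply i j (Pi.single K y), Pi.single_eq_of_ne (by omega : k + 1 ≠ K), map_zero,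
            smul_zero, add_zero]
          rcases hk.eq_or_lt with rfl | hk
          · rw [Pi.single_eq_same, hy i j hij]
          · rw [hK i j k hk, Pi.single_eq_of_ne (by omega), map_zero, map_zero])
    exact ⟨b + ψ hn u K y, by rw [map_add, hb, sub_add_cancel]⟩

end Model

end Tower

lemma isUniversalMagic_ASu (n : ℕ) :
    IsUniversalMagic fun i j => ASu (0 : Matrix (Fin n) (Fin n) ℂ) i j where
  row i j k := by
    have := RingQuot.mkAlgHom_rel ℂ (ASRel.row_orth (d := 0) i j k)
    rw [map_mul] at this
    rw [ASu, ASu, this]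
    split_ifs <;> simp
  col i j k := by
    have := RingQuot.mkAlgHom_rel ℂ (ASRel.col_orth (d := 0) i j k)
    rw [map_mul] at this
    rw [ASu, ASu, this]
    split_ifs <;> simp
  row_sum i := by
    have := RingQuot.mkAlgHom_rel ℂ (ASRel.row_sum (d := 0) i)
    rwa [map_sum, map_one] at this
  col_sum i := by
    have := RingQuot.mkAlgHom_rel ℂ (ASRel.col_sum (d := 0) i)
    rwa [map_sum, map_one] at this
  adjoin_eq_top := by
    have h : (Set.range fun p : Fin n × Fin n => ASu (0 : Matrix (Fin n) (Fin n) ℂ) p.1 p.2) =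
        RingQuot.mkAlgHom ℂ (ASRel n 0) '' Set.range (FreeAlgebra.ι ℂ) := by
      rw [← Set.range_comp]
      rfl
    rw [h, ← AlgHom.map_adjoin, FreeAlgebra.adjoin_range_ι, Algebra.map_top,
      AlgHom.range_eq_top]
    exact RingQuot.mkAlgHom_surjective ℂ _
  exists_lift {B} _ _ w hw := by
    refine ⟨RingQuot.liftAlgHom ℂ ⟨FreeAlgebra.lift ℂ fun p => w p.1 p.2, fun a b h => ?_⟩,
      fun i j => ?_⟩
    · induction h with
      | row_orth i j k =>
        rw [map_mul, FreeAlgebra.lift_ι_apply, FreeAlgebra.lift_ι_apply, hw.row]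
        split_ifs <;> simp
      | col_orth i j k =>
        rw [map_mul, FreeAlgebra.lift_ι_apply, FreeAlgebra.lift_ι_apply, hw.col]
        split_ifs <;> simp
      | row_sum i => simp [hw.row_sum]
      | col_sum i => simp [hw.col_sum]
      | inter i j => simp
    · simp [ASu, RingQuot.liftAlgHom_mkAlgHom_apply]

/-- For `n ≥ 4` and every `p ≥ 4` (written as `p = q + 1` with `q ≥ 3`),
every Hochschild `p`-cocycle with trivial coefficients on `A_s(n)` (realized as `A_s(n,d)`
with `d = 0`) is a coboundary; that is, `H^p(A_s(n), ℂ) = 0` for all `p ≥ 4`. -/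
theorem higher_cohomology_vanishes (n : ℕ) (hn : 4 ≤ n) (q : ℕ) (hq : 3 ≤ q)
    (f : MultilinearMap ℂ (fun _ : Fin (q + 1) => ASAlg n 0) ℂ)
    (hf : ∀ a, hdiff (ASeps n 0) (q + 1) ⇑f a = 0) :
    ∃ g : MultilinearMap ℂ (fun _ : Fin q => ASAlg n 0) ℂ,
      ∀ a, f a = hdiff (ASeps n 0) q ⇑g a := by
  have hu := isUniversalMagic_ASu n
  obtain ⟨r, rfl⟩ := Nat.exists_eq_add_of_le' hq
  let ρ : ASAlg n 0 →ₙₐ[ℂ] Module.End ℂ ℂ :=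
    ((Algebra.lmul ℂ ℂ).comp (ASeps n 0) : ASAlg n 0 →ₐ[ℂ] Module.End ℂ ℂ)
  have hcobd : ∀ (p : ℕ) (f : (Fin p → ASAlg n 0) → ℂ) (a : Fin (p + 1) → ASAlg n 0),
      cobd (ASeps n 0) ρ p f a = hdiff (ASeps n 0) p f a := fun p f a => by
    simp only [cobd, hdiff, smul_eq_mul]
    rw [mul_right_comm]
    rfl
  obtain ⟨g, hg⟩ := cohomologyVanishes_add_three hu (ASeps_u 0)
    (fun a => Tower.eq_zero_of_mul_eq_zero hn hu) (Tower.exists_mulMap_eq_of_sum_eq hn hu) r ρ f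
    fun a => (hcobd _ _ a).trans (hf a)
  exact ⟨g, fun a => (hg a).trans (hcobd _ _ a)⟩
end

section
/- Let A be a Hopf algebra over ℂ, B ⊆ A a Hopf subalgebra, and t ∈ A a right A/B-integral. Let M, N be right A-modules and f : M → N a B-linear map (i.e., ℂ-linear with f(x·b) = f(x)·b for all b ∈ B). Define f̃ : M → N by f̃(x) = Σ f(x·S(t₍₁₎))·t₍₂₎, where Δ(t) = Σ t₍₁₎ ⊗ t₍₂₎ (formally, f̃(x) is the image of (S ⊗ id)(Δ(t)) under the bilinear map A × A → N, (a, a') ↦ f(x·a)·a'). Then: (1) f̃ is A-linear; (2) if i : N → M is an A-linear map with f ∘ i = id_N, then f̃ ∘ i = ε(t)·id_N. -/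
open MulOpposite

/-- `B⁺A`: the linear span of the products `b·a` with `b ∈ B`, `ε(b) = 0` and `a ∈ A`. -/
def BplusA {A : Type*} [Ring A] [HopfAlgebra ℂ A] (B : Subalgebra ℂ A) : Submodule ℂ A :=
  Submodule.span ℂ
    {x : A | ∃ b a : A, b ∈ B ∧ Coalgebra.counit (R := ℂ) b = 0 ∧ x = b * a}

/-- A Hopf subalgebra: a subalgebra `B ⊆ A` with `Δ(B)` contained in the image of
`B ⊗ B` in `A ⊗ A` and `S(B) ⊆ B`. -/
def IsHopfSubalgebra {A : Type*} [Ring A] [HopfAlgebra ℂ A] (B : Subalgebra ℂ A) : Prop :=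
  (∀ b ∈ B, Coalgebra.comul (R := ℂ) b ∈
      LinearMap.range (TensorProduct.map B.val.toLinearMap B.val.toLinearMap))
  ∧ ∀ b ∈ B, HopfAlgebra.antipode (R := ℂ) b ∈ B

/-- A right `A/B`-integral: an element `t ∈ A` with `ta − ε(a)t ∈ B⁺A` for all `a ∈ A`. -/
def IsRightRelIntegral {A : Type*} [Ring A] [HopfAlgebra ℂ A] (B : Subalgebra ℂ A)
    (t : A) : Prop :=
  ∀ a : A, t * a - Coalgebra.counit (R := ℂ) a • t ∈ BplusA B

/-- The averaged map `f̃(x) = Σ f(x·S(t₍₁₎))·t₍₂₎`: the image of `(S ⊗ id)(Δ(t))` under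
the bilinear map `(a, a') ↦ f(x·a)·a'`, for right `A`-modules `M`, `N` (left
`Aᵐᵒᵖ`-modules) and a `ℂ`-linear map `f : M → N`. -/
noncomputable def ftilde {A : Type*} [Ring A] [HopfAlgebra ℂ A] {M N : Type*}
    [AddCommGroup M] [Module ℂ M] [Module Aᵐᵒᵖ M] [IsScalarTower ℂ Aᵐᵒᵖ M]
    [AddCommGroup N] [Module ℂ N] [Module Aᵐᵒᵖ N] [IsScalarTower ℂ Aᵐᵒᵖ N]
    [SMulCommClass ℂ Aᵐᵒᵖ N]
    (t : A) (f : M →ₗ[ℂ] N) (x : M) : N :=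
  TensorProduct.lift
    (LinearMap.mk₂ ℂ (fun a a' : A => op a' • f (op a • x))
      (fun a₁ a₂ a' => by simp only [op_add, add_smul, map_add, smul_add])
      (fun c a a' => by
        show op a' • f (op (c • a) • x) = c • (op a' • f (op a • x))
        rw [op_smul, smul_assoc, map_smul, smul_comm])
      (fun a a'₁ a'₂ => by simp only [op_add, add_smul])
      (fun c a a' => by simp only [op_smul, smul_assoc]))
    ((TensorProduct.map (HopfAlgebra.antipode (R := ℂ)) LinearMap.id)
      (Coalgebra.comul (R := ℂ) t))

open Coalgebra HopfAlgebra TensorProduct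

section HopfIdentity

variable {R A ι : Type*} [CommSemiring R] [Semiring A] [HopfAlgebra R A]

/-- The Hopf identity `Σ a₍₁₎ S(a₍₂₎) ⊗ a₍₃₎ = 1 ⊗ a`. -/
theorem sum_mul_antipode_tmul_eq {κ : ι → Type*} {a : A} (r : Repr R a ι)
    (s : (i : ι) → Repr R (r.right i) (κ i)) :
    ∑ i ∈ r.index, ∑ j ∈ (s i).index,
      (r.left i * antipode R ((s i).left j)) ⊗ₜ[R] (s i).right j = 1 ⊗ₜ[R] a := by
  have h := congrArg ((LinearMap.rTensor A (LinearMap.mul' R A ∘ₗ LinearMap.lTensor A (antipode R)))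
    ∘ₗ (TensorProduct.assoc R A A A).symm.toLinearMap)
    (sum_tmul_tmul_eq r (fun i => ℛ R (r.left i)) s)
  simp only [map_sum, LinearMap.comp_apply, LinearEquiv.coe_coe, TensorProduct.assoc_symm_tmul,
    LinearMap.rTensor_tmul, LinearMap.lTensor_tmul, LinearMap.mul'_apply] at h
  rw [← h]
  simp only [← TensorProduct.sum_tmul, sum_mul_antipode_eq_smul, TensorProduct.smul_tmul]
  rw [← TensorProduct.tmul_sum, sum_counit_smul]

/-- The identity `Σ ε(a₍₂₎) a₍₁₎ = a`. -/
theorem sum_counit_right_smul {a : A} (r : Repr R a ι) :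
    ∑ i ∈ r.index, counit (R := R) (r.right i) • r.left i = a := by
  simpa only [map_sum, TensorProduct.rid_tmul, one_smul]
    using congrArg (TensorProduct.rid R A) (sum_tmul_counit_eq r)

end HopfIdentity

section Averaging

variable {A : Type*} [Ring A] [HopfAlgebra ℂ A] {M N : Type*}
  [AddCommGroup M] [Module ℂ M] [Module Aᵐᵒᵖ M] [IsScalarTower ℂ Aᵐᵒᵖ M]
  [AddCommGroup N] [Module ℂ N] [Module Aᵐᵒᵖ N] [IsScalarTower ℂ Aᵐᵒᵖ N]

/-- The linear map `A ⊗ A → N`, `u ⊗ v ↦ f(x·u)·v`. -/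
noncomputable def sandwich (f : M →ₗ[ℂ] N) (x : M) : A ⊗[ℂ] A →ₗ[ℂ] N :=
  TensorProduct.lift
    (LinearMap.mk₂ ℂ (fun a a' : A => op a' • f (op a • x))
      (fun a₁ a₂ a' => by simp only [op_add, add_smul, map_add, smul_add])
      (fun c a a' => by
        change op a' • f (op (c • a) • x) = c • (op a' • f (op a • x))
        rw [op_smul, smul_assoc, map_smul, smul_comm])
      (fun a a'₁ a'₂ => by simp only [op_add, add_smul])
      (fun c a a' => by simp only [op_smul, smul_assoc]))

@[simp]
theorem sandwich_tmul (f : M →ₗ[ℂ] N) (x : M) (u v : A) :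
    sandwich f x (u ⊗ₜ[ℂ] v) = op v • f (op u • x) := rfl

/-- The linear map `A ⊗ A → N`, `u ⊗ v ↦ f(x·S(u))·v`. -/
noncomputable def antipodeSandwich (f : M →ₗ[ℂ] N) (x : M) : A ⊗[ℂ] A →ₗ[ℂ] N :=
  sandwich f x ∘ₗ TensorProduct.map (antipode ℂ) LinearMap.id

@[simp]
theorem antipodeSandwich_tmul (f : M →ₗ[ℂ] N) (x : M) (u v : A) :
    antipodeSandwich f x (u ⊗ₜ[ℂ] v) = op v • f (op (antipode ℂ u) • x) := rfl

theorem ftilde_eq_antipodeSandwich (t : A) (f : M →ₗ[ℂ] N) (x : M) :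
    ftilde t f x = antipodeSandwich f x (comul t) := rfl

theorem antipodeSandwich_sum_smul {ι : Type*} (s : Finset ι) (c : ι → ℂ) (a : ι → A)
    (f : M →ₗ[ℂ] N) (x : M) (p : A ⊗[ℂ] A) :
    ∑ i ∈ s, c i • antipodeSandwich f (op (a i) • x) p =
      antipodeSandwich f (op (∑ i ∈ s, c i • a i) • x) p := by
  induction p with
  | zero => simp
  | add p q hp hq => simp only [map_add, smul_add, Finset.sum_add_distrib, hp, hq]
  | tmul u v =>
    simp only [antipodeSandwich_tmul, Finset.op_sum, Finset.sum_smul, map_sum, Finset.smul_sum,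
      op_smul, smul_assoc]
    refine Finset.sum_congr rfl fun i _ => ?_
    rw [smul_comm (op (antipode ℂ u)) (c i), smul_comm (c i) (op v), map_smul f (c i)]

/-- `Σ f(x·a₍₁₎·S(u a₍₂₎))·v a₍₃₎ = f(x·S(u))·v a`, extended linearly in `u ⊗ v`. -/
theorem sum_antipodeSandwich_mul_comul {ι : Type*} {a : A} (r : Repr ℂ a ι)
    (f : M →ₗ[ℂ] N) (x : M) (p : A ⊗[ℂ] A) :
    ∑ i ∈ r.index, antipodeSandwich f (op (r.left i) • x) (p * comul (r.right i)) =
      op a • antipodeSandwich f x p := by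
  induction p with
  | zero => simp
  | add p q hp hq => simp only [add_mul, map_add, smul_add, Finset.sum_add_distrib, hp, hq]
  | tmul u v =>
    have h := congrArg (sandwich f x ∘ₗ TensorProduct.map
      (LinearMap.mulRight ℂ (antipode ℂ u)) (LinearMap.mulLeft ℂ v))
      (sum_mul_antipode_tmul_eq r (fun i => ℛ ℂ (r.right i)))
    simp only [map_sum, LinearMap.comp_apply, TensorProduct.map_tmul, LinearMap.mulRight_apply,
      LinearMap.mulLeft_apply, sandwich_tmul, one_mul] at h
    rw [antipodeSandwich_tmul, smul_smul, ← op_mul, ← h]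
    refine Finset.sum_congr rfl fun i _ => ?_
    conv_lhs => rw [← (ℛ ℂ (r.right i)).eq]
    simp only [Finset.mul_sum, map_sum, Algebra.TensorProduct.tmul_mul_tmul,
      antipodeSandwich_tmul, antipode_mul_antidistrib, smul_smul, ← op_mul, mul_assoc]

variable {B : Subalgebra ℂ A}

/-- If `f` is `B`-linear and `S(B) ⊆ B`, then
`f(x·S(b₍₁₎ u))·b₍₂₎ v = f(x·S(u))·S(b₍₁₎) b₍₂₎ v`, extended linearly over `B ⊗ B`. -/
theorem antipodeSandwich_map_val_mul (hS : ∀ b ∈ B, antipode ℂ b ∈ B)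
    (f : M →ₗ[ℂ] N) (hf : ∀ b ∈ B, ∀ x : M, f (op b • x) = op b • f x)
    (x : M) (q : B ⊗[ℂ] B) (u v : A) :
    antipodeSandwich f x
        (TensorProduct.map B.val.toLinearMap B.val.toLinearMap q * u ⊗ₜ[ℂ] v) =
      op (LinearMap.mul' ℂ A ((antipode ℂ).rTensor A
        (TensorProduct.map B.val.toLinearMap B.val.toLinearMap q)) * v) •
          f (op (antipode ℂ u) • x) := by
  induction q with
  | zero => simp
  | add p q hp hq => simp only [add_mul, map_add, hp, hq, op_add, add_smul]
  | tmul b c =>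
    simp only [TensorProduct.map_tmul, AlgHom.toLinearMap_apply, Subalgebra.coe_val,
      Algebra.TensorProduct.tmul_mul_tmul, antipodeSandwich_tmul, antipode_mul_antidistrib,
      LinearMap.rTensor_tmul, LinearMap.mul'_apply]
    rw [op_mul (antipode ℂ u), mul_smul, hf _ (hS b b.2), smul_smul, ← op_mul, mul_assoc]

theorem antipodeSandwich_comul_mul (hB : IsHopfSubalgebra B)
    (f : M →ₗ[ℂ] N) (hf : ∀ b ∈ B, ∀ x : M, f (op b • x) = op b • f x)
    (x : M) {b : A} (hb : b ∈ B) (p : A ⊗[ℂ] A) :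
    antipodeSandwich f x (comul b * p) = counit (R := ℂ) b • antipodeSandwich f x p := by
  obtain ⟨q, hq⟩ := hB.1 b hb
  induction p with
  | zero => simp
  | add p q hp hq => simp only [mul_add, map_add, smul_add, hp, hq]
  | tmul u v =>
    rw [← hq, antipodeSandwich_map_val_mul hB.2 f hf, hq, mul_antipode_rTensor_comul_apply,
      ← Algebra.smul_def, op_smul, smul_assoc, antipodeSandwich_tmul]

theorem antipodeSandwich_comul_eq_zero (hB : IsHopfSubalgebra B)
    (f : M →ₗ[ℂ] N) (hf : ∀ b ∈ B, ∀ x : M, f (op b • x) = op b • f x)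
    (x : M) {y : A} (hy : y ∈ BplusA B) :
    antipodeSandwich f x (comul y) = 0 := by
  have h : BplusA B ≤ LinearMap.ker (antipodeSandwich f x ∘ₗ comul) := by
    refine Submodule.span_le.2 ?_
    rintro _ ⟨b, a, hb, hε, rfl⟩
    simp [antipodeSandwich_comul_mul hB f hf x hb, hε]
  exact h hy

theorem ftilde_smul (hB : IsHopfSubalgebra B) {t : A} (ht : IsRightRelIntegral B t)
    (f : M →ₗ[ℂ] N) (hf : ∀ b ∈ B, ∀ x : M, f (op b • x) = op b • f x) (a : A) (x : M) :
    ftilde t f (op a • x) = op a • ftilde t f x := by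
  have key (y : M) (c : A) : antipodeSandwich f y (comul t * comul c) =
      counit (R := ℂ) c • antipodeSandwich f y (comul t) := by
    have h := antipodeSandwich_comul_eq_zero hB f hf y (ht c)
    rwa [map_sub, map_smul, map_sub, map_smul, Bialgebra.comul_mul, sub_eq_zero] at h
  rw [ftilde_eq_antipodeSandwich, ftilde_eq_antipodeSandwich,
    ← sum_antipodeSandwich_mul_comul (ℛ ℂ a)]
  simp only [key]
  rw [antipodeSandwich_sum_smul, sum_counit_right_smul]

theorem ftilde_section (t : A) (f : M →ₗ[ℂ] N) (i : N →ₗ[ℂ] M)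
    (hi : ∀ (a : A) (y : N), i (op a • y) = op a • i y) (hfi : ∀ y : N, f (i y) = y) (y : N) :
    ftilde t f (i y) = counit (R := ℂ) t • y := by
  rw [ftilde_eq_antipodeSandwich, ← (ℛ ℂ t).eq]
  simp only [map_sum, antipodeSandwich_tmul, ← hi, hfi, smul_smul, ← op_mul]
  rw [← Finset.sum_smul, ← Finset.op_sum, sum_antipode_mul_eq_smul, op_smul, op_one, smul_assoc, one_smul]

end Averaging

/-- Lemma 3.4: let `B ⊆ A` be a Hopf subalgebra, `t` a right
`A/B`-integral, `M`, `N` right `A`-modules and `f : M → N` a `B`-linear map. Then the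
averaged map `f̃(x) = Σ f(x·S(t₍₁₎))·t₍₂₎` is `A`-linear, and if `i : N → M` is `A`-linear
with `f ∘ i = id_N`, then `f̃ ∘ i = ε(t)·id_N`. -/
theorem ftilde_linear_and_section {A : Type*} [Ring A] [HopfAlgebra ℂ A]
    (B : Subalgebra ℂ A) (hB : IsHopfSubalgebra B)
    (t : A) (ht : IsRightRelIntegral B t)
    {M N : Type*}
    [AddCommGroup M] [Module ℂ M] [Module Aᵐᵒᵖ M] [IsScalarTower ℂ Aᵐᵒᵖ M]
    [AddCommGroup N] [Module ℂ N] [Module Aᵐᵒᵖ N] [IsScalarTower ℂ Aᵐᵒᵖ N]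
    [SMulCommClass ℂ Aᵐᵒᵖ N]
    (f : M →ₗ[ℂ] N) (hf : ∀ b ∈ B, ∀ x : M, f (op b • x) = op b • f x) :
    (∀ (a : A) (x : M), ftilde t f (op a • x) = op a • ftilde t f x)
    ∧ ∀ i : N →ₗ[ℂ] M, (∀ (a : A) (y : N), i (op a • y) = op a • i y) →
        (∀ y : N, f (i y) = y) →
        ∀ y : N, ftilde t f (i y) = Coalgebra.counit (R := ℂ) t • y := by
  exact ⟨ftilde_smul hB ht f hf, fun i hi hfi y => ftilde_section t f i hi hfi y⟩
end

section
/- Let A be a Hopf algebra over ℂ with bijective antipode, let B ⊆ A be a Hopf subalgebra such that A is faithfully flat as a left B-module (via the inclusion), and suppose there exists a non-trivial right A/B-integral t ∈ A (i.e., t ∉ B⁺A). Then the quotient vector space A/B⁺A is finite-dimensional over ℂ, and A is finitely generated and projective both as a right B-module and as a left B-module. -/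
open MulOpposite

/-- A left module `M` over a (possibly noncommutative) ring `R` is flat, expressed by the
standard equational criterion: every relation `Σ rᵢ xᵢ = 0` comes from a matrix
factorization through relations in `R`. -/
def LeftFlat (R : Type*) [Ring R] (M : Type*) [AddCommGroup M] [Module R M] : Prop :=
  ∀ (k : ℕ) (r : Fin k → R) (x : Fin k → M), ∑ i, r i • x i = 0 →
    ∃ (m : ℕ) (c : Fin k → Fin m → R) (y : Fin m → M),
      (∀ i, x i = ∑ j, c i j • y j) ∧ ∀ j, ∑ i, r i * c i j = 0

/-- A left module `M` over a (possibly noncommutative) ring `R` is faithfully flat: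
it is flat and `I·M ≠ M` for every proper right ideal `I` of `R`. -/
def LeftFaithfullyFlat (R : Type*) [Ring R] (M : Type*) [AddCommGroup M] [Module R M] :
    Prop :=
  LeftFlat R M ∧ ∀ I : Submodule Rᵐᵒᵖ R, I ≠ ⊤ →
    AddSubgroup.closure {z : M | ∃ r ∈ I, ∃ x : M, z = r • x} ≠ ⊤

/-- `A` is finitely generated and projective as a right `B`-module, expressed through the
dual basis characterization: there are `x₁,…,x_k ∈ A` and right-`B`-linear functionals
`f₁,…,f_k : A → B` with `a = Σ xᵢ·fᵢ(a)` for all `a`. -/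
def FGProjRight {A : Type*} [Ring A] [Algebra ℂ A] (B : Subalgebra ℂ A) : Prop :=
  ∃ (k : ℕ) (x : Fin k → A) (f : Fin k → (A →ₗ[ℂ] ↥B)),
    (∀ (i : Fin k) (a : A) (b : ↥B), f i (a * ↑b) = f i a * b)
    ∧ ∀ a : A, a = ∑ i, x i * ↑(f i a)

/-- `A` is finitely generated and projective as a left `B`-module, expressed through the
dual basis characterization. -/
def FGProjLeft {A : Type*} [Ring A] [Algebra ℂ A] (B : Subalgebra ℂ A) : Prop :=
  ∃ (k : ℕ) (x : Fin k → A) (f : Fin k → (A →ₗ[ℂ] ↥B)),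
    (∀ (i : Fin k) (b : ↥B) (a : A), f i (↑b * a) = b * f i a)
    ∧ ∀ a : A, a = ∑ i, ↑(f i a) * x i

open scoped TensorProduct

section Flatness

theorem LeftFlat.exists_factorization_fin {R M : Type*} [Ring R] [AddCommGroup M] [Module R M]
    (h : LeftFlat R M) (L : ℕ) {k : ℕ} (r : Fin L → Fin k → R) (x : Fin k → M)
    (hx : ∀ l, ∑ i, r l i • x i = 0) :
    ∃ (m : ℕ) (c : Fin k → Fin m → R) (y : Fin m → M),
      (∀ i, x i = ∑ j, c i j • y j) ∧ ∀ l j, ∑ i, r l i * c i j = 0 := by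
  induction L with
  | zero =>
    exact ⟨k, fun i j => if i = j then 1 else 0, x, fun i => by simp [ite_smul], fun l => l.elim0⟩
  | succ L ih =>
    obtain ⟨m, c, y, hc, hr⟩ := ih (fun l => r l.castSucc) fun l => hx l.castSucc
    obtain ⟨m', c', y', hc', hr'⟩ := h m (fun j => ∑ i, r (Fin.last L) i * c i j) y (by
      rw [← hx (Fin.last L)]
      simp_rw [hc, Finset.smul_sum, Finset.sum_smul, mul_smul]
      exact Finset.sum_comm)
    refine ⟨m', fun i j' => ∑ j, c i j * c' j j', y', fun i => ?_, fun l j' => ?_⟩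
    · simp_rw [hc i, hc', Finset.smul_sum, Finset.sum_smul, mul_smul]
      exact Finset.sum_comm
    · have key : ∀ l, ∑ i, r l i * ∑ j, c i j * c' j j'
          = ∑ j, (∑ i, r l i * c i j) * c' j j' := fun l => by
        simp_rw [Finset.mul_sum, Finset.sum_mul, mul_assoc]
        exact Finset.sum_comm
      rw [key]
      induction l using Fin.lastCases with
      | last => exact hr' j'
      | cast l => simp [hr l]

/-- The equational criterion of flatness for a finite system of relations. -/
theorem LeftFlat.exists_factorization {R M : Type*} [Ring R] [AddCommGroup M] [Module R M]
    (h : LeftFlat R M) {L K : Type*} [Finite L] [Fintype K] (r : L → K → R) (x : K → M)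
    (hx : ∀ l, ∑ i, r l i • x i = 0) :
    ∃ (m : ℕ) (c : K → Fin m → R) (y : Fin m → M),
      (∀ i, x i = ∑ j, c i j • y j) ∧ ∀ l j, ∑ i, r l i * c i j = 0 := by
  have := Fintype.ofFinite L
  let e := Fintype.equivFin K
  let f := Fintype.equivFin L
  obtain ⟨m, c, y, hc, hr⟩ := h.exists_factorization_fin (Fintype.card L)
    (fun l i => r (f.symm l) (e.symm i)) (fun i => x (e.symm i)) (fun l => by
      rw [← hx (f.symm l)]
      exact e.symm.sum_comp fun i => r (f.symm l) i • x i)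
  refine ⟨m, fun i => c (e i), y, fun i => by simpa using hc (e i), fun l j => ?_⟩
  have := hr (f l) j
  rw [← e.symm.sum_comp]
  simpa using this

variable {A : Type*} [Ring A] [Algebra ℂ A] {B : Subalgebra ℂ A}
variable {M N : Type*} [AddCommGroup M] [Module ℂ M] [AddCommGroup N] [Module ℂ N]

/-- For a right `B`-module `N` with action `act` and `P ⊆ N`, the kernel of
`N ⊗ A → (N ⧸ P) ⊗_B A`. -/
def balancedRel (act : ↥B →ₗ[ℂ] N →ₗ[ℂ] N) (P : Submodule ℂ N) : Submodule ℂ (N ⊗[ℂ] A) :=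
  Submodule.span ℂ {z | ∃ (n : N) (b : ↥B) (a : A), z = act b n ⊗ₜ a - n ⊗ₜ ((b : A) * a)} ⊔
    Submodule.span ℂ {z | ∃ p ∈ P, ∃ a : A, z = p ⊗ₜ a}

theorem act_tmul_sub_mem (act : ↥B →ₗ[ℂ] N →ₗ[ℂ] N) (P : Submodule ℂ N) (n : N) (b : ↥B) (a : A) :
    act b n ⊗ₜ a - n ⊗ₜ ((b : A) * a) ∈ balancedRel act P :=
  Submodule.mem_sup_left (Submodule.subset_span ⟨n, b, a, rfl⟩)

theorem tmul_mem_balancedRel (act : ↥B →ₗ[ℂ] N →ₗ[ℂ] N) {P : Submodule ℂ N} {p : N} (hp : p ∈ P)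
    (a : A) : p ⊗ₜ a ∈ balancedRel act P :=
  Submodule.mem_sup_right (Submodule.subset_span ⟨p, hp, a, rfl⟩)

theorem balancedRel_le {act : ↥B →ₗ[ℂ] N →ₗ[ℂ] N} {P : Submodule ℂ N}
    {U : Submodule ℂ (N ⊗[ℂ] A)} (h₁ : ∀ n b a, act b n ⊗ₜ a - n ⊗ₜ ((b : A) * a) ∈ U)
    (h₂ : ∀ p ∈ P, ∀ a : A, p ⊗ₜ a ∈ U) : balancedRel act P ≤ U :=
  sup_le (Submodule.span_le.2 fun _ ⟨n, b, a, h⟩ => h ▸ h₁ n b a)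
    (Submodule.span_le.2 fun _ ⟨p, hp, a, h⟩ => h ▸ h₂ p hp a)

theorem balancedRel_mono (act : ↥B →ₗ[ℂ] N →ₗ[ℂ] N) {P Q : Submodule ℂ N} (h : P ≤ Q) :
    balancedRel act P ≤ balancedRel act Q :=
  balancedRel_le (act_tmul_sub_mem act Q) fun _ hp => tmul_mem_balancedRel act (h hp)

theorem exists_sum_of_mem_balancedRel {act : ↥B →ₗ[ℂ] N →ₗ[ℂ] N} {P : Submodule ℂ N}
    {z : N ⊗[ℂ] A} (hz : z ∈ balancedRel act P) :
    ∃ (L : ℕ) (m : Fin L → N) (b : Fin L → ↥B) (a : Fin L → A),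
      z - ∑ l, (act (b l) (m l) ⊗ₜ a l - m l ⊗ₜ ((b l : A) * a l)) ∈
        Submodule.span ℂ {z | ∃ p ∈ P, ∃ a : A, z = p ⊗ₜ[ℂ] a} := by
  obtain ⟨u, hu, v, hv, rfl⟩ := Submodule.mem_sup.1 hz
  obtain ⟨L, t, g, rfl⟩ := Submodule.mem_span_set'.1 hu
  choose m b a h using fun l => (g l).2
  refine ⟨L, fun l => t l • m l, b, a, ?_⟩
  have : ∀ l, t l • (g l : N ⊗[ℂ] A) =
      act (b l) (t l • m l) ⊗ₜ a l - (t l • m l) ⊗ₜ ((b l : A) * a l) := fun l => by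
    rw [h, map_smul, smul_sub, TensorProduct.smul_tmul', TensorProduct.smul_tmul']
  simpa [this] using hv

/-- Tensoring with a flat left module preserves injectivity, in terms of `balancedRel`. -/
theorem LeftFlat.mem_balancedRel_comap (h : LeftFlat ↥B A)
    {actM : ↥B →ₗ[ℂ] M →ₗ[ℂ] M} {act : ↥B →ₗ[ℂ] N →ₗ[ℂ] N} {P : Submodule ℂ N}
    (hmul : ∀ b c n, act (b * c) n = act c (act b n)) (hP : ∀ b, ∀ p ∈ P, act b p ∈ P)
    (φ : M →ₗ[ℂ] N) (hφ : ∀ b m, φ (actM b m) - act b (φ m) ∈ P) {z : M ⊗[ℂ] A}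
    (hz : φ.rTensor A z ∈ balancedRel act P) : z ∈ balancedRel actM (P.comap φ) := by
  obtain ⟨L, m, b, a, hp⟩ := exists_sum_of_mem_balancedRel hz
  let y := Module.Basis.ofVectorSpace ℂ A
  obtain ⟨n, rfl⟩ := TensorProduct.eq_repr_basis_right y z
  classical
  let s : Finset _ := n.support ∪ Finset.univ.biUnion (fun l => (y.repr (a l)).support) ∪
    Finset.univ.biUnion (fun l => (y.repr ((b l : A) * a l)).support)
  have hs₁ : n.support ⊆ s := fun j hj => by
    simp only [s, Finset.mem_union]
    exact Or.inl (Or.inl hj)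
  have hs₂ : ∀ l, (y.repr (a l)).support ⊆ s := fun l j hj => by
    simp only [s, Finset.mem_union, Finset.mem_biUnion, Finset.mem_univ, true_and]
    exact Or.inl (Or.inr ⟨l, hj⟩)
  have hs₃ : ∀ l, (y.repr ((b l : A) * a l)).support ⊆ s := fun l j hj => by
    simp only [s, Finset.mem_union, Finset.mem_biUnion, Finset.mem_univ, true_and]
    exact Or.inr ⟨l, hj⟩
  have expand : ∀ w : A, (y.repr w).support ⊆ s → ∑ j : s, y.repr w j • y j = w := fun w hw => by
    conv_rhs => rw [← y.linearCombination_repr w, Finsupp.linearCombination_apply,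
      Finsupp.sum_of_support_subset _ hw _ (by simp)]
    exact Finset.sum_coe_sort s fun j => y.repr w j • y j
  have coord : ∀ j, φ (n j) - ∑ l, (y.repr (a l) j • act (b l) (m l)
      - y.repr ((b l : A) * a l) j • m l) ∈ P := fun j => by
    have hle : Submodule.span ℂ {z | ∃ p ∈ P, ∃ a : A, z = p ⊗ₜ[ℂ] a} ≤
        P.comap ((TensorProduct.rid ℂ N).toLinearMap ∘ₗ (y.coord j).lTensor N) :=
      Submodule.span_le.2 fun _ ⟨p, hp, a, h⟩ => by
        subst h
        simpa using P.smul_mem _ hp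
    have := hle hp
    rw [Submodule.mem_comap, map_sub, map_sum, Finsupp.sum, map_sum, map_sum] at this
    convert this using 2
    · simp +contextual [Finsupp.single_apply]
    · simp
  obtain ⟨k, c, x, hc, hr⟩ := h.exists_factorization
    (fun l (j : s) => y.repr (a l) j • b l - algebraMap ℂ ↥B (y.repr ((b l : A) * a l) j))
    (fun j => y j) (fun l => by
      have h₁ : ∀ j : s, (y.repr (a l) j • b l - algebraMap ℂ ↥B (y.repr ((b l : A) * a l) j)) • y j
          = (b l : A) * (y.repr (a l) j • y j) - y.repr ((b l : A) * a l) j • y j := fun j => by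
        rw [sub_smul, algebraMap_smul, mul_smul_comm, smul_assoc]
        rfl
      simp_rw [h₁, Finset.sum_sub_distrib, ← Finset.mul_sum]
      rw [expand _ (hs₂ l), expand _ (hs₃ l), sub_self])
  have hsum : n.sum (fun j m => m ⊗ₜ[ℂ] y j) = ∑ j : s, ∑ i, n j ⊗ₜ[ℂ] ((c j i : A) * x i) := by
    rw [Finsupp.sum_of_support_subset _ hs₁ _ (by simp), ← Finset.sum_coe_sort]
    refine Finset.sum_congr rfl fun j _ => ?_
    rw [hc, TensorProduct.tmul_sum]
    rfl
  have hker : ∀ i, ∑ j : s, actM (c j i) (n j) ∈ P.comap φ := fun i => by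
    have h₁ : ∑ j : s, act (c j i) (∑ l, (y.repr (a l) j • act (b l) (m l)
        - y.repr ((b l : A) * a l) j • m l)) = 0 := by
      have h₂ : ∀ (j : s) l, act (c j i) (y.repr (a l) j • act (b l) (m l)
          - y.repr ((b l : A) * a l) j • m l) = act ((y.repr (a l) j • b l
          - algebraMap ℂ ↥B (y.repr ((b l : A) * a l) j)) * c j i) (m l) := fun j l => by
        rw [sub_mul, smul_mul_assoc, ← Algebra.smul_def, map_sub, map_smul, map_smul, map_sub,
          map_smul, map_smul, LinearMap.sub_apply, LinearMap.smul_apply, LinearMap.smul_apply, hmul]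
      simp_rw [map_sum, h₂]
      rw [Finset.sum_comm]
      simp_rw [← LinearMap.sum_apply, ← map_sum, hr]
      simp
    rw [Submodule.mem_comap, map_sum, ← sub_zero (∑ j : s, φ _), ← h₁, ← Finset.sum_sub_distrib]
    refine sum_mem fun j _ => ?_
    rw [← sub_add_sub_cancel _ (act (c j i) (φ (n j))), ← map_sub]
    exact add_mem (hφ _ _) (hP _ _ (coord j))
  rw [hsum, Finset.sum_comm, ← sub_sub_self (∑ i, (∑ j : s, actM (c j i) (n j)) ⊗ₜ[ℂ] x i)
    (∑ i, ∑ j : s, n j ⊗ₜ[ℂ] ((c j i : A) * x i))]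
  refine sub_mem (sum_mem fun i _ => tmul_mem_balancedRel _ (hker i) _) ?_
  simp_rw [TensorProduct.sum_tmul, ← Finset.sum_sub_distrib]
  exact sum_mem fun i _ => sum_mem fun j _ => act_tmul_sub_mem _ _ _ _ _

end Flatness

section Faithful

variable {A : Type*} [Ring A] [Algebra ℂ A] {B : Subalgebra ℂ A}
variable {N : Type*} [AddCommGroup N] [Module ℂ N]

/-- Right multiplication by elements of `B` on a subalgebra containing it, as an action. -/
noncomputable def rightMul (B : Subalgebra ℂ A) : ↥B →ₗ[ℂ] A →ₗ[ℂ] A :=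
  (LinearMap.mul ℂ A).flip ∘ₗ B.val.toLinearMap

@[simp]
theorem rightMul_apply (b : ↥B) (a : A) : rightMul B b a = a * b := rfl

/-- Faithful flatness detects zero elements of `N ⧸ P`. -/
theorem LeftFaithfullyFlat.mem_of_tmul_one_mem (h : LeftFaithfullyFlat ↥B A)
    {act : ↥B →ₗ[ℂ] N →ₗ[ℂ] N} {P : Submodule ℂ N}
    (hone : ∀ n, act 1 n = n) (hmul : ∀ b c n, act (b * c) n = act c (act b n))
    (hP : ∀ b, ∀ p ∈ P, act b p ∈ P) {n : N} (hn : n ⊗ₜ[ℂ] (1 : A) ∈ balancedRel act P) :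
    n ∈ P := by
  let φ : ↥B →ₗ[ℂ] N := act.flip n
  have hφ : ∀ b m, φ ((LinearMap.mul ℂ ↥B).flip b m) - act b (φ m) ∈ P := fun b m => by
    simp [φ, hmul]
  have h1 : (1 : ↥B) ⊗ₜ[ℂ] (1 : A) ∈ balancedRel (LinearMap.mul ℂ ↥B).flip (P.comap φ) :=
    h.1.mem_balancedRel_comap hmul hP φ hφ (by simpa [φ, hone] using hn)
  let I : Submodule (↥B)ᵐᵒᵖ ↥B :=
    { carrier := {b | φ b ∈ P}
      add_mem' := fun ha hb => by
        simp only [Set.mem_ofPred_eq, map_add] at *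
        exact add_mem ha hb
      zero_mem' := by simp
      smul_mem' := fun c b hb => by
        simp only [Set.mem_ofPred_eq] at *
        rw [MulOpposite.smul_eq_mul_unop]
        simpa [φ, hmul] using hP c.unop _ hb }
  let U : Submodule ℂ A :=
    { AddSubgroup.closure {z : A | ∃ r ∈ I, ∃ x : A, z = r • x} with
      smul_mem' := fun c z hz => by
        refine AddSubgroup.closure_induction (p := fun z _ => c • z ∈ AddSubgroup.closure
          {z : A | ∃ r ∈ I, ∃ x : A, z = r • x}) ?_ ?_ ?_ ?_ hz
        · rintro _ ⟨r, hr, x, rfl⟩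
          exact AddSubgroup.subset_closure ⟨r, hr, c • x, (smul_comm _ _ _).symm⟩
        · simp
        · intro x y _ _ hx hy
          rw [smul_add]
          exact add_mem hx hy
        · intro x _ hx
          rw [smul_neg]
          exact neg_mem hx }
  have hU : ∀ r ∈ I, ∀ x : A, r • x ∈ U := fun r hr x => AddSubgroup.subset_closure ⟨r, hr, x, rfl⟩
  let μ : ↥B ⊗[ℂ] A →ₗ[ℂ] A := TensorProduct.lift (LinearMap.mul ℂ A ∘ₗ B.val.toLinearMap)
  have hle (c : A) : balancedRel (LinearMap.mul ℂ ↥B).flip (P.comap φ) ≤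
      U.comap (LinearMap.mulRight ℂ c ∘ₗ μ) :=
    balancedRel_le (fun n b a => by simp [μ, mul_assoc])
      (fun p hp a => by
        have := hU p hp (a * c)
        rw [Subalgebra.smul_def, smul_eq_mul] at this
        simpa [μ, mul_assoc] using this)
  have hI : I = ⊤ := by
    by_contra hI
    refine h.2 I hI (eq_top_iff.2 fun c _ => ?_)
    have : c ∈ U := by simpa [μ] using hle c h1
    exact this
  have : (1 : ↥B) ∈ I := hI ▸ Submodule.mem_top
  simpa [I, φ, hone] using this

end Faithful

section Antipode

open Coalgebra HopfAlgebra

variable {H : Type*} [Ring H] [HopfAlgebra ℂ H]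

/-- `Δ(B)` is contained in the image of `B ⊗ B`. -/
def ComulStable (B : Subalgebra ℂ H) : Prop :=
  ∀ b ∈ B, comul (R := ℂ) b ∈
    LinearMap.range (TensorProduct.map B.val.toLinearMap B.val.toLinearMap)

theorem mul'_rTensor_mul_one_tmul (f : H →ₗ[ℂ] H) (d : H ⊗[ℂ] H) (y : H) :
    LinearMap.mul' ℂ H (f.rTensor H (d * 1 ⊗ₜ y)) = LinearMap.mul' ℂ H (f.rTensor H d) * y := by
  induction d with
  | zero => simp
  | tmul a b => simp [mul_assoc]
  | add a b ha hb => simp only [add_mul, map_add, ha, hb]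

/-- A subalgebra stable under comultiplication over which the Hopf algebra is left faithfully flat
is stable under the antipode. -/
theorem antipode_mem_of_leftFaithfullyFlat {B : Subalgebra ℂ H}
    (hΔ : ComulStable B) (h : LeftFaithfullyFlat ↥B H) {x : H} (hx : x ∈ B) : antipode ℂ x ∈ B := by
  let act : ↥B →ₗ[ℂ] H ⊗[ℂ] H →ₗ[ℂ] H ⊗[ℂ] H := (LinearMap.mul ℂ (H ⊗[ℂ] H)).flip ∘ₗ
    (Algebra.TensorProduct.includeRight (R := ℂ) (A := H)).toLinearMap ∘ₗ B.val.toLinearMap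
  have act_apply (b n) : act b n = n * 1 ⊗ₜ (b : H) := rfl
  let P : Submodule ℂ (H ⊗[ℂ] H) :=
    Submodule.span ℂ {z | ∃ x ∈ B, ∃ y ∈ B, z = comul (R := ℂ) x * 1 ⊗ₜ y}
  have hP : ∀ b, ∀ p ∈ P, act b p ∈ P := fun b p hp => by
    refine (Submodule.span_le (p := P.comap (act b))).2 ?_ hp
    rintro _ ⟨x, hx, y, hy, rfl⟩
    refine Submodule.subset_span ⟨x, hx, y * b, B.mul_mem hy b.2, ?_⟩
    rw [act_apply, mul_assoc, Algebra.TensorProduct.tmul_mul_tmul, one_mul]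
  have hcomul : ∀ u ∈ B, comul (R := ℂ) u ∈ P := fun u hu =>
    Submodule.subset_span ⟨u, hu, 1, B.one_mem, by
      rw [← Algebra.TensorProduct.one_def, mul_one]⟩
  have hle : P ≤ (Subalgebra.toSubmodule B).comap
      (LinearMap.mul' ℂ H ∘ₗ (antipode ℂ).rTensor H) := by
    refine Submodule.span_le.2 ?_
    rintro _ ⟨x, hx, y, hy, rfl⟩
    change LinearMap.mul' ℂ H ((antipode ℂ).rTensor H (comul (R := ℂ) x * 1 ⊗ₜ y)) ∈ B
    rw [mul'_rTensor_mul_one_tmul, mul_antipode_rTensor_comul_apply]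
    exact B.mul_mem (B.algebraMap_mem _) hy
  suffices x ⊗ₜ 1 ∈ P by simpa using hle this
  refine h.mem_of_tmul_one_mem (act := act) (fun n => ?_) (fun b c n => ?_) hP ?_
  · rw [act_apply, B.coe_one, ← Algebra.TensorProduct.one_def, mul_one]
  · simp [act_apply, mul_assoc]
  let G : H ⊗[ℂ] (H ⊗[ℂ] H) →ₗ[ℂ] (H ⊗[ℂ] H) ⊗[ℂ] H :=
    (antipode ℂ).lTensor (H ⊗[ℂ] H) ∘ₗ (TensorProduct.assoc ℂ H H H).symm.toLinearMap
  let G' : H ⊗[ℂ] (H ⊗[ℂ] H) →ₗ[ℂ] (H ⊗[ℂ] H) ⊗[ℂ] H :=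
    TensorProduct.map (Algebra.TensorProduct.includeLeft (R := ℂ) (S := ℂ) (B := H)).toLinearMap
      (LinearMap.mul' ℂ H ∘ₗ (antipode ℂ).lTensor H)
  have hG (u : H) (d : ↥B ⊗[ℂ] ↥B) :
      G (u ⊗ₜ TensorProduct.map B.val.toLinearMap B.val.toLinearMap d) -
      G' (u ⊗ₜ TensorProduct.map B.val.toLinearMap B.val.toLinearMap d) ∈ balancedRel act P := by
    induction d with
    | zero => simp
    | tmul v w =>
      simpa [G, G', act_apply] using
        act_tmul_sub_mem act P (u ⊗ₜ 1) v (antipode ℂ (w : H))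
    | add a b ha hb =>
      simp only [TensorProduct.tmul_add, map_add, add_sub_add_comm]
      exact add_mem ha hb
  have hG' (w : ↥B ⊗[ℂ] ↥B) :
      G ((comul (R := ℂ)).lTensor H (TensorProduct.map B.val.toLinearMap B.val.toLinearMap w)) -
      G' ((comul (R := ℂ)).lTensor H (TensorProduct.map B.val.toLinearMap B.val.toLinearMap w)) ∈
        balancedRel act P := by
    induction w with
    | zero => simp
    | tmul u v =>
      obtain ⟨d, hd⟩ := hΔ v v.2
      have := hG u d
      rw [hd] at this
      simpa using this
    | add a b ha hb =>
      simp only [map_add, add_sub_add_comm]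
      exact add_mem ha hb
  have hmem (w : ↥B ⊗[ℂ] ↥B) : TensorProduct.map (comul (R := ℂ)) (antipode ℂ)
      (TensorProduct.map B.val.toLinearMap B.val.toLinearMap w) ∈ balancedRel act P := by
    induction w with
    | zero => simp
    | tmul u v => simpa using tmul_mem_balancedRel act (hcomul u u.2) (antipode ℂ (v : H))
    | add a b ha hb =>
      simp only [map_add]
      exact add_mem ha hb
  obtain ⟨w, hw⟩ := hΔ x hx
  have h₁ := hG' w
  have h₂ := hmem w
  rw [hw] at h₁ h₂
  have e₁ : G ((comul (R := ℂ)).lTensor H (comul x)) =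
      TensorProduct.map (comul (R := ℂ)) (antipode ℂ) (comul (R := ℂ) x) := by
    simp only [G, LinearMap.comp_apply, LinearEquiv.coe_coe, coassoc_symm_apply]
    rw [← LinearMap.comp_apply, LinearMap.lTensor_comp_rTensor]
  have e₂ : G' ((comul (R := ℂ)).lTensor H (comul x)) = (x ⊗ₜ 1) ⊗ₜ 1 := by
    have : G' ∘ₗ (comul (R := ℂ)).lTensor H =
        TensorProduct.map (Algebra.TensorProduct.includeLeft (R := ℂ) (S := ℂ) (B := H)).toLinearMap
          (Algebra.linearMap ℂ H) ∘ₗ (counit (R := ℂ)).lTensor H := by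
      ext u v
      simp [G', mul_antipode_lTensor_comul_apply]
    rw [← LinearMap.comp_apply, this, LinearMap.comp_apply, lTensor_counit_comul]
    simp
  rw [e₁, e₂] at h₁
  simpa using sub_mem h₂ h₁

end Antipode

section BplusA

open Coalgebra HopfAlgebra

variable {H : Type*} [Ring H] [HopfAlgebra ℂ H] {B : Subalgebra ℂ H}

theorem mul_mem_BplusA_of_counit {b : H} (hb : b ∈ B) (h : counit (R := ℂ) b = 0) (a : H) :
    b * a ∈ BplusA B :=
  Submodule.subset_span ⟨b, a, hb, h, rfl⟩

theorem mul_sub_counit_smul_mem_BplusA {b : H} (hb : b ∈ B) (a : H) :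
    b * a - counit (R := ℂ) b • a ∈ BplusA B := by
  have := mul_mem_BplusA_of_counit (B := B)
    (sub_mem hb (B.algebraMap_mem (counit (R := ℂ) b))) (by simp) a
  rwa [sub_mul, ← Algebra.smul_def] at this

theorem BplusA_le {U : Submodule ℂ H}
    (h : ∀ b ∈ B, counit (R := ℂ) b = 0 → ∀ a, b * a ∈ U) : BplusA B ≤ U :=
  Submodule.span_le.2 fun _ ⟨b, a, hb, h0, e⟩ => e ▸ h b hb h0 a

theorem mul_mem_BplusA {x : H} (hx : x ∈ BplusA B) (a : H) : x * a ∈ BplusA B := by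
  refine BplusA_le (U := (BplusA B).comap (LinearMap.mulRight ℂ a)) (fun b hb h0 c => ?_) hx
  simpa [mul_assoc] using mul_mem_BplusA_of_counit hb h0 (c * a)

theorem counit_eq_zero_of_mem_BplusA {x : H} (hx : x ∈ BplusA B) : counit (R := ℂ) x = 0 :=
  BplusA_le (U := LinearMap.ker (counit (R := ℂ) (A := H))) (fun b hb h0 c => by simp [h0]) hx

variable (B) in
/-- The operator induced on `H ⧸ B⁺H` by right multiplication. -/
noncomputable def quotMulRight (a : H) : H ⧸ BplusA B →ₗ[ℂ] H ⧸ BplusA B :=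
  (BplusA B).mapQ (BplusA B) (LinearMap.mulRight ℂ a) fun _ hx => mul_mem_BplusA hx a

@[simp]
theorem quotMulRight_mkQ (a x : H) :
    quotMulRight B a ((BplusA B).mkQ x) = (BplusA B).mkQ (x * a) := rfl

variable (B) in
/-- The projection `H ⊗ H → H ⧸ B⁺H ⊗ H ⧸ B⁺H`. -/
noncomputable def quotMap : H ⊗[ℂ] H →ₗ[ℂ] (H ⧸ BplusA B) ⊗[ℂ] (H ⧸ BplusA B) :=
  TensorProduct.map (BplusA B).mkQ (BplusA B).mkQ

theorem quotMap_mul_tmul (z : H ⊗[ℂ] H) (a c : H) :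
    quotMap B (z * a ⊗ₜ c) =
      TensorProduct.map (quotMulRight B a) (quotMulRight B c) (quotMap B z) := by
  induction z with
  | zero => simp
  | tmul x y => simp [quotMap, -Submodule.mkQ_apply]
  | add x y hx hy => simp only [add_mul, map_add, hx, hy]

theorem quotMap_mul_eq_zero {z : H ⊗[ℂ] H} (hz : quotMap B z = 0) (w : H ⊗[ℂ] H) :
    quotMap B (z * w) = 0 := by
  induction w with
  | zero => simp
  | tmul x y => rw [quotMap_mul_tmul, hz, map_zero]
  | add x y hx hy => simp only [mul_add, map_add, hx, hy, add_zero]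

theorem quotMap_map_val_mul (d : ↥B ⊗[ℂ] ↥B) (w : H ⊗[ℂ] H) :
    quotMap B (TensorProduct.map B.val.toLinearMap B.val.toLinearMap d * w) =
      counit (R := ℂ) (TensorProduct.rid ℂ H ((counit (R := ℂ)).lTensor H
        (TensorProduct.map B.val.toLinearMap B.val.toLinearMap d))) • quotMap B w := by
  induction d with
  | zero => simp
  | add x y hx hy => simp only [add_mul, map_add, hx, hy, add_smul]
  | tmul u v =>
    induction w with
    | zero => simp
    | add x y hx hy => simp only [mul_add, map_add, hx, hy, smul_add]
    | tmul x y =>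
      have h (b : ↥B) (a : H) :
          (BplusA B).mkQ (b * a) = counit (R := ℂ) (b : H) • (BplusA B).mkQ a := by
        rw [← map_smul, ← sub_eq_zero, ← map_sub]
        exact (Submodule.Quotient.mk_eq_zero _).2 (mul_sub_counit_smul_mem_BplusA b.2 a)
      simp [quotMap, -Submodule.mkQ_apply, h, TensorProduct.smul_tmul', TensorProduct.tmul_smul,
        smul_smul]

theorem quotMap_comul_eq_zero (hΔ : ComulStable B) {x : H} (hx : x ∈ BplusA B) :
    quotMap B (comul x) = 0 := by
  refine BplusA_le (U := LinearMap.ker (quotMap B ∘ₗ comul)) (fun b hb h0 a => ?_) hx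
  obtain ⟨d, hd⟩ := hΔ b hb
  rw [LinearMap.mem_ker, LinearMap.comp_apply, Bialgebra.comul_mul, ← hd, quotMap_map_val_mul, hd,
    lTensor_counit_comul]
  simp [h0]

end BplusA

section Integral

open Coalgebra HopfAlgebra

variable {H : Type*} [Ring H] [HopfAlgebra ℂ H] {B : Subalgebra ℂ H}

theorem mul'_map_comul_includeRight_antipode_comul (a : H) :
    LinearMap.mul' ℂ (H ⊗[ℂ] H) (TensorProduct.map (comul (R := ℂ))
      ((Algebra.TensorProduct.includeRight (R := ℂ) (A := H)).toLinearMap ∘ₗ antipode ℂ)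
      (comul (R := ℂ) a)) = a ⊗ₜ 1 := by
  have h₁ : LinearMap.mul' ℂ (H ⊗[ℂ] H) ∘ₗ TensorProduct.map LinearMap.id
      ((Algebra.TensorProduct.includeRight (R := ℂ) (A := H)).toLinearMap ∘ₗ antipode ℂ) =
      (LinearMap.mul' ℂ H ∘ₗ (antipode ℂ).lTensor H).lTensor H ∘ₗ
        (TensorProduct.assoc ℂ H H H).toLinearMap := by
    ext x y w
    simp
  have h₂ : LinearMap.mul' ℂ (H ⊗[ℂ] H) ∘ₗ TensorProduct.map (comul (R := ℂ))
      ((Algebra.TensorProduct.includeRight (R := ℂ) (A := H)).toLinearMap ∘ₗ antipode ℂ) =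
      (LinearMap.mul' ℂ H ∘ₗ (antipode ℂ).lTensor H).lTensor H ∘ₗ
        (TensorProduct.assoc ℂ H H H).toLinearMap ∘ₗ (comul (R := ℂ)).rTensor H := by
    rw [← LinearMap.comp_assoc, ← h₁, LinearMap.comp_assoc, LinearMap.rTensor,
      ← TensorProduct.map_comp, LinearMap.id_comp, LinearMap.comp_id]
  have h₃ : (LinearMap.mul' ℂ H ∘ₗ (antipode ℂ).lTensor H).lTensor H ∘ₗ
      (comul (R := ℂ)).lTensor H = (Algebra.linearMap ℂ H).lTensor H ∘ₗ
        (counit (R := ℂ)).lTensor H := by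
    ext x y
    simp [mul_antipode_lTensor_comul_apply]
  rw [← LinearMap.comp_apply, h₂, LinearMap.comp_apply, LinearMap.comp_apply,
    LinearEquiv.coe_coe, coassoc_apply, ← LinearMap.comp_apply, h₃, LinearMap.comp_apply,
    lTensor_counit_comul]
  simp

theorem IsRightRelIntegral.quotMap_comul_mul_comul (hΔ : ComulStable B) {t : H}
    (ht : IsRightRelIntegral B t) (a : H) :
    quotMap B (comul t * comul a) = counit (R := ℂ) a • quotMap B (comul t) := by
  have := quotMap_comul_eq_zero hΔ (ht a)
  rwa [map_sub, map_sub, Bialgebra.comul_mul, map_smul, map_smul, sub_eq_zero] at this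

theorem IsRightRelIntegral.quotMap_comul_mul_tmul_one (hΔ : ComulStable B) {t : H}
    (ht : IsRightRelIntegral B t) (a : H) :
    quotMap B (comul t * a ⊗ₜ 1) = quotMap B (comul t * 1 ⊗ₜ antipode ℂ a) := by
  have h : quotMap B ∘ₗ LinearMap.mulLeft ℂ (comul t) ∘ₗ LinearMap.mul' ℂ (H ⊗[ℂ] H) ∘ₗ
      TensorProduct.map (comul (R := ℂ))
        ((Algebra.TensorProduct.includeRight (R := ℂ) (A := H)).toLinearMap ∘ₗ antipode ℂ) =
      quotMap B ∘ₗ LinearMap.mulLeft ℂ (comul t) ∘ₗ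
        (Algebra.TensorProduct.includeRight (R := ℂ) (A := H)).toLinearMap ∘ₗ antipode ℂ ∘ₗ
        (TensorProduct.lid ℂ H).toLinearMap ∘ₗ (counit (R := ℂ)).rTensor H := by
    refine TensorProduct.ext' fun u v => ?_
    have h0 : quotMap B (comul t * comul u - counit (R := ℂ) u • comul t) = 0 := by
      rw [map_sub, map_smul, ht.quotMap_comul_mul_comul hΔ, sub_self]
    have := quotMap_mul_eq_zero h0 (1 ⊗ₜ antipode ℂ v)
    rw [sub_mul, map_sub, sub_eq_zero, mul_assoc] at this
    simpa using this
  have := LinearMap.congr_fun h (comul a)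
  simp only [LinearMap.comp_apply, mul'_map_comul_includeRight_antipode_comul,
    rTensor_counit_comul] at this
  simpa using this

/-- The map `c ⊗ a ↦ c S(a₁) ⊗ a₂`. -/
noncomputable def antipodeShear : H ⊗[ℂ] H →ₗ[ℂ] H ⊗[ℂ] H :=
  (LinearMap.mul' ℂ H ∘ₗ (antipode ℂ).lTensor H).rTensor H ∘ₗ
    (TensorProduct.assoc ℂ H H H).symm.toLinearMap ∘ₗ (comul (R := ℂ)).lTensor H

theorem antipodeShear_comul (a : H) : antipodeShear (comul (R := ℂ) a) = 1 ⊗ₜ a := by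
  have h : (LinearMap.mul' ℂ H ∘ₗ (antipode ℂ).lTensor H).rTensor H ∘ₗ
      (comul (R := ℂ)).rTensor H = (Algebra.linearMap ℂ H).rTensor H ∘ₗ
        (counit (R := ℂ)).rTensor H := by
    ext x y
    simp [mul_antipode_lTensor_comul_apply]
  rw [antipodeShear, LinearMap.comp_apply, LinearMap.comp_apply, LinearEquiv.coe_coe,
    coassoc_symm_apply, ← LinearMap.comp_apply, h, LinearMap.comp_apply, rTensor_counit_comul]
  simp

theorem antipodeShear_tmul (c a : H) :
    antipodeShear (c ⊗ₜ a) =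
      TensorProduct.map (LinearMap.mulLeft ℂ c ∘ₗ antipode ℂ) LinearMap.id (comul (R := ℂ) a) := by
  have (d : H ⊗[ℂ] H) : (LinearMap.mul' ℂ H ∘ₗ (antipode ℂ).lTensor H).rTensor H
      ((TensorProduct.assoc ℂ H H H).symm (c ⊗ₜ d)) =
      TensorProduct.map (LinearMap.mulLeft ℂ c ∘ₗ antipode ℂ) LinearMap.id d := by
    induction d with
    | zero => simp
    | tmul x y => simp
    | add x y hx hy => simp only [TensorProduct.tmul_add, map_add, hx, hy]
  simp [antipodeShear, this]

theorem map_mulLeft_antipode_val_mul_sub_mem (c : H) (d : ↥B ⊗[ℂ] ↥B) (e : H ⊗[ℂ] H) :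
    TensorProduct.map (LinearMap.mulLeft ℂ c ∘ₗ antipode ℂ) LinearMap.id
      (TensorProduct.map B.val.toLinearMap B.val.toLinearMap d * e) -
    TensorProduct.map (LinearMap.mulRight ℂ (LinearMap.mul' ℂ H ((antipode ℂ).rTensor H
      (TensorProduct.map B.val.toLinearMap B.val.toLinearMap d))) ∘ₗ
        LinearMap.mulLeft ℂ c ∘ₗ antipode ℂ) LinearMap.id e ∈ balancedRel (rightMul B) ⊥ := by
  induction e with
  | zero => simp
  | add x y hx hy =>
    simp only [mul_add, map_add, add_sub_add_comm]
    exact add_mem hx hy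
  | tmul x y =>
    induction d with
    | zero => simp
    | add u v hu hv =>
      simp only [TensorProduct.map_tmul, LinearMap.comp_apply, LinearMap.mulRight_apply, add_mul,
        map_add, mul_add, TensorProduct.add_tmul, add_sub_add_comm] at hu hv ⊢
      exact add_mem hu hv
    | tmul u v =>
      rw [← neg_mem_iff, neg_sub]
      simpa [antipode_mul_antidistrib, mul_assoc] using
        act_tmul_sub_mem (rightMul B) ⊥ (c * (antipode ℂ x * antipode ℂ (u : H))) v y

theorem antipodeShear_tmul_mem (hΔ : ComulStable B) (c : H) {x : H} (hx : x ∈ BplusA B) :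
    antipodeShear (c ⊗ₜ x) ∈ balancedRel (rightMul B) ⊥ := by
  refine BplusA_le (U := (balancedRel (rightMul B) ⊥).comap
    (antipodeShear ∘ₗ TensorProduct.mk ℂ H H c)) (fun b hb h0 a => ?_) hx
  obtain ⟨d, hd⟩ := hΔ b hb
  have := map_mulLeft_antipode_val_mul_sub_mem c d (comul (R := ℂ) a)
  rw [hd, mul_antipode_rTensor_comul_apply, h0] at this
  simpa [antipodeShear_tmul] using this

end Integral

section FiniteDimensional

open Coalgebra HopfAlgebra

variable {H : Type*} [Ring H] [HopfAlgebra ℂ H] {B : Subalgebra ℂ H}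

/-- Right multiplication restricted to a right ideal. -/
noncomputable def restrictMulRight (W : Submodule ℂ H) (hW : ∀ w ∈ W, ∀ a, w * a ∈ W) :
    H →ₗ[ℂ] ↥W →ₗ[ℂ] ↥W :=
  LinearMap.mk₂ ℂ (fun a w => ⟨w * a, hW w w.2 a⟩) (fun _ _ _ => Subtype.ext (mul_add _ _ _))
    (fun _ _ _ => Subtype.ext (mul_smul_comm _ _ _)) (fun _ _ _ => Subtype.ext (add_mul _ _ _))
    (fun _ _ _ => Subtype.ext (smul_mul_assoc _ _ _))

@[simp]
theorem coe_restrictMulRight (W : Submodule ℂ H) (hW : ∀ w ∈ W, ∀ a, w * a ∈ W) (a : H) (w : ↥W) :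
    (restrictMulRight W hW a w : H) = w * a := rfl

theorem mem_BplusA_of_comul_eq (hΔ : ComulStable B) (hflat : LeftFlat ↥B H) (W : Submodule ℂ H)
    (hW : ∀ w ∈ W, ∀ a, w * a ∈ W) (hJ : BplusA B ≤ W) (h1 : (1 : H) ∉ W) {t : H}
    {y : ↥W ⊗[ℂ] H} {y' : H ⊗[ℂ] ↥(BplusA B)}
    (ht : comul (R := ℂ) t = W.subtype.rTensor H y + (BplusA B).subtype.lTensor H y') :
    t ∈ BplusA B := by
  let mW : ↥W ⊗[ℂ] H →ₗ[ℂ] ↥W :=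
    TensorProduct.lift (restrictMulRight W hW ∘ₗ antipode ℂ).flip
  let sW : ↥W ⊗[ℂ] H →ₗ[ℂ] ↥W ⊗[ℂ] H := mW.rTensor H ∘ₗ
    (TensorProduct.assoc ℂ ↥W H H).symm.toLinearMap ∘ₗ (comul (R := ℂ)).lTensor ↥W
  let T : ↥W ⊗[ℂ] H →ₗ[ℂ] H := LinearMap.mul' ℂ H ∘ₗ W.subtype.rTensor H
  have hs : antipodeShear ∘ₗ W.subtype.rTensor H = W.subtype.rTensor H ∘ₗ sW := by
    refine TensorProduct.ext' fun w a => ?_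
    have (d : H ⊗[ℂ] H) :
        TensorProduct.map (LinearMap.mulLeft ℂ (w : H) ∘ₗ antipode ℂ) LinearMap.id d =
          W.subtype.rTensor H (mW.rTensor H ((TensorProduct.assoc ℂ ↥W H H).symm (w ⊗ₜ d))) := by
      induction d with
      | zero => simp
      | tmul x y => simp [mW]
      | add x y hx hy => simp only [TensorProduct.tmul_add, map_add, hx, hy]
    simp [sW, antipodeShear_tmul, this]
  have hT : T ∘ₗ sW = W.subtype ∘ₗ (TensorProduct.rid ℂ ↥W).toLinearMap ∘ₗ
      (counit (R := ℂ)).lTensor ↥W := by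
    refine TensorProduct.ext' fun w a => ?_
    have (d : H ⊗[ℂ] H) :
        T (mW.rTensor H ((TensorProduct.assoc ℂ ↥W H H).symm (w ⊗ₜ d))) =
          w * LinearMap.mul' ℂ H ((antipode ℂ).rTensor H d) := by
      induction d with
      | zero => simp
      | tmul x y => simp [mW, T, mul_assoc]
      | add x y hx hy => simp only [TensorProduct.tmul_add, map_add, mul_add, hx, hy]
    simp [sW, this, mul_antipode_rTensor_comul_apply, ← Algebra.commutes, ← Algebra.smul_def]
  have hy' (y' : H ⊗[ℂ] ↥(BplusA B)) :
      antipodeShear ((BplusA B).subtype.lTensor H y') ∈ balancedRel (rightMul B) ⊥ := by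
    induction y' with
    | zero => simp
    | tmul c x => exact antipodeShear_tmul_mem hΔ c x.2
    | add x y hx hy => simpa only [map_add] using add_mem hx hy
  have hz : W.subtype.rTensor H (sW y) ∈
      balancedRel (rightMul B) (Subalgebra.toSubmodule B) := by
    rw [← LinearMap.comp_apply, ← hs, LinearMap.comp_apply, eq_sub_of_add_eq ht.symm, map_sub,
      antipodeShear_comul]
    exact sub_mem (tmul_mem_balancedRel _ B.one_mem t) (balancedRel_mono _ bot_le (hy' y'))
  have key := hflat.mem_balancedRel_comap (actM := restrictMulRight W hW ∘ₗ B.val.toLinearMap)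
    (fun b c n => by simp [mul_assoc]) (fun b p hp => B.mul_mem hp b.2) W.subtype
    (fun b m => by simp) hz
  have hle : balancedRel (restrictMulRight W hW ∘ₗ B.val.toLinearMap)
      ((Subalgebra.toSubmodule B).comap W.subtype) ≤ (BplusA B).comap T := by
    refine balancedRel_le (fun n b a => by simp [T, mul_assoc]) fun p hp a => ?_
    have hp0 : counit (R := ℂ) (p : H) = 0 := by
      by_contra h0
      refine h1 ?_
      have := W.sub_mem p.2 (hJ (mul_sub_counit_smul_mem_BplusA (b := (p : H)) hp 1))
      rwa [mul_one, sub_sub_cancel, W.smul_mem_iff h0] at this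
    simpa [T] using mul_mem_BplusA_of_counit (B := B) hp hp0 a
  have hTs : T (sW y) ∈ BplusA B := hle key
  have hε (y' : H ⊗[ℂ] ↥(BplusA B)) :
      (counit (R := ℂ)).lTensor H ((BplusA B).subtype.lTensor H y') = 0 := by
    induction y' with
    | zero => simp
    | tmul c x => simp [counit_eq_zero_of_mem_BplusA x.2]
    | add x y hx hy => simp only [map_add, hx, hy, add_zero]
  have htT : t = T (sW y) := by
    have h := congrArg (fun z => TensorProduct.rid ℂ H ((counit (R := ℂ)).lTensor H z)) ht
    have h' : (TensorProduct.rid ℂ H).toLinearMap ∘ₗ (counit (R := ℂ)).lTensor H ∘ₗ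
        W.subtype.rTensor H = T ∘ₗ sW := by
      rw [hT]
      ext
      simp
    simp only [lTensor_counit_comul, map_add, hε, add_zero] at h
    simpa using h.trans (LinearMap.congr_fun h' y)
  exact htT ▸ hTs

/-- A Hopf algebra with a non-trivial right relative integral has a finite-dimensional quotient. -/
theorem IsRightRelIntegral.finiteDimensional_quotient (hΔ : ComulStable B)
    (hflat : LeftFlat ↥B H) {t : H} (ht : IsRightRelIntegral B t) (htriv : t ∉ BplusA B) :
    FiniteDimensional ℂ (H ⧸ BplusA B) := by
  classical
  let π := (BplusA B).mkQ
  let ℬ := Module.Basis.ofVectorSpace ℂ (H ⧸ BplusA B)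
  obtain ⟨c, hc⟩ := TensorProduct.eq_repr_basis_right ℬ (π.lTensor H (comul (R := ℂ) t))
  let V : Submodule ℂ (H ⧸ BplusA B) := Submodule.span ℂ (c.support.image fun i => π (c i))
  let W : Submodule ℂ H := V.comap π
  have hcV (i) : π (c i) ∈ V := by
    by_cases hi : i ∈ c.support
    · exact Submodule.subset_span (Finset.mem_coe.2 (Finset.mem_image_of_mem _ hi))
    · simp [Finsupp.notMem_support_iff.1 hi]
  have hQ (a b : H) : quotMap B (comul t * a ⊗ₜ b) =
      ∑ i ∈ c.support, π (c i * a) ⊗ₜ quotMulRight B b (ℬ i) := by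
    have : quotMap B (comul t) = π.rTensor (H ⧸ BplusA B) (c.sum fun i m => m ⊗ₜ ℬ i) := by
      rw [hc, ← LinearMap.comp_apply (LinearMap.rTensor _ _), LinearMap.rTensor_comp_lTensor]
      rfl
    rw [quotMap_mul_tmul, this, Finsupp.sum, map_sum, map_sum]
    rfl
  have hca (a : H) (i) : π (c i * a) ∈ V := by
    have h := congrArg (fun z => TensorProduct.rid ℂ _ ((ℬ.coord i).lTensor (H ⧸ BplusA B) z))
      (ht.quotMap_comul_mul_tmul_one hΔ a)
    simp only [hQ, map_sum, LinearMap.lTensor_tmul, TensorProduct.rid_tmul, mul_one] at h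
    have h1 : quotMulRight B 1 = LinearMap.id := by
      refine Submodule.linearMap_qext _ (LinearMap.ext fun x => ?_)
      simp [-Submodule.mkQ_apply]
    have h2 : ∑ j ∈ c.support, ℬ.coord i (quotMulRight B 1 (ℬ j)) • π (c j * a) = π (c i * a) := by
      rw [Finset.sum_eq_single i]
      · simp [h1]
      · intro j _ hj
        simp [h1, hj]
      · intro hi
        simp [Finsupp.notMem_support_iff.1 hi]
    rw [← h2, h]
    exact sum_mem fun j _ => V.smul_mem _ (hcV j)
  have hW : ∀ w ∈ W, ∀ a, w * a ∈ W := fun w hw a => by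
    have : V ≤ V.comap (quotMulRight B a) := Submodule.span_le.2 fun x hx => by
      obtain ⟨i, -, rfl⟩ := Finset.mem_image.1 (Finset.mem_coe.1 hx)
      exact hca a i
    exact this hw
  have hJ : BplusA B ≤ W := fun x hx => by
    have : π x = 0 := (Submodule.Quotient.mk_eq_zero _).2 hx
    simp [W, this, -Submodule.mkQ_apply]
  have h1 : (1 : H) ∈ W := by
    by_contra h1
    refine htriv ?_
    choose a ha using fun i => (BplusA B).mkQ_surjective (ℬ i)
    let y : ↥W ⊗[ℂ] H := ∑ i ∈ c.support, (⟨c i, hcV i⟩ : ↥W) ⊗ₜ a i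
    have hy : π.lTensor H (comul t - W.subtype.rTensor H y) = 0 := by
      rw [map_sub, sub_eq_zero, ← hc, Finsupp.sum]
      simp [y, π, ha, -Submodule.mkQ_apply]
    have hexact := lTensor_exact H (f := (BplusA B).subtype) (g := π)
      (LinearMap.exact_subtype_mkQ _) (Submodule.mkQ_surjective _)
    obtain ⟨y', hy'⟩ := (hexact _).1 hy
    exact mem_BplusA_of_comul_eq hΔ hflat W hW hJ h1 (y := y) (y' := y')
      (by rw [hy', add_sub_cancel])
  have hV : V = ⊤ := eq_top_iff.2 fun x _ => by
    obtain ⟨a, rfl⟩ := (BplusA B).mkQ_surjective x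
    rw [← one_mul a]
    exact hW 1 h1 a
  exact Module.finite_def.2 ⟨_, hV⟩

end FiniteDimensional

section Coopposite

open Coalgebra HopfAlgebra

variable {A : Type*} [Ring A] [HopfAlgebra ℂ A]

variable (A) in
/-- The co-opposite coalgebra. -/
@[reducible]
noncomputable def coopCoalgebra : Coalgebra ℂ A where
  comul := (TensorProduct.comm ℂ A A).toLinearMap ∘ₗ comul
  counit := counit
  coassoc := by
    let τ : A ⊗[ℂ] (A ⊗[ℂ] A) →ₗ[ℂ] A ⊗[ℂ] (A ⊗[ℂ] A) :=
      (TensorProduct.assoc ℂ A A A).toLinearMap ∘ₗ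
        (TensorProduct.comm ℂ A (A ⊗[ℂ] A)).toLinearMap ∘ₗ
        (TensorProduct.comm ℂ A A).toLinearMap.lTensor A
    have h₁ : (TensorProduct.assoc ℂ A A A).toLinearMap ∘ₗ
        ((TensorProduct.comm ℂ A A).toLinearMap ∘ₗ comul).rTensor A ∘ₗ
          (TensorProduct.comm ℂ A A).toLinearMap = τ ∘ₗ (comul (R := ℂ)).lTensor A := by
      ext
      simp [τ]
    have h₂ : ((TensorProduct.comm ℂ A A).toLinearMap ∘ₗ comul).lTensor A ∘ₗ
          (TensorProduct.comm ℂ A A).toLinearMap = τ ∘ₗ (TensorProduct.assoc ℂ A A A).toLinearMap ∘ₗ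
            (comul (R := ℂ)).rTensor A := by
      refine TensorProduct.ext' fun u v => ?_
      have (d : A ⊗[ℂ] A) : v ⊗ₜ (TensorProduct.comm ℂ A A) d =
          τ (TensorProduct.assoc ℂ A A A (d ⊗ₜ v)) := by
        induction d with
        | zero => simp
        | tmul x y => simp [τ]
        | add x y hx hy =>
          simp only [TensorProduct.add_tmul, TensorProduct.tmul_add, map_add, hx, hy]
      simpa using this _
    refine LinearMap.ext fun a => ?_
    have e₁ := LinearMap.congr_fun h₁ (comul (R := ℂ) a)
    have e₂ := LinearMap.congr_fun h₂ (comul (R := ℂ) a)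
    simp only [LinearMap.comp_apply, LinearEquiv.coe_coe, coassoc_apply] at e₁ e₂ ⊢
    exact e₁.trans e₂.symm
  rTensor_counit_comp_comul := by
    have : (counit (R := ℂ)).rTensor A ∘ₗ (TensorProduct.comm ℂ A A).toLinearMap =
        (TensorProduct.comm ℂ A ℂ).toLinearMap ∘ₗ (counit (R := ℂ)).lTensor A := by
      ext; simp
    rw [← LinearMap.comp_assoc, this, LinearMap.comp_assoc, lTensor_counit_comp_comul]
    ext; simp
  lTensor_counit_comp_comul := by
    have : (counit (R := ℂ)).lTensor A ∘ₗ (TensorProduct.comm ℂ A A).toLinearMap =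
        (TensorProduct.comm ℂ ℂ A).toLinearMap ∘ₗ (counit (R := ℂ)).rTensor A := by
      ext; simp
    rw [← LinearMap.comp_assoc, this, LinearMap.comp_assoc, rTensor_counit_comp_comul]
    ext; simp

variable (A) in
/-- The co-opposite bialgebra. -/
@[reducible]
noncomputable def coopBialgebra : Bialgebra ℂ A :=
  Bialgebra.mk' ℂ A (C := coopCoalgebra A) (Bialgebra.counit_one (R := ℂ) (A := A))
    (fun {a b} => Bialgebra.counit_mul a b)
    (by
      change TensorProduct.comm ℂ A A (comul (R := ℂ) 1) = 1
      rw [Bialgebra.comul_one]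
      rfl)
    (fun {a b} => by
      change TensorProduct.comm ℂ A A (comul (R := ℂ) (a * b)) =
        TensorProduct.comm ℂ A A (comul (R := ℂ) a) * TensorProduct.comm ℂ A A (comul (R := ℂ) b)
      rw [Bialgebra.comul_mul]
      exact map_mul (Algebra.TensorProduct.comm ℂ A A) _ _)

variable (hS : Function.Bijective (antipode ℂ (A := A)))

/-- The antipode as a linear equivalence. -/
noncomputable def antipodeEquiv (hS : Function.Bijective (antipode ℂ (A := A))) : A ≃ₗ[ℂ] A :=
  LinearEquiv.ofBijective (antipode ℂ) hS

@[simp]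
theorem antipodeEquiv_apply (a : A) : antipodeEquiv hS a = antipode ℂ a := rfl

theorem antipode_antipodeEquiv_symm (a : A) : antipode ℂ ((antipodeEquiv hS).symm a) = a :=
  (antipodeEquiv hS).apply_symm_apply a

theorem antipode_mul'_antipodeEquiv_symm_rTensor_comm (d : A ⊗[ℂ] A) :
    antipode ℂ (LinearMap.mul' ℂ A ((antipodeEquiv hS).symm.toLinearMap.rTensor A
      (TensorProduct.comm ℂ A A d))) = LinearMap.mul' ℂ A ((antipode ℂ).rTensor A d) := by
  induction d with
  | zero => simp
  | tmul x y => simp [antipode_mul_antidistrib, antipode_antipodeEquiv_symm]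
  | add x y hx hy => simp only [map_add, hx, hy]

theorem antipode_mul'_antipodeEquiv_symm_lTensor_comm (d : A ⊗[ℂ] A) :
    antipode ℂ (LinearMap.mul' ℂ A ((antipodeEquiv hS).symm.toLinearMap.lTensor A
      (TensorProduct.comm ℂ A A d))) = LinearMap.mul' ℂ A ((antipode ℂ).lTensor A d) := by
  induction d with
  | zero => simp
  | tmul x y => simp [antipode_mul_antidistrib, antipode_antipodeEquiv_symm]
  | add x y hx hy => simp only [map_add, hx, hy]

theorem antipode_algebraMap (c : ℂ) : antipode ℂ (algebraMap ℂ A c) = algebraMap ℂ A c := by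
  rw [Algebra.algebraMap_eq_smul_one, map_smul, antipode_one]

/-- The co-opposite Hopf algebra of a Hopf algebra with bijective antipode. -/
@[reducible]
noncomputable def coopHopfAlgebra (hS : Function.Bijective (antipode ℂ (A := A))) :
    HopfAlgebra ℂ A :=
  { coopBialgebra A with
    antipode := (antipodeEquiv hS).symm.toLinearMap
    mul_antipode_rTensor_comul := LinearMap.ext fun a => hS.1 <|
      (antipode_mul'_antipodeEquiv_symm_rTensor_comm hS (comul a)).trans <|
        (mul_antipode_rTensor_comul_apply a).trans (antipode_algebraMap _).symm
    mul_antipode_lTensor_comul := LinearMap.ext fun a => hS.1 <|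
      (antipode_mul'_antipodeEquiv_symm_lTensor_comm hS (comul a)).trans <|
        (mul_antipode_lTensor_comul_apply a).trans (antipode_algebraMap _).symm }

theorem comulStable_coop (hS : Function.Bijective (antipode ℂ (A := A)))
    {B : Subalgebra ℂ A} (hΔ : ComulStable B) :
    @ComulStable A _ (coopHopfAlgebra hS) B := fun b hb => by
  obtain ⟨d, hd⟩ := hΔ b hb
  refine ⟨TensorProduct.comm ℂ _ _ d, ?_⟩
  change _ = TensorProduct.comm ℂ A A (comul (R := ℂ) b)
  rw [← hd]
  exact TensorProduct.map_comm _ _ d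

theorem antipodeEquiv_symm_mem {B : Subalgebra ℂ A} (hΔ : ComulStable B)
    (h : LeftFaithfullyFlat ↥B A) {b : A} (hb : b ∈ B) : (antipodeEquiv hS).symm b ∈ B :=
  @antipode_mem_of_leftFaithfullyFlat A _ (coopHopfAlgebra hS) B (comulStable_coop hS hΔ) h b hb

theorem finiteDimensional_quotient_BplusA (hS : Function.Bijective (antipode ℂ (A := A)))
    {B : Subalgebra ℂ A} (hΔ : ComulStable B)
    (hflat : LeftFlat ↥B A) {t : A} (ht : IsRightRelIntegral B t) (htriv : t ∉ BplusA B) :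
    FiniteDimensional ℂ (A ⧸ BplusA B) :=
  @IsRightRelIntegral.finiteDimensional_quotient A _ (coopHopfAlgebra hS) B
    (comulStable_coop hS hΔ) hflat t ht htriv

end Coopposite

section Projective

variable {A : Type*} [Ring A] [Algebra ℂ A] {B : Subalgebra ℂ A}
variable {N : Type*} [AddCommGroup N] [Module ℂ N]

theorem exists_finset_of_mem_balancedRel {act : ↥B →ₗ[ℂ] N →ₗ[ℂ] N} {P : Submodule ℂ N}
    {z : N ⊗[ℂ] A} (hz : z ∈ balancedRel act P) :
    ∃ s : Finset N, (↑s : Set N) ⊆ P ∧ ∀ Q : Submodule ℂ N, ↑s ⊆ (Q : Set N) →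
      z ∈ balancedRel act Q := by
  classical
  obtain ⟨u, hu, v, hv, rfl⟩ := Submodule.mem_sup.1 hz
  suffices ∃ s : Finset N, (↑s : Set N) ⊆ P ∧ ∀ Q : Submodule ℂ N, ↑s ⊆ (Q : Set N) →
      v ∈ balancedRel act Q by
    obtain ⟨s, hs, h⟩ := this
    exact ⟨s, hs, fun Q hQ => add_mem (Submodule.mem_sup_left hu) (h Q hQ)⟩
  clear hz
  induction hv using Submodule.span_induction with
  | mem x hx =>
    obtain ⟨p, hp, a, rfl⟩ := hx
    exact ⟨{p}, by simpa using hp, fun Q hQ => tmul_mem_balancedRel act (by simpa using hQ) a⟩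
  | zero => exact ⟨∅, by simp, fun _ _ => zero_mem _⟩
  | add x y hx hy ihx ihy =>
    obtain ⟨s, hs, h⟩ := ihx
    obtain ⟨s', hs', h'⟩ := ihy
    refine ⟨s ∪ s', by simp [hs, hs'], fun Q hQ => ?_⟩
    rw [Finset.coe_union, Set.union_subset_iff] at hQ
    exact add_mem (h Q hQ.1) (h' Q hQ.2)
  | smul c x hx ih =>
    obtain ⟨s, hs, h⟩ := ih
    exact ⟨s, hs, fun Q hQ => Submodule.smul_mem _ c (h Q hQ)⟩

theorem mulRight_mem_balancedRel {act : ↥B →ₗ[ℂ] N →ₗ[ℂ] N} {P : Submodule ℂ N}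
    {z : N ⊗[ℂ] A} (hz : z ∈ balancedRel act P) (c : A) :
    (LinearMap.mulRight ℂ c).lTensor N z ∈ balancedRel act P := by
  refine balancedRel_le (U := (balancedRel act P).comap ((LinearMap.mulRight ℂ c).lTensor N))
    (fun n b a => ?_) (fun p hp a => ?_) hz
  · simpa [mul_assoc] using act_tmul_sub_mem act P n b (a * c)
  · simpa using tmul_mem_balancedRel act hp (a * c)

/-- If `z` is a finite family generating `A` as a right `B`-module after base change along the
faithfully flat `B → A`, with `B`-linear coefficients `q`, then `A` is finitely presented; being
flat it is then finitely generated projective. -/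
theorem FGProjRight.of_baseChange {ι : Type*} [Fintype ι] (h : LeftFaithfullyFlat ↥B A)
    (hR : ∀ (s : Finset (ι → ↥B)) (x : ι → A),
      (∀ k ∈ s, ∑ i, x i * (k i : A) = 0) → ∃ (m : ℕ) (c : ι → Fin m → ↥B) (y : Fin m → A),
        (∀ i, x i = ∑ j, y j * (c i j : A)) ∧ ∀ k ∈ s, ∀ j, ∑ i, c i j * k i = 0)
    (z : ι → A) (q : ι → A →ₗ[ℂ] A) (hq : ∀ p a, ∀ b ∈ B, q p (a * b) = q p a * b)
    (hz : ∀ a, a ⊗ₜ 1 - ∑ p, z p ⊗ₜ q p a ∈ balancedRel (rightMul B) ⊥) : FGProjRight B := by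
  classical
  let φ : (ι → ↥B) →ₗ[ℂ] A := ∑ p, LinearMap.mulLeft ℂ (z p) ∘ₗ B.val.toLinearMap ∘ₗ
    LinearMap.proj p
  have φ_apply (k) : φ k = ∑ p, z p * k p := by simp [φ]
  have φ_single (p) : φ (Pi.single p 1) = z p := by
    rw [φ_apply, Finset.sum_eq_single p (fun j _ hj => by simp [hj]) (by simp)]
    simp
  let act : ↥B →ₗ[ℂ] (ι → ↥B) →ₗ[ℂ] (ι → ↥B) := LinearMap.mk₂ ℂ (fun b k p => k p * b)
    (fun _ _ _ => funext fun _ => mul_add _ _ _) (fun _ _ _ => funext fun _ => mul_smul_comm _ _ _)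
    (fun _ _ _ => funext fun _ => add_mul _ _ _)
    (fun c b k => funext fun p => smul_mul_assoc c (k p) b)
  have act_apply (b k p) : act b k p = k p * b := rfl
  have act_mul (b c n) : act (b * c) n = act c (act b n) := by
    ext p
    simp [act_apply, mul_assoc]
  have φ_act (b k) : φ (act b k) = φ k * b := by
    simp [φ_apply, act_apply, Finset.sum_mul, mul_assoc]
  have hφ : LinearMap.range φ = ⊤ := by
    refine eq_top_iff.2 fun a _ => h.mem_of_tmul_one_mem (act := rightMul B) (by simp)
      (fun b c n => by simp [mul_assoc]) ?_ ?_
    · rintro b _ ⟨k, rfl⟩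
      exact ⟨act b k, φ_act b k⟩
    · rw [← sub_add_cancel (a ⊗ₜ 1) (∑ p, z p ⊗ₜ q p a)]
      refine add_mem (balancedRel_mono _ bot_le (hz a)) (sum_mem fun p _ =>
        tmul_mem_balancedRel _ (P := LinearMap.range φ) ⟨Pi.single p 1, φ_single p⟩ _)
  let Z (r : ι) : (ι → ↥B) ⊗[ℂ] A :=
    Pi.single r 1 ⊗ₜ 1 - ∑ p, Pi.single p 1 ⊗ₜ q p (z r)
  have hZ (r) : Z r ∈ balancedRel act (LinearMap.ker φ) :=
    h.1.mem_balancedRel_comap (act := rightMul B) (P := ⊥) (fun b c n => by simp [mul_assoc])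
      (by simp) φ (fun b m => by simp [φ_act]) (by simpa [Z, φ_single] using hz (z r))
  choose s hs hsZ using fun r => exists_finset_of_mem_balancedRel (hZ r)
  let S : Finset (ι → ↥B) := Finset.univ.biUnion s
  have hSφ : ∀ k ∈ S, φ k = 0 := fun k hk => by
    obtain ⟨r, -, hr⟩ := Finset.mem_biUnion.1 hk
    exact hs r hr
  let K : Submodule ℂ (ι → ↥B) := Submodule.span ℂ {x | ∃ k ∈ S, ∃ b, x = act b k}
  have hK : ∀ k, φ k = 0 → k ∈ K := fun k hk => by
    have hact : ∀ b, ∀ p ∈ K, act b p ∈ K := fun b p hp => by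
      refine (Submodule.span_le (p := K.comap (act b))).2 ?_ hp
      rintro _ ⟨k, hk, c, rfl⟩
      exact Submodule.subset_span ⟨k, hk, c * b, (act_mul _ _ _).symm⟩
    have hone (n) : act 1 n = n := by
      ext p
      simp [act_apply]
    refine h.mem_of_tmul_one_mem hone act_mul hact ?_
    have hZK (r) : Z r ∈ balancedRel act K := hsZ r K fun k hk =>
      Submodule.subset_span ⟨k, Finset.mem_biUnion.2 ⟨r, Finset.mem_univ r, hk⟩, 1, (hone k).symm⟩
    have h₁ : ∑ r, (LinearMap.mulRight ℂ (k r : A)).lTensor (ι → ↥B) (Z r) ∈ balancedRel act K :=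
      sum_mem fun r _ => mulRight_mem_balancedRel (hZK r) _
    have h₂ : ∑ r, (LinearMap.mulRight ℂ (k r : A)).lTensor (ι → ↥B) (Z r) =
        ∑ r, Pi.single r 1 ⊗ₜ (k r : A) := by
      simp only [Z, map_sub, map_sum, LinearMap.lTensor_tmul, LinearMap.mulRight_apply, one_mul,
        Finset.sum_sub_distrib]
      rw [Finset.sum_comm, sub_eq_self]
      refine Finset.sum_eq_zero fun p _ => ?_
      simp_rw [← TensorProduct.tmul_sum, ← hq p _ _ (k _).2, ← map_sum, ← φ_apply, hk, map_zero,
        TensorProduct.tmul_zero]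
    have h₃ : k ⊗ₜ 1 - ∑ r, Pi.single r 1 ⊗ₜ (k r : A) ∈ balancedRel act K := by
      have : k = ∑ r, act (k r) (Pi.single r 1) := by
        ext p
        simp [act_apply, Pi.single_apply]
      nth_rewrite 1 [this]
      rw [TensorProduct.sum_tmul, ← Finset.sum_sub_distrib]
      exact sum_mem fun r _ => by simpa using act_tmul_sub_mem act K (Pi.single r 1) (k r) 1
    rw [h₂] at h₁
    simpa using add_mem h₃ h₁
  obtain ⟨m, c, y, hc, hcS⟩ := hR S z fun k hk => (φ_apply k).symm.trans (hSφ k hk)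
  let F (j : Fin m) : (ι → ↥B) →ₗ[ℂ] ↥B := ∑ p, LinearMap.mulLeft ℂ (c p j) ∘ₗ LinearMap.proj p
  have F_apply (j k) : F j k = ∑ p, c p j * k p := by simp [F]
  have F_act (j b k) : F j (act b k) = F j k * b := by
    simp [F_apply, act_apply, Finset.sum_mul, mul_assoc]
  have hF (j k) (hk : φ k = 0) : F j k = 0 := by
    refine (Submodule.span_le (p := LinearMap.ker (F j))).2 ?_ (hK k hk)
    rintro _ ⟨k, hk, b, rfl⟩
    simp [F_act, F_apply, hcS k hk]
  obtain ⟨σ, hσ⟩ := φ.exists_rightInverse_of_surjective hφ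
  have hσ (a) : φ (σ a) = a := LinearMap.congr_fun hσ a
  refine ⟨m, y, fun j => F j ∘ₗ σ, fun j a b => ?_, fun a => ?_⟩
  · have := hF j (σ (a * b) - act b (σ a)) (by simp [hσ, φ_act])
    rwa [map_sub, F_act, sub_eq_zero] at this
  · conv_lhs => rw [← hσ a, φ_apply]
    simp_rw [hc, Finset.sum_mul, LinearMap.comp_apply, F_apply]
    rw [Finset.sum_comm]
    simp [Finset.mul_sum, mul_assoc]

end Projective

section BaseChange

open Coalgebra HopfAlgebra

variable {A : Type*} [Ring A] [HopfAlgebra ℂ A] {B : Subalgebra ℂ A}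

/-- `AB⁺`: the linear span of the products `a·b` with `b ∈ B` and `ε(b) = 0`. -/
def ABplus (B : Subalgebra ℂ A) : Submodule ℂ A :=
  Submodule.span ℂ {x : A | ∃ b a : A, b ∈ B ∧ counit (R := ℂ) b = 0 ∧ x = a * b}

theorem ABplus_le {U : Submodule ℂ A}
    (h : ∀ b ∈ B, counit (R := ℂ) b = 0 → ∀ a, a * b ∈ U) : ABplus B ≤ U :=
  Submodule.span_le.2 fun _ ⟨b, a, hb, h0, e⟩ => e ▸ h b hb h0 a

theorem mul_mem_ABplus_of_counit {b : A} (hb : b ∈ B) (h : counit (R := ℂ) b = 0) (a : A) :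
    a * b ∈ ABplus B :=
  Submodule.subset_span ⟨b, a, hb, h, rfl⟩

theorem mul_sub_counit_smul_mem_ABplus {b : A} (hb : b ∈ B) (a : A) :
    a * b - counit (R := ℂ) b • a ∈ ABplus B := by
  have := mul_mem_ABplus_of_counit (B := B)
    (sub_mem hb (B.algebraMap_mem (counit (R := ℂ) b))) (by simp) a
  rwa [mul_sub, ← Algebra.commutes, ← Algebra.smul_def] at this

theorem finiteDimensional_quotient_ABplus (hS : Function.Surjective (antipode ℂ (A := A)))
    (hB : ∀ b ∈ B, antipode ℂ b ∈ B) [FiniteDimensional ℂ (A ⧸ BplusA B)] :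
    FiniteDimensional ℂ (A ⧸ ABplus B) := by
  have hle : BplusA B ≤ (ABplus B).comap (antipode ℂ) := BplusA_le fun b hb h0 a => by
    rw [Submodule.mem_comap, antipode_mul_antidistrib]
    exact mul_mem_ABplus_of_counit (hB b hb) (by simpa using h0) _
  refine Module.Finite.of_surjective ((BplusA B).mapQ (ABplus B) (antipode ℂ) hle) fun y => ?_
  obtain ⟨a, rfl⟩ := (ABplus B).mkQ_surjective y
  obtain ⟨a, rfl⟩ := hS a
  exact ⟨(BplusA B).mkQ a, rfl⟩

/-- The map `x ⊗ a ↦ x₁ ⊗ S(x₂) a`. -/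
noncomputable def comulShear : A ⊗[ℂ] A →ₗ[ℂ] A ⊗[ℂ] A :=
  (LinearMap.mul' ℂ A ∘ₗ (antipode ℂ).rTensor A).lTensor A ∘ₗ
    (TensorProduct.assoc ℂ A A A).toLinearMap ∘ₗ (comul (R := ℂ)).rTensor A

theorem comulShear_comul (a : A) : comulShear (comul (R := ℂ) a) = a ⊗ₜ 1 := by
  have h : (LinearMap.mul' ℂ A ∘ₗ (antipode ℂ).rTensor A).lTensor A ∘ₗ
      (comul (R := ℂ)).lTensor A = (Algebra.linearMap ℂ A).lTensor A ∘ₗ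
        (counit (R := ℂ)).lTensor A := by
    ext x y
    simp [mul_antipode_rTensor_comul_apply]
  rw [comulShear, LinearMap.comp_apply, LinearMap.comp_apply, LinearEquiv.coe_coe,
    coassoc_apply, ← LinearMap.comp_apply, h, LinearMap.comp_apply, lTensor_counit_comul]
  simp

theorem comulShear_tmul (x a : A) :
    comulShear (x ⊗ₜ a) =
      (LinearMap.mulRight ℂ a ∘ₗ antipode ℂ).lTensor A (comul (R := ℂ) x) := by
  have (d : A ⊗[ℂ] A) : (LinearMap.mul' ℂ A ∘ₗ (antipode ℂ).rTensor A).lTensor A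
      (TensorProduct.assoc ℂ A A A (d ⊗ₜ a)) =
      (LinearMap.mulRight ℂ a ∘ₗ antipode ℂ).lTensor A d := by
    induction d with
    | zero => simp
    | tmul x y => simp
    | add x y hx hy => simp only [TensorProduct.add_tmul, map_add, hx, hy]
  simp [comulShear, this]

theorem lTensor_mulRight_antipode_mul_val_sub_mem (c : A) (d : ↥B ⊗[ℂ] ↥B) (e : A ⊗[ℂ] A) :
    (LinearMap.mulRight ℂ c ∘ₗ antipode ℂ).lTensor A
      (e * TensorProduct.map B.val.toLinearMap B.val.toLinearMap d) -
    (LinearMap.mulLeft ℂ (LinearMap.mul' ℂ A ((antipode ℂ).lTensor A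
      (TensorProduct.map B.val.toLinearMap B.val.toLinearMap d))) ∘ₗ
        LinearMap.mulRight ℂ c ∘ₗ antipode ℂ).lTensor A e ∈ balancedRel (rightMul B) ⊥ := by
  induction e with
  | zero => simp
  | add x y hx hy =>
    simp only [add_mul, map_add, add_sub_add_comm]
    exact add_mem hx hy
  | tmul x y =>
    induction d with
    | zero => simp
    | add u v hu hv =>
      simp only [LinearMap.lTensor_tmul, LinearMap.comp_apply, LinearMap.mulLeft_apply, add_mul,
        map_add, mul_add, TensorProduct.tmul_add, add_sub_add_comm] at hu hv ⊢
      exact add_mem hu hv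
    | tmul u v =>
      simpa [antipode_mul_antidistrib, mul_assoc] using
        act_tmul_sub_mem (rightMul B) ⊥ x u (antipode ℂ (v : A) * (antipode ℂ y * c))

theorem comulShear_tmul_mem (hΔ : ComulStable B) {x : A} (hx : x ∈ ABplus B) (c : A) :
    comulShear (x ⊗ₜ c) ∈ balancedRel (rightMul B) ⊥ := by
  refine ABplus_le (U := (balancedRel (rightMul B) ⊥).comap
    (comulShear ∘ₗ (TensorProduct.mk ℂ A A).flip c)) (fun b hb h0 a => ?_) hx
  obtain ⟨d, hd⟩ := hΔ b hb
  have := lTensor_mulRight_antipode_mul_val_sub_mem c d (comul (R := ℂ) a)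
  rw [hd, mul_antipode_lTensor_comul_apply, h0] at this
  simpa [comulShear_tmul] using this

theorem lid_rTensor_comul_mul (hΔ : ComulStable B) {f : A →ₗ[ℂ] ℂ}
    (hf : ∀ x ∈ ABplus B, f x = 0) (a : A) {b : A} (hb : b ∈ B) :
    TensorProduct.lid ℂ A (f.rTensor A (comul (a * b))) =
      TensorProduct.lid ℂ A (f.rTensor A (comul a)) * b := by
  have hfb (x : A) (u : ↥B) : f (x * u) = counit (R := ℂ) (u : A) * f x := by
    have := hf _ (mul_sub_counit_smul_mem_ABplus u.2 x)
    rwa [map_sub, map_smul, sub_eq_zero] at this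
  have h (e : A ⊗[ℂ] A) (d : ↥B ⊗[ℂ] ↥B) : TensorProduct.lid ℂ A (f.rTensor A
      (e * TensorProduct.map B.val.toLinearMap B.val.toLinearMap d)) =
      TensorProduct.lid ℂ A (f.rTensor A e) * TensorProduct.lid ℂ A ((counit (R := ℂ)).rTensor A
        (TensorProduct.map B.val.toLinearMap B.val.toLinearMap d)) := by
    induction e with
    | zero => simp
    | add x y hx hy => simp only [add_mul, map_add, hx, hy]
    | tmul x y =>
      induction d with
      | zero => simp
      | add u v hu hv => simp only [mul_add, map_add, hu, hv]
      | tmul u v => simp [hfb, smul_smul, mul_comm]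
  obtain ⟨d, hd⟩ := hΔ b hb
  rw [Bialgebra.comul_mul, ← hd, h, hd, rTensor_counit_comul]
  simp

/-- The base change `A ⊗_B A` is finitely generated over `A` if `A ⧸ AB⁺` is finite-dimensional. -/
theorem exists_generators_baseChange (hΔ : ComulStable B) [FiniteDimensional ℂ (A ⧸ ABplus B)] :
    ∃ (m : ℕ) (s : Fin m → Finset (A × A)) (q : (Σ i, ↥(s i)) → A →ₗ[ℂ] A),
      (∀ p a, ∀ b ∈ B, q p (a * b) = q p a * b) ∧
      ∀ a : A, a ⊗ₜ 1 - ∑ p : Σ i, ↥(s i), (p.2 : A × A).1 ⊗ₜ q p a ∈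
        balancedRel (rightMul B) ⊥ := by
  let ℬ := Module.finBasis ℂ (A ⧸ ABplus B)
  choose x hx using fun i => (ABplus B).mkQ_surjective (ℬ i)
  let f (i) : A →ₗ[ℂ] ℂ := ℬ.coord i ∘ₗ (ABplus B).mkQ
  have hf (i) : ∀ x ∈ ABplus B, f i x = 0 := fun x hx => by
    have : (ABplus B).mkQ x = 0 := (Submodule.Quotient.mk_eq_zero _).2 hx
    simp [f, this, -Submodule.mkQ_apply]
  let g (i) : A →ₗ[ℂ] A := (TensorProduct.lid ℂ A).toLinearMap ∘ₗ (f i).rTensor A ∘ₗ comul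
  choose s hs using fun i =>
    TensorProduct.exists_finset ((antipode ℂ).lTensor A (comul (R := ℂ) (x i)))
  refine ⟨_, s, fun p => LinearMap.mulLeft ℂ (p.2 : A × A).2 ∘ₗ g p.1, fun p a b hb => ?_,
    fun a => ?_⟩
  · simp [-Bialgebra.comul_mul, g, lid_rTensor_comul_mul hΔ (hf p.1) a hb, mul_assoc]
  · have hr (y : A) : y - ∑ i, f i y • x i ∈ ABplus B := by
      rw [← Submodule.Quotient.mk_eq_zero, ← Submodule.mkQ_apply]
      simp only [map_sub, map_sum, map_smul, hx]
      exact sub_eq_zero.2 (ℬ.sum_repr _).symm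
    have hd (d : A ⊗[ℂ] A) : comulShear d - ∑ i, comulShear (x i ⊗ₜ TensorProduct.lid ℂ A
        ((f i).rTensor A d)) ∈ balancedRel (rightMul B) ⊥ := by
      induction d with
      | zero => simp
      | add u v hu hv =>
        simp only [map_add, TensorProduct.tmul_add, Finset.sum_add_distrib, add_sub_add_comm]
        exact add_mem hu hv
      | tmul u v =>
        simpa [TensorProduct.sub_tmul, TensorProduct.sum_tmul, TensorProduct.smul_tmul] using
          comulShear_tmul_mem hΔ (hr u) v
    have hsum : ∑ p : Σ i, ↥(s i), (p.2 : A × A).1 ⊗ₜ[ℂ] ((p.2 : A × A).2 * g p.1 a) =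
        ∑ i, comulShear (x i ⊗ₜ g i a) := by
      rw [Fintype.sum_sigma]
      refine Finset.sum_congr rfl fun i _ => ?_
      rw [comulShear_tmul, LinearMap.lTensor_comp_apply, hs i, map_sum,
        Finset.sum_coe_sort (s i) fun p => p.1 ⊗ₜ[ℂ] (p.2 * g i a)]
      rfl
    have := hd (comul a)
    change comulShear (comul a) - ∑ i, comulShear (x i ⊗ₜ g i a) ∈ _ at this
    rw [comulShear_comul, ← hsum] at this
    exact this

end BaseChange

section Antipode

open HopfAlgebra

variable {A : Type*} [Ring A] [HopfAlgebra ℂ A] {B : Subalgebra ℂ A}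

/-- The equational criterion for flatness of `A` as a right `B`-module. -/
theorem LeftFlat.exists_factorization_right (hS : Function.Bijective (antipode ℂ (A := A)))
    (hB : ∀ b ∈ B, antipode ℂ b ∈ B) (hB' : ∀ b ∈ B, (antipodeEquiv hS).symm b ∈ B)
    (h : LeftFlat ↥B A) {ι : Type*} [Fintype ι] (s : Finset (ι → ↥B)) (x : ι → A)
    (hx : ∀ k ∈ s, ∑ i, x i * (k i : A) = 0) :
    ∃ (m : ℕ) (c : ι → Fin m → ↥B) (y : Fin m → A),
      (∀ i, x i = ∑ j, y j * (c i j : A)) ∧ ∀ k ∈ s, ∀ j, ∑ i, c i j * k i = 0 := by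
  obtain ⟨m, c, y, hc, hk⟩ := h.exists_factorization
    (fun (k : ↥s) i => (⟨antipode ℂ (k.1 i : A), hB _ (k.1 i).2⟩ : ↥B))
    (fun i => antipode ℂ (x i)) fun k => by
      simpa [Subalgebra.smul_def, antipode_mul_antidistrib] using
        congrArg (antipode ℂ) (hx k.1 k.2)
  refine ⟨m, fun i j => ⟨(antipodeEquiv hS).symm (c i j), hB' _ (c i j).2⟩,
    fun j => (antipodeEquiv hS).symm (y j), fun i => hS.1 ?_, fun k hks j => ?_⟩
  · simp [hc, Subalgebra.smul_def, antipode_mul_antidistrib, antipode_antipodeEquiv_symm]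
  · refine Subtype.ext (hS.1 ?_)
    have := congrArg Subtype.val (hk ⟨k, hks⟩ j)
    simpa [antipode_mul_antidistrib, antipode_antipodeEquiv_symm] using this

theorem FGProjRight.fgProjLeft (hS : Function.Bijective (antipode ℂ (A := A)))
    (hB : ∀ b ∈ B, antipode ℂ b ∈ B) (hB' : ∀ b ∈ B, (antipodeEquiv hS).symm b ∈ B)
    (h : FGProjRight B) : FGProjLeft B := by
  obtain ⟨k, x, f, hf, hx⟩ := h
  let σ : ↥B →ₗ[ℂ] ↥B := LinearMap.codRestrict (Subalgebra.toSubmodule B)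
    ((antipodeEquiv hS).symm.toLinearMap ∘ₗ B.val.toLinearMap) fun b => hB' b b.2
  have hσ (b : ↥B) : antipode ℂ (σ b : A) = b := antipode_antipodeEquiv_symm hS b
  refine ⟨k, fun i => (antipodeEquiv hS).symm (x i), fun i => σ ∘ₗ f i ∘ₗ antipode ℂ,
    fun i b a => ?_, fun a => ?_⟩
  · refine Subtype.ext (hS.1 ?_)
    have := hf i (antipode ℂ a) ⟨antipode ℂ (b : A), hB b b.2⟩
    simp only at this
    simp [antipode_mul_antidistrib, hσ, this]
  · refine hS.1 ?_
    simpa [antipode_mul_antidistrib, antipode_antipodeEquiv_symm, hσ] using hx (antipode ℂ a)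

end Antipode

/-- Proposition 3.5(1): let `A` be a Hopf algebra with bijective
antipode, `B ⊆ A` a Hopf subalgebra such that `A` is faithfully flat as a left `B`-module,
and suppose there is a non-trivial right `A/B`-integral `t ∈ A`. Then `A/B⁺A` is
finite-dimensional and `A` is finitely generated and projective both as a right and as a
left `B`-module. -/
theorem finite_dim_and_fg_projective {A : Type*} [Ring A] [HopfAlgebra ℂ A]
    (hS : Function.Bijective (HopfAlgebra.antipode (R := ℂ) (A := A)))
    (B : Subalgebra ℂ A) (hB : IsHopfSubalgebra B)
    (hflat : LeftFaithfullyFlat ↥B A)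
    (t : A) (ht : IsRightRelIntegral B t) (htriv : t ∉ BplusA B) :
    FiniteDimensional ℂ (A ⧸ BplusA B) ∧ FGProjRight B ∧ FGProjLeft B := by
  have hB' : ∀ b ∈ B, (antipodeEquiv hS).symm b ∈ B :=
    fun b hb => antipodeEquiv_symm_mem hS hB.1 hflat hb
  have hfin := finiteDimensional_quotient_BplusA hS hB.1 hflat.1 ht htriv
  have := finiteDimensional_quotient_ABplus hS.2 hB.2
  obtain ⟨m, s, q, hq, hz⟩ := exists_generators_baseChange hB.1
  have hright : FGProjRight B := .of_baseChange hflat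
    (fun s x => hflat.1.exists_factorization_right hS hB.2 hB' s x) _ q hq hz
  exact ⟨hfin, hright, hright.fgProjLeft hS hB.2 hB'⟩
end
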